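/- For every ε > 0 there exists a constant C = C(ε) > 0 such that the following holds. Let p be an odd prime, let j < k ≤ 2j be positive integers, set q = p^k and q₀ = p^j, and let χ be an even primitive Dirichlet character of conductor q. Let a_χ be the unique integer with |a_χ| < q/(2q₀) such that χ(1 + q₀ x) = e_{q/q₀}(a_χ x) for all integers x; then p ∤ a_χ, and setting D = (φ(q₀)/2)·(φ(q)/q)·(log q + 2γ + Γ'(1/4)/Γ(1/4) − log π + 2 log p/(p−1)) and A = (φ(q₀)/q₀)·√q·d(|a_χ|)/√|a_χ|, one has | Σ_{ψ mod q₀, ψ(−1)=1} |L(1/2, χ·ψ)|² − D − A | ≤ C q^{−1/8+ε} q₀, where the sum runs over all even Dirichlet characters ψ modulo q₀. -/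

import Mathlib

open Complex

/-- `eN q x = e^{2πix/q}`. -/
noncomputable def eN (q : ℕ) (x : ℤ) : ℂ := Complex.exp (2 * Real.pi * Complex.I * x / q)

section Stepanov

open Polynomial

variable {F : Type*} [Field F]

theorem pow_dvd_hasseDeriv_pow_mul (f r : F[X]) (n k : ℕ) :
    f ^ (n - k) ∣ hasseDeriv k (f ^ n * r) := by
  induction n generalizing k with
  | zero => simp
  | succ n ih =>
    rw [pow_succ', mul_assoc, hasseDeriv_mul]
    refine Finset.dvd_sum fun ij hij => ?_
    rw [Finset.HasAntidiagonal.mem_antidiagonal] at hij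
    rcases Nat.eq_zero_or_pos ij.1 with h0 | h0
    · rw [h0, hasseDeriv_zero']
      have : ij.2 = k := by omega
      rw [this]
      rcases Nat.lt_or_ge n k with hk | hk
      · have : n + 1 - k = 0 := by omega
        simp [this]
      · have : n + 1 - k = (n - k) + 1 := by omega
        rw [this, pow_succ']
        exact mul_dvd_mul_left f (ih k)
    · exact Dvd.dvd.mul_left ((pow_dvd_pow f (by omega)).trans (ih ij.2)) _

theorem exists_hasseDeriv_quotient {f : F[X]} (hf : f ≠ 0) (n k : ℕ) :
    ∃ w : F[X] →ₗ[F] F[X], ∀ r, hasseDeriv k (f ^ n * r) = f ^ (n - k) * w r := by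
  have h : ∀ r, ∃ w, hasseDeriv k (f ^ n * r) = f ^ (n - k) * w := fun r =>
    pow_dvd_hasseDeriv_pow_mul f r n k
  choose w hw using h
  have hfn : f ^ (n - k) ≠ 0 := pow_ne_zero _ hf
  refine ⟨⟨⟨w, fun r s => ?_⟩, fun c r => ?_⟩, hw⟩
  · apply mul_left_cancel₀ hfn
    rw [← hw, mul_add, mul_add, map_add, hw, hw]
  · apply mul_left_cancel₀ hfn
    rw [← hw, mul_smul_comm, map_smul, hw, RingHom.id_apply, mul_smul_comm]

theorem natDegree_hasseDeriv_quotient_le {f r w : F[X]} (hf : f ≠ 0) {n k : ℕ} (hkn : k ≤ n)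
    (h : hasseDeriv k (f ^ n * r) = f ^ (n - k) * w) :
    w.natDegree ≤ r.natDegree + k * f.natDegree := by
  by_cases hw : w = 0
  · simp [hw]
  have h1 : (f ^ (n - k) * w).natDegree = (n - k) * f.natDegree + w.natDegree := by
    rw [natDegree_mul (pow_ne_zero _ hf) hw, natDegree_pow]
  have h2 : (hasseDeriv k (f ^ n * r)).natDegree ≤ n * f.natDegree + r.natDegree := by
    refine (natDegree_hasseDeriv_le _ _).trans ((Nat.sub_le _ _).trans ?_)
    refine natDegree_mul_le.trans ?_
    rw [natDegree_pow]
  rw [h, h1] at h2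
  have h3 : n * f.natDegree = (n - k) * f.natDegree + k * f.natDegree := by
    rw [← add_mul]; congr 1; omega
  omega

/-- If the Hasse derivatives of `h` of order less than `l` vanish at `y`, then `(X - y)^l ∣ h`. -/
theorem X_sub_C_pow_dvd_of_hasseDeriv (h : F[X]) (y : F) (l : ℕ)
    (hk : ∀ k < l, (hasseDeriv k h).eval y = 0) : (X - C y) ^ l ∣ h := by
  have h1 : X ^ l ∣ taylor y h := by
    rw [X_pow_dvd_iff]
    intro d hd
    rw [taylor_coeff]
    exact hk d hd
  obtain ⟨g, hg⟩ := h1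
  refine ⟨taylor (-y) g, ?_⟩
  have h2 := congrArg (taylor (-y)) hg
  rw [taylor_taylor, taylor_mul, taylor_pow, taylor_X] at h2
  simpa [sub_eq_add_neg] using h2

/-- Stepanov's auxiliary polynomial coefficients. -/
theorem stepanov_exists (f : F[X]) (hf : f ≠ 0) (c d l J : ℕ)
    (hcount : l * (d + l * f.natDegree + J) < 2 * (J * d)) :
    ∃ r s : ℕ → F[X], (∀ j, (r j).degree < d) ∧ (∀ j, (s j).degree < d) ∧
      (∃ j < J, r j ≠ 0 ∨ s j ≠ 0) ∧
      ∀ y : F, f.eval y ^ c = -1 → ∀ k < l,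
        (hasseDeriv k (f ^ l * ∑ j ∈ Finset.range J, (r j + s j * f ^ c) * C (y ^ j))).eval y
          = 0 := by
  choose w hw using fun k : ℕ => exists_hasseDeriv_quotient hf l k
  choose w' hw' using fun k : ℕ => exists_hasseDeriv_quotient hf (l + c) k
  set M := d + l * f.natDegree + J with hM
  let P : Fin l → ((Fin J → degreeLT F d) × (Fin J → degreeLT F d)) →ₗ[F] F[X] := fun k =>
    ∑ j : Fin J, (LinearMap.mulRight F ((X : F[X]) ^ (j : ℕ))) ∘ₗ
      ((w k) ∘ₗ (degreeLT F d).subtype ∘ₗ (LinearMap.proj j) ∘ₗ (LinearMap.fst F _ _)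
      - (w' k) ∘ₗ (degreeLT F d).subtype ∘ₗ (LinearMap.proj j) ∘ₗ (LinearMap.snd F _ _))
  have hP : ∀ k v, P k v = ∑ j : Fin J, (w k (v.1 j) - w' k (v.2 j)) * X ^ (j : ℕ) := by
    intro k v
    simp [P, LinearMap.sum_apply]
  let L : ((Fin J → degreeLT F d) × (Fin J → degreeLT F d)) →ₗ[F] (Fin l → Fin M → F) :=
    LinearMap.pi fun k => LinearMap.pi fun i => (lcoeff F (i : ℕ)) ∘ₗ P k
  have : FiniteDimensional F (degreeLT F d) :=
    Module.Finite.equiv (degreeLTEquiv F d).symm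
  have hdim : Module.finrank F (Fin l → Fin M → F)
      < Module.finrank F ((Fin J → degreeLT F d) × (Fin J → degreeLT F d)) := by
    have h1 : Module.finrank F (degreeLT F d) = d := by
      rw [(degreeLTEquiv F d).finrank_eq]; simp
    have h2 : Module.finrank F (Fin J → degreeLT F d) = J * d := by
      simp [Module.finrank_pi_fintype, h1]
    have h3 : Module.finrank F (Fin l → Fin M → F) = l * M := by
      simp [Module.finrank_pi_fintype]
    rw [Module.finrank_prod, h2, h3]
    omega
  have hker := LinearMap.ker_ne_bot_of_finrank_lt (f := L) hdim
  obtain ⟨v, hv, hv0⟩ := (Submodule.ne_bot_iff _).mp hker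
  let ext : (Fin J → degreeLT F d) → ℕ → F[X] := fun u j =>
    if hj : j < J then (u ⟨j, hj⟩ : F[X]) else 0
  have hext : ∀ u j, (ext u j).degree < d := by
    intro u j
    simp only [ext]
    split_ifs with hj
    · exact mem_degreeLT.mp (u ⟨j, hj⟩).2
    · rw [degree_zero]; exact WithBot.bot_lt_coe d
  have hextF : ∀ u (j : Fin J), ext u j = u j := by
    intro u j; simp [ext]
  have hnat : ∀ u : degreeLT F d, (u : F[X]).natDegree ≤ d - 1 := by
    intro u
    have := mem_degreeLT.mp u.2
    by_cases h0 : (u : F[X]) = 0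
    · simp [h0]
    · rw [degree_eq_natDegree h0] at this
      have : (u : F[X]).natDegree < d := by exact_mod_cast this
      omega
  refine ⟨ext v.1, ext v.2, hext _, hext _, ?_, ?_⟩
  · by_contra hcon
    push Not at hcon
    apply hv0
    ext j
    · have := (hcon j j.2).1
      rw [hextF] at this; simp [this]
    · have := (hcon j j.2).2
      rw [hextF] at this; simp [this]
  · intro y hy k hk
    have hPk : P ⟨k, hk⟩ v = 0 := by
      have hJd : 0 < J ∧ 0 < d := by
        constructor
        · by_contra hJ
          have : J = 0 := by omega
          subst this; simp at hcount
        · by_contra hJ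
          have : d = 0 := by omega
          subst this; simp at hcount
      ext i
      by_cases hi : i < M
      · have := congrFun (congrFun (LinearMap.mem_ker.mp hv) ⟨k, hk⟩) ⟨i, hi⟩
        simpa [L] using this
      · rw [coeff_zero]
        apply coeff_eq_zero_of_natDegree_lt
        rw [hP]
        refine lt_of_le_of_lt (natDegree_sum_le_of_forall_le (n := d - 1 + k * f.natDegree + (J - 1))
          _ _ ?_) ?_
        · intro j _
          refine natDegree_mul_le.trans ?_
          rw [natDegree_X_pow]
          have h1 := natDegree_hasseDeriv_quotient_le hf hk.le (hw k (v.1 j))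
          have h2 := natDegree_hasseDeriv_quotient_le hf (by omega) (hw' k (v.2 j))
          have h3 := natDegree_sub_le (w k (v.1 j)) (w' k (v.2 j))
          have h4 := hnat (v.1 j)
          have h5 := hnat (v.2 j)
          have h6 := max_le (h1.trans (Nat.add_le_add_right h4 _))
            (h2.trans (Nat.add_le_add_right h5 _))
          have h7 := h3.trans h6
          have := j.2
          simp only at h7 ⊢
          omega
        · have : k * f.natDegree ≤ l * f.natDegree := Nat.mul_le_mul_right _ hk.le
          omega
    rw [Finset.mul_sum, map_sum, eval_finsetSum, Finset.sum_range]
    have hterm : ∀ j : Fin J, eval y (hasseDeriv k (f ^ l *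
        ((ext v.1 j + ext v.2 j * f ^ c) * C (y ^ (j : ℕ)))))
        = eval y f ^ (l - k) * eval y ((w k (v.1 j) - w' k (v.2 j)) * X ^ (j : ℕ)) := by
      intro j
      rw [hextF, hextF]
      have e1 : f ^ l * (((v.1 j : F[X]) + (v.2 j : F[X]) * f ^ c) * C (y ^ (j : ℕ)))
          = (y ^ (j : ℕ)) • (f ^ l * (v.1 j : F[X]) + f ^ (l + c) * (v.2 j : F[X])) := by
        rw [smul_eq_C_mul]; ring
      have e2 : l + c - k = (l - k) + c := by omega
      rw [e1, map_smul, map_add, hw, hw', e2, pow_add]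
      simp only [eval_smul, eval_add, eval_mul, eval_pow, hy, smul_eq_mul, eval_sub, eval_X]
      ring
    simp_rw [hterm]
    rw [← Finset.mul_sum, ← eval_finsetSum, ← hP ⟨k, hk⟩ v, hPk]
    simp

variable [Fintype F]

/-- Linear independence of the powers of `X ^ q` over small polynomials in Stepanov's method. -/
theorem stepanov_independent (f : F[X]) {c m d : ℕ} (hq : Fintype.card F = 2 * c + 1)
    (hm : f.natDegree ≤ m) (hmd : m + 2 * d ≤ Fintype.card F) (hf0 : f.coeff 0 ≠ 0)
    (hsq : ∀ r s : F[X], f * r ^ 2 = C (f.coeff 0) * s ^ 2 → r = 0)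
    (J : ℕ) (r s : ℕ → F[X]) (hr : ∀ j, (r j).degree < d) (hs : ∀ j, (s j).degree < d)
    (h : ∑ j ∈ Finset.range J, (r j + s j * f ^ c) * X ^ (j * Fintype.card F) = 0) :
    ∀ j < J, r j = 0 ∧ s j = 0 := by
  set q := Fintype.card F with hqdef
  induction J generalizing r s with
  | zero => intro j hj; omega
  | succ J ih =>
    have hqpos : 0 < q := Fintype.card_pos
    rw [Finset.sum_range_succ'] at h
    set A := ∑ j ∈ Finset.range J, r (j + 1) * X ^ (j * q) with hA
    set B := ∑ j ∈ Finset.range J, s (j + 1) * X ^ (j * q) with hB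
    have hAB : ∑ j ∈ Finset.range J, (r (j + 1) + s (j + 1) * f ^ c) * X ^ ((j + 1) * q)
        = X ^ q * (A + B * f ^ c) := by
      rw [hA, hB, Finset.sum_mul, ← Finset.sum_add_distrib, Finset.mul_sum]
      refine Finset.sum_congr rfl fun j _ => ?_
      ring
    rw [hAB] at h
    simp only [zero_mul, pow_zero, mul_one] at h
    -- `r 0 + X^q A = -f^c (s 0 + X^q B)`
    have hexp : f ^ q = C (f.coeff 0) + X ^ q * (expand F q f.divX) := by
      rw [← FiniteField.expand_card]
      conv_lhs => rw [← divX_mul_X_add f]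
      rw [map_add, map_mul, expand_X, expand_C]
      ring
    have key : X ^ q ∣ f * r 0 ^ 2 - C (f.coeff 0) * s 0 ^ 2 := by
      have e1 : r 0 = -(X ^ q * A) - f ^ c * (s 0 + X ^ q * B) := by
        linear_combination h
      have e2 : f * (r 0 + X ^ q * A) ^ 2 = f ^ q * (s 0 + X ^ q * B) ^ 2 := by
        have : r 0 + X ^ q * A = - f ^ c * (s 0 + X ^ q * B) := by linear_combination e1
        rw [this, hq]; ring
      rw [hexp] at e2
      refine ⟨-(2 * f * r 0 * A + f * X ^ q * A ^ 2) + (C (f.coeff 0)) * (2 * s 0 * B +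
        X ^ q * B ^ 2) + expand F q f.divX * (s 0 + X ^ q * B) ^ 2, ?_⟩
      linear_combination e2
    have hdeg : ∀ u : F[X], u.degree < d → u.natDegree ≤ d - 1 ∧ (u = 0 ∨ 0 < d) := by
      intro u hu
      by_cases h0 : u = 0
      · simp [h0]
      · rw [degree_eq_natDegree h0] at hu
        have : u.natDegree < d := by exact_mod_cast hu
        omega
    have hzero : f * r 0 ^ 2 - C (f.coeff 0) * s 0 ^ 2 = 0 := by
      by_contra hne
      have h1 := natDegree_le_of_dvd key hne
      rw [natDegree_X_pow] at h1
      have hr0 := hdeg _ (hr 0)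
      have hs0 := hdeg _ (hs 0)
      have h2 : (f * r 0 ^ 2 - C (f.coeff 0) * s 0 ^ 2).natDegree ≤ m + 2 * (d - 1) := by
        refine (natDegree_sub_le _ _).trans (max_le ?_ ?_)
        · refine natDegree_mul_le.trans ?_
          have := natDegree_pow_le (p := r 0) (n := 2)
          omega
        · refine natDegree_mul_le.trans ?_
          have := natDegree_pow_le (p := s 0) (n := 2)
          rw [natDegree_C]
          omega
      rcases Nat.eq_zero_or_pos d with hd | hd
      · have a1 : r 0 = 0 := by
          rcases hr0.2 with h | h
          · exact h
          · omega
        have a2 : s 0 = 0 := by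
          rcases hs0.2 with h | h
          · exact h
          · omega
        apply hne; simp [a1, a2]
      · omega
    have hr00 : r 0 = 0 := hsq _ _ (sub_eq_zero.mp hzero)
    have hs00 : s 0 = 0 := by
      rw [hr00] at hzero
      have : C (f.coeff 0) * s 0 ^ 2 = 0 := by linear_combination -hzero
      rcases mul_eq_zero.mp this with h | h
      · exact absurd (C_eq_zero.mp h) hf0
      · exact pow_eq_zero_iff (two_ne_zero) |>.mp h
    rw [hr00, hs00] at h
    have h' : A + B * f ^ c = 0 := by
      have hX : (X : F[X]) ^ q ≠ 0 := pow_ne_zero _ X_ne_zero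
      have : X ^ q * (A + B * f ^ c) = 0 := by linear_combination h
      exact (mul_eq_zero.mp this).resolve_left hX
    have := ih (fun j => r (j + 1)) (fun j => s (j + 1)) (fun j => hr _) (fun j => hs _) (by
      rw [hA, hB, Finset.sum_mul, ← Finset.sum_add_distrib] at h'
      rw [← h']
      refine Finset.sum_congr rfl fun j _ => ?_
      ring)
    intro j hj
    rcases j with _ | j
    · exact ⟨hr00, hs00⟩
    · exact this j (by omega)

theorem stepanov_bound [DecidableEq F] (f : F[X]) {c d l J : ℕ}
    (hq : Fintype.card F = 2 * c + 1) (hl : l ≤ Fintype.card F)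
    (hmd : f.natDegree + 2 * d ≤ Fintype.card F) (hf0 : f.coeff 0 ≠ 0)
    (hsq : ∀ r s : F[X], f * r ^ 2 = C (f.coeff 0) * s ^ 2 → r = 0)
    (hcount : l * (d + l * f.natDegree + J) < 2 * (J * d)) :
    (Finset.univ.filter fun y : F => f.eval y ^ c = -1).card * l
      ≤ l * f.natDegree + (d + c * f.natDegree) + J * Fintype.card F := by
  have hf : f ≠ 0 := by rintro rfl; simp at hf0
  obtain ⟨r, s, hr, hs, ⟨j0, hj0, hne⟩, hvan⟩ := stepanov_exists f hf c d l J hcount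
  set q := Fintype.card F with hqdef
  set S := Finset.univ.filter fun y : F => f.eval y ^ c = -1 with hS
  set R := f ^ l * ∑ j ∈ Finset.range J, (r j + s j * f ^ c) * X ^ (j * q) with hR
  have hR0 : R ≠ 0 := by
    intro h0
    have h1 := (mul_eq_zero.mp h0).resolve_left (pow_ne_zero _ hf)
    have := stepanov_independent f hq le_rfl hmd hf0 hsq J r s hr hs h1 j0 hj0
    rcases hne with h | h
    · exact h this.1
    · exact h this.2
  obtain ⟨p, hp⟩ := CharP.exists F
  obtain ⟨n, hpp, hn⟩ := FiniteField.card F p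
  have : Fact p.Prime := ⟨hpp⟩
  have hdvd : ∀ y ∈ S, (X - C y) ^ l ∣ R := by
    intro y hy
    have hyc : f.eval y ^ c = -1 := by simpa [hS] using hy
    have h1 := X_sub_C_pow_dvd_of_hasseDeriv _ y l (hvan y hyc)
    have h2 : (X - C y) ^ l ∣ ∑ j ∈ Finset.range J, (r j + s j * f ^ c) *
        (X ^ (j * q) - C (y ^ j)) := by
      refine Finset.dvd_sum fun j _ => Dvd.dvd.mul_left ?_ _
      have h3 : (X - C y) ^ q = X ^ q - C y := by
        rw [hqdef, hn, sub_pow_char_pow, ← C_pow, ← hn, FiniteField.pow_card]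
      refine (pow_dvd_pow _ hl).trans ?_
      rw [h3, mul_comm j q, pow_mul, C_pow]
      exact sub_dvd_pow_sub_pow _ _ _
    have h4 : R = f ^ l * (∑ j ∈ Finset.range J, (r j + s j * f ^ c) * C (y ^ j))
        + f ^ l * ∑ j ∈ Finset.range J, (r j + s j * f ^ c) * (X ^ (j * q) - C (y ^ j)) := by
      rw [hR, ← mul_add, ← Finset.sum_add_distrib]
      congr 1
      refine Finset.sum_congr rfl fun j _ => ?_
      ring
    rw [h4]
    exact dvd_add h1 (Dvd.dvd.mul_left h2 _)
  have hprod : ∏ y ∈ S, (X - C y) ^ l ∣ R := by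
    refine Finset.prod_dvd_of_coprime ?_ hdvd
    intro a _ b _ hab
    exact (isCoprime_X_sub_C_of_isUnit_sub (sub_ne_zero.mpr hab).isUnit).pow
  have h1 := natDegree_le_of_dvd hprod hR0
  rw [natDegree_prod_of_monic _ _ (fun y _ => (monic_X_sub_C y).pow l)] at h1
  simp only [natDegree_pow, natDegree_X_sub_C, mul_one, Finset.sum_const, smul_eq_mul] at h1
  refine h1.trans ?_
  have hnat : ∀ u : F[X], u.degree < d → u.natDegree ≤ d := by
    intro u hu
    exact natDegree_le_of_degree_le hu.le
  refine natDegree_mul_le.trans ?_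
  rw [natDegree_pow]
  rw [add_assoc]
  refine Nat.add_le_add_left (natDegree_sum_le_of_forall_le _ _ ?_) _
  intro j hj
  have hj := Finset.mem_range.mp hj
  refine natDegree_mul_le.trans ?_
  rw [natDegree_X_pow]
  refine Nat.add_le_add ?_ (Nat.mul_le_mul_right _ hj.le)
  refine (natDegree_add_le _ _).trans (max_le ((hnat _ (hr j)).trans (by omega)) ?_)
  refine natDegree_mul_le.trans ?_
  rw [natDegree_pow]
  exact Nat.add_le_add_right (hnat _ (hs j)) _

end Stepanov

section ArtinSchreierCount

open Polynomial

variable {F : Type*} [Field F] {p : ℕ}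

theorem natDegree_X_pow_sub_X_sq_sub_C [Fact p.Prime] (b : F) :
    ((X ^ p - X : F[X]) ^ 2 - C (4 * b)).natDegree = 2 * p := by
  have hp := (Fact.out : p.Prime).one_lt
  have h1 : (X ^ p - X : F[X]).natDegree = p := FiniteField.X_pow_card_sub_X_natDegree_eq F hp
  rw [natDegree_sub_C, natDegree_pow, h1]

theorem separable_X_pow_sub_X_sq_sub_C [CharP F p] (hp2 : p ≠ 2) {b : F} (hb : b ≠ 0) :
    ((X ^ p - X : F[X]) ^ 2 - C (4 * b)).Separable := by
  have h2 : (2 : F) ≠ 0 := Ring.two_ne_zero (by rwa [ringChar.eq F p])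
  have hder : derivative ((X ^ p - X : F[X]) ^ 2 - C (4 * b)) = -2 * (X ^ p - X) := by
    rw [derivative_sub, derivative_C, derivative_pow, derivative_sub, derivative_X_pow]
    have h3 : C (2 : F) = (2 : F[X]) := map_ofNat C 2
    simp [h3]
  refine ⟨C (-1 / (4 * b)), C (-1 / (8 * b)) * (X ^ p - X), ?_⟩
  rw [hder]
  have e1 : C (-1 / (4 * b)) = C (-1 / (8 * b)) * (2 : F[X]) := by
    have h3 : (2 : F[X]) = C (2 : F) := (map_ofNat C 2).symm
    rw [h3, ← C_mul]; congr 1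
    have : (8 : F) = 4 * 2 := by norm_num
    rw [this]; field_simp
  have e2 : (C (-1 / (8 * b)) * 2 : F[X]) * C (4 * b) = -1 := by
    rw [← e1, ← C_mul, ← C_1, ← C_neg]; congr 1
    have : (4 : F) ≠ 0 := by
      rw [show (4 : F) = 2 * 2 by norm_num]; exact mul_ne_zero h2 h2
    field_simp
  rw [e1]
  linear_combination -e2

theorem eq_zero_of_mul_sq_eq_C_mul_sq {f : F[X]} (hf : Squarefree f) (hdeg : 0 < f.natDegree)
    {c : F} (hc : c ≠ 0) {r s : F[X]} (h : f * r ^ 2 = C c * s ^ 2) : r = 0 := by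
  by_contra hr
  have hdvd : r ^ 2 ∣ s ^ 2 := by
    have : s ^ 2 = C c⁻¹ * (f * r ^ 2) := by
      rw [h, ← mul_assoc, ← C_mul, inv_mul_cancel₀ hc, C_1, one_mul]
    rw [this, ← mul_assoc]
    exact dvd_mul_left _ _
  rw [UniqueFactorizationMonoid.pow_dvd_pow_iff_dvd two_ne_zero] at hdvd
  obtain ⟨t, rfl⟩ := hdvd
  have h1 : f = C c * t ^ 2 := by
    apply mul_right_cancel₀ (pow_ne_zero 2 hr)
    rw [h]; ring
  have ht : IsUnit t := hf t ⟨C c, by rw [h1]; ring⟩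
  have : IsUnit f := by
    rw [h1]
    exact (isUnit_C.mpr hc.isUnit).mul (ht.pow 2)
  rw [natDegree_eq_zero_of_isUnit this] at hdeg
  exact lt_irrefl _ hdeg

variable [Fact p.Prime] [CharP F p] [Fintype F] [DecidableEq F]

/-- Stepanov's bound for the number of `y` with `(y^p - y)² - 4b` a nonsquare. -/
theorem two_mul_card_nonsquare_le (hp2 : p ≠ 2) {b : F} (hb : b ≠ 0) {r : ℕ} (hr : 4 ≤ r)
    (hcard : Fintype.card F = (p ^ r) ^ 2) :
    2 * (Finset.univ.filter fun y : F =>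
      ((y ^ p - y) ^ 2 - 4 * b) ^ (((p ^ r) ^ 2) / 2) = -1).card
      ≤ (p ^ r) ^ 2 + (6 * p + 5) * p ^ r := by
  have hp := (Fact.out : p.Prime)
  have hp3 : 3 ≤ p := by have := hp.two_le; omega
  set s := p ^ r with hs
  have hodd : Odd s := (hp.odd_of_ne_two hp2).pow
  obtain ⟨u, hu⟩ := hodd
  have hs10 : 10 * p ≤ s := by
    have : p ^ 4 ≤ s := Nat.pow_le_pow_right hp.pos hr
    have h3 : 3 ^ 3 ≤ p ^ 3 := Nat.pow_le_pow_left hp3 3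
    nlinarith [pow_succ p 3]
  set c := s ^ 2 / 2 with hc
  have hc' : s ^ 2 = 2 * c + 1 := by
    have : s ^ 2 = 2 * (2 * u * u + 2 * u) + 1 := by rw [hu]; ring
    omega
  have h2 : (2 : F) ≠ 0 := Ring.two_ne_zero (by rwa [ringChar.eq F p])
  have h4 : (4 : F) ≠ 0 := by
    rw [show (4 : F) = 2 * 2 by norm_num]; exact mul_ne_zero h2 h2
  set f : F[X] := (X ^ p - X : F[X]) ^ 2 - C (4 * b) with hf
  have hdeg : f.natDegree = 2 * p := natDegree_X_pow_sub_X_sq_sub_C b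
  have hf0 : f.coeff 0 = -(4 * b) := by
    rw [coeff_zero_eq_eval_zero, hf]
    simp [hp.ne_zero]
  have hf0' : f.coeff 0 ≠ 0 := by rw [hf0]; exact neg_ne_zero.mpr (mul_ne_zero h4 hb)
  have hpc : p + 1 ≤ c := by nlinarith
  obtain ⟨d, hd⟩ : ∃ d, c = d + p := ⟨c - p, by omega⟩
  have hkey := stepanov_bound f (c := c) (d := d) (l := s) (J := u + (2 * p + 2))
    (by rw [hcard, hc']) (by rw [hcard]; nlinarith) (by rw [hdeg, hcard, hc']; omega) hf0'
    (fun a b h => eq_zero_of_mul_sq_eq_C_mul_sq (separable_X_pow_sub_X_sq_sub_C hp2 hb).squarefree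
      (by rw [hdeg]; omega) hf0' h)
    (by rw [hdeg]; zify at *; nlinarith)
  have hset : (Finset.univ.filter fun y : F => f.eval y ^ c = -1)
      = (Finset.univ.filter fun y : F => ((y ^ p - y) ^ 2 - 4 * b) ^ c = -1) := by
    ext y; simp [hf]
  rw [hset, hdeg, hcard] at hkey
  set N := (Finset.univ.filter fun y : F => ((y ^ p - y) ^ 2 - 4 * b) ^ c = -1).card
  have hspos : 0 < s := by omega
  refine Nat.le_of_mul_le_mul_right ?_ hspos
  zify at *
  nlinarith

/-- Lower bound for the number of points with `Tr (x + b / x) = 0`. -/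
theorem card_trace_add_mul_inv_eq_zero_ge [Algebra (ZMod p) F] (hp2 : p ≠ 2) {b : F} (hb : b ≠ 0)
    {r : ℕ} (hr : 4 ≤ r) (hcard : Fintype.card F = (p ^ r) ^ 2) :
    (p ^ r) ^ 2 ≤ p * (Finset.univ.filter fun x : F =>
      x ≠ 0 ∧ Algebra.trace (ZMod p) F (x + b * x⁻¹) = 0).card + (6 * p + 6) * p ^ r := by
  classical
  have hp := (Fact.out : p.Prime)
  have h2 : (2 : F) ≠ 0 := Ring.two_ne_zero (by rwa [ringChar.eq F p])
  set T := Finset.univ.filter fun x : F =>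
      x ≠ 0 ∧ Algebra.trace (ZMod p) F (x + b * x⁻¹) = 0 with hT
  set W := Finset.univ.filter fun v : F × F => v.1 ≠ 0 ∧ v.1 + b * v.1⁻¹ = v.2 ^ p - v.2 with hW
  set g : F → F := fun y => (y ^ p - y) ^ 2 - 4 * b with hg
  set s := p ^ r with hs
  set Nm := Finset.univ.filter fun y : F => g y ^ (s ^ 2 / 2) = -1 with hNm
  set N0 := Finset.univ.filter fun y : F => g y = 0 with hN0
  have hupper : W.card ≤ p * T.card := by
    have hmaps : ∀ v ∈ W, v.1 ∈ T := by
      intro v hv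
      simp only [hW, hT, Finset.mem_filter, Finset.mem_univ, true_and] at hv ⊢
      refine ⟨hv.1, ?_⟩
      rw [hv.2, map_sub, sub_eq_zero]
      have := Algebra.trace_eq_of_algEquiv (FiniteField.frobeniusAlgEquiv (ZMod p) F p) v.2
      simpa [ZMod.card] using this
    refine Finset.card_le_mul_card_image_of_maps_to hmaps p ?_
    intro x _
    set P : F[X] := X ^ p - X - C (x + b * x⁻¹) with hP
    have hdegP : P.natDegree = p := by
      rw [hP, natDegree_sub_C, FiniteField.X_pow_card_sub_X_natDegree_eq F hp.one_lt]
    have hP0 : P ≠ 0 := by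
      rintro h0; rw [h0, natDegree_zero] at hdegP; exact hp.ne_zero hdegP.symm
    refine le_trans ?_ (hdegP ▸ card_roots' P)
    refine le_trans ?_ (Multiset.toFinset_card_le _)
    refine Finset.card_le_card_of_injOn Prod.snd ?_ ?_
    · intro v hv
      simp only [hW, Finset.coe_filter, Finset.mem_filter, Finset.mem_univ, true_and,
        Set.mem_ofPred_eq] at hv
      obtain ⟨⟨h0, h1⟩, h3⟩ := hv
      simp only [Multiset.mem_toFinset, Finset.mem_coe]
      rw [mem_roots hP0, IsRoot, hP]
      simp only [eval_sub, eval_pow, eval_X, eval_C]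
      rw [← h3, h1, sub_self]
    · intro v hv w hw h
      simp only [Finset.coe_filter, Set.mem_ofPred_eq] at hv hw
      exact Prod.ext (hv.2.trans hw.2.symm) h
  have hlower : 2 * (Finset.univ \ (Nm ∪ N0)).card ≤ W.card := by
    have hmaps : ∀ v ∈ W.filter (fun v => v.2 ∈ Finset.univ \ (Nm ∪ N0)),
        v.2 ∈ Finset.univ \ (Nm ∪ N0) := by
      intro v hv; exact (Finset.mem_filter.mp hv).2
    refine le_trans ?_ (Finset.card_filter_le W (fun v => v.2 ∈ Finset.univ \ (Nm ∪ N0)))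
    refine Finset.mul_card_image_le_card_of_maps_to hmaps 2 ?_
    intro y hy
    simp only [Finset.mem_sdiff, Finset.mem_univ, true_and, Finset.mem_union, not_or] at hy
    obtain ⟨hy1, hy2⟩ := hy
    have hy0 : g y ≠ 0 := by simpa [hN0] using hy2
    have hsq : IsSquare (g y) := by
      have h3 := FiniteField.pow_dichotomy (F := F) (by rwa [ringChar.eq F p]) hy0
      rw [hcard] at h3
      rw [FiniteField.isSquare_iff (by rwa [ringChar.eq F p]) hy0, hcard]
      rcases h3 with h3 | h3
      · exact h3
      · exact absurd (by simpa [hNm] using h3) hy1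
    obtain ⟨z, hz⟩ := hsq
    have hz0 : z ≠ 0 := by rintro rfl; simp at hz; exact hy0 hz
    have hmem : ∀ w : F, w * w = g y → ((y ^ p - y + w) / 2, y) ∈
        (W.filter (fun v => v.2 ∈ Finset.univ \ (Nm ∪ N0))).filter (fun v => v.2 = y) := by
      intro w hw
      have hprod : (y ^ p - y + w) / 2 * ((y ^ p - y - w) / 2) = b := by
        have h4 : (4 : F) ≠ 0 := by
          rw [show (4 : F) = 2 * 2 by norm_num]; exact mul_ne_zero h2 h2
        have : (y ^ p - y + w) / 2 * ((y ^ p - y - w) / 2) = ((y ^ p - y) ^ 2 - w * w) / 4 := by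
          field_simp; ring
        rw [this, hw, hg]; field_simp; ring
      have hne : (y ^ p - y + w) / 2 ≠ 0 := by
        intro h0; rw [h0, zero_mul] at hprod; exact hb hprod.symm
      simp only [hW, Finset.mem_filter, Finset.mem_univ, true_and, Finset.mem_sdiff,
        Finset.mem_union, not_or, and_true]
      refine ⟨⟨hne, ?_⟩, hy1, hy2⟩
      have : b * ((y ^ p - y + w) / 2)⁻¹ = (y ^ p - y - w) / 2 := by
        conv_lhs => rw [← hprod]
        rw [mul_comm, ← mul_assoc, inv_mul_cancel₀ hne, one_mul]
      rw [this]; field_simp; ring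
    have h1 := hmem z hz.symm
    have h3 := hmem (-z) (by rw [hz]; ring)
    have hne : ((y ^ p - y + z) / 2, y) ≠ ((y ^ p - y + -z) / 2, y) := by
      intro h
      have h5 := (Prod.ext_iff.mp h).1
      have h6 : (y ^ p - y + z) = (y ^ p - y + -z) := by
        simpa [div_left_inj' h2] using h5
      have h7 : 2 * z = 0 := by linear_combination h6
      exact hz0 ((mul_eq_zero.mp h7).resolve_left h2)
    rw [← Finset.card_pair hne]
    refine Finset.card_le_card ?_
    intro v hv
    rcases Finset.mem_insert.mp hv with rfl | hv
    · exact h1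
    · rw [Finset.mem_singleton.mp hv]; exact h3
  have hN0 : N0.card ≤ 2 * p := by
    have hdegP := natDegree_X_pow_sub_X_sq_sub_C (p := p) b
    set P : F[X] := (X ^ p - X : F[X]) ^ 2 - C (4 * b) with hP
    have hP0 : P ≠ 0 := by
      rintro h0; rw [h0, natDegree_zero] at hdegP; have := hp.pos; omega
    refine le_trans ?_ (hdegP ▸ card_roots' P)
    refine le_trans (Finset.card_le_card ?_) (Multiset.toFinset_card_le _)
    intro y hy
    rw [Multiset.mem_toFinset, mem_roots hP0, IsRoot, hP]
    simpa [hN0, hg] using hy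
  have hNmle := two_mul_card_nonsquare_le hp2 hb hr hcard
  have hcomp : s ^ 2 ≤ (Finset.univ \ (Nm ∪ N0)).card + (Nm.card + N0.card) := by
    have h1 : (Finset.univ \ (Nm ∪ N0)).card + (Nm ∪ N0).card = Fintype.card F := by
      rw [Finset.card_sdiff_add_card_eq_card (Finset.subset_univ _), Finset.card_univ]
    have := Finset.card_union_le Nm N0
    omega
  have hs10 : 4 * p ≤ s := by
    have : p ^ 4 ≤ s := Nat.pow_le_pow_right hp.pos hr
    have h3 : 2 ^ 3 ≤ p ^ 3 := Nat.pow_le_pow_left hp.two_le 3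
    nlinarith [pow_succ p 3]
  have e1 : (6 * p + 6) * s = (6 * p + 5) * s + s := by ring
  rw [e1]
  have : 2 * Nm.card ≤ s ^ 2 + (6 * p + 5) * s := hNmle
  omega

end ArtinSchreierCount

section MonicPolynomials

open Polynomial

variable {k : Type*} [Field k]

open Classical in
theorem card_filter_pow_dvd {f P : k[X]} (hf : f.Monic) (hP : P.Monic) (hPi : Irreducible P) :
    ((Finset.Icc 1 f.natDegree).filter
      fun i => P.natDegree ∣ i ∧ P ^ (i / P.natDegree) ∣ f).card
      = Multiset.count P (UniqueFactorizationMonoid.normalizedFactors f) := by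
  set m := Multiset.count P (UniqueFactorizationMonoid.normalizedFactors f) with hm
  have hdeg : 0 < P.natDegree := hPi.natDegree_pos
  have hcount : ∀ j : ℕ, P ^ j ∣ f ↔ j ≤ m := by
    intro j
    rw [pow_dvd_iff_le_emultiplicity,
      UniqueFactorizationMonoid.emultiplicity_eq_count_normalizedFactors hPi hf.ne_zero,
      hP.normalize_eq_self, Nat.cast_le]
  have : ((Finset.Icc 1 f.natDegree).filter
      fun i => P.natDegree ∣ i ∧ P ^ (i / P.natDegree) ∣ f)
      = (Finset.Icc 1 m).image (fun j => j * P.natDegree) := by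
    ext i
    simp only [Finset.mem_filter, Finset.mem_Icc, Finset.mem_image]
    constructor
    · rintro ⟨⟨h1, h2⟩, ⟨j, rfl⟩, h4⟩
      rw [Nat.mul_div_cancel_left _ hdeg, hcount] at h4
      refine ⟨j, ⟨?_, h4⟩, mul_comm _ _⟩
      exact Nat.pos_of_ne_zero (by rintro rfl; simp at h1)
    · rintro ⟨j, ⟨h1, h2⟩, rfl⟩
      have h3 : P ^ j ∣ f := (hcount j).mpr h2
      refine ⟨⟨Nat.mul_pos h1 hdeg, ?_⟩, dvd_mul_left _ _, ?_⟩
      · have := natDegree_le_of_dvd h3 hf.ne_zero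
        rwa [natDegree_pow] at this
      · rwa [Nat.mul_div_cancel _ hdeg]
  rw [this, Finset.card_image_of_injective _ (mul_left_injective₀ hdeg.ne')]
  simp

variable (k) [Finite k]

theorem finite_setOf_natDegree_le (d : ℕ) : {f : k[X] | f.natDegree ≤ d}.Finite := by
  refine Set.Finite.of_injOn (f := fun f => fun i : Fin (d + 1) => f.coeff i)
    (t := Set.univ) (fun _ _ => Set.mem_univ _) ?_ Set.finite_univ
  intro f hf g hg h
  ext i
  by_cases hi : i < d + 1
  · exact congrFun h ⟨i, hi⟩
  · rw [coeff_eq_zero_of_natDegree_lt (lt_of_le_of_lt hf (by omega)),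
      coeff_eq_zero_of_natDegree_lt (lt_of_le_of_lt hg (by omega))]

/-- Monic polynomials of degree `d` over a finite field. -/
noncomputable def monicsOfDegree (d : ℕ) : Finset k[X] :=
  ((finite_setOf_natDegree_le k d).subset (t := {f : k[X] | f.Monic ∧ f.natDegree = d})
    (fun _ hf => hf.2.le)).toFinset

/-- Monic irreducible polynomials of degree at most `N` over a finite field. -/
noncomputable def irreducibleMonics (N : ℕ) : Finset k[X] :=
  ((finite_setOf_natDegree_le k N).subset
    (t := {f : k[X] | f.Monic ∧ Irreducible f ∧ f.natDegree ≤ N}) (fun _ hf => hf.2.2)).toFinset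

variable {k}

theorem mem_monicsOfDegree {d : ℕ} {f : k[X]} :
    f ∈ monicsOfDegree k d ↔ f.Monic ∧ f.natDegree = d := by
  rw [monicsOfDegree, Set.Finite.mem_toFinset, Set.mem_ofPred_eq]

theorem mem_irreducibleMonics {N : ℕ} {f : k[X]} :
    f ∈ irreducibleMonics k N ↔ f.Monic ∧ Irreducible f ∧ f.natDegree ≤ N := by
  rw [irreducibleMonics, Set.Finite.mem_toFinset, Set.mem_ofPred_eq]

open Classical in
theorem natDegree_eq_sum_irreducibleMonics {f : k[X]} (hf : f.Monic) {N : ℕ}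
    (hN : f.natDegree ≤ N) :
    f.natDegree = ∑ i ∈ Finset.Icc 1 f.natDegree, ∑ P ∈ irreducibleMonics k N,
      if P.natDegree ∣ i ∧ P ^ (i / P.natDegree) ∣ f then P.natDegree else 0 := by
  rw [Finset.sum_comm]
  have h1 : ∀ P ∈ irreducibleMonics k N, (∑ i ∈ Finset.Icc 1 f.natDegree,
      if P.natDegree ∣ i ∧ P ^ (i / P.natDegree) ∣ f then P.natDegree else 0)
      = Multiset.count P (UniqueFactorizationMonoid.normalizedFactors f) * P.natDegree := by
    intro P hP
    rw [mem_irreducibleMonics] at hP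
    rw [← Finset.sum_filter, Finset.sum_const, card_filter_pow_dvd hf hP.1 hP.2.1, smul_eq_mul]
  rw [Finset.sum_congr rfl h1]
  have hprod : f = (UniqueFactorizationMonoid.normalizedFactors f).prod := by
    have := UniqueFactorizationMonoid.prod_normalizedFactors_eq hf.ne_zero
    rw [hf.normalize_eq_self] at this
    exact this.symm
  have hmonic : ∀ P ∈ UniqueFactorizationMonoid.normalizedFactors f, P.Monic ∧ Irreducible P ∧
      P ∣ f := by
    intro P hP
    have h2 := UniqueFactorizationMonoid.irreducible_of_normalized_factor P hP
    have h3 := UniqueFactorizationMonoid.normalize_normalized_factor P hP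
    exact ⟨h3 ▸ monic_normalize h2.ne_zero, h2,
      UniqueFactorizationMonoid.dvd_of_mem_normalizedFactors hP⟩
  conv_lhs => rw [hprod]
  rw [natDegree_multiset_prod_of_monic _ (fun P hP => (hmonic P hP).1),
    Finset.sum_multiset_map_count]
  simp only [smul_eq_mul]
  refine Finset.sum_subset ?_ ?_
  · intro P hP
    rw [Multiset.mem_toFinset] at hP
    rw [mem_irreducibleMonics]
    exact ⟨(hmonic P hP).1, (hmonic P hP).2.1,
      (natDegree_le_of_dvd (hmonic P hP).2.2 hf.ne_zero).trans hN⟩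
  · intro P _ hP
    rw [Multiset.mem_toFinset] at hP
    rw [Multiset.count_eq_zero_of_notMem hP, zero_mul]

open Classical in
/-- Newton's identities for the `L`-function of a multiplicative function on monic polynomials. -/
theorem natCast_mul_sum_monicsOfDegree (χ : k[X] → ℂ) (h1 : χ 1 = 1)
    (hmul : ∀ f g : k[X], f.Monic → g.Monic → χ (f * g) = χ f * χ g) {d N : ℕ} (hN : d ≤ N) :
    (d : ℂ) * ∑ f ∈ monicsOfDegree k d, χ f = ∑ i ∈ Finset.Icc 1 d,
      (∑ P ∈ irreducibleMonics k N,
        if P.natDegree ∣ i then (P.natDegree : ℂ) * χ P ^ (i / P.natDegree) else 0) *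
      ∑ f ∈ monicsOfDegree k (d - i), χ f := by
  have hpow : ∀ (P : k[X]) (j : ℕ), P.Monic → χ (P ^ j) = χ P ^ j := by
    intro P j hP
    induction j with
    | zero => simp [h1]
    | succ j ih => rw [pow_succ, hmul _ _ (hP.pow j) hP, ih, pow_succ]
  have e1 : (d : ℂ) * ∑ f ∈ monicsOfDegree k d, χ f = ∑ i ∈ Finset.Icc 1 d,
      ∑ P ∈ irreducibleMonics k N, ∑ f ∈ monicsOfDegree k d,
        if P.natDegree ∣ i ∧ P ^ (i / P.natDegree) ∣ f then (P.natDegree : ℂ) * χ f else 0 := by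
    rw [Finset.mul_sum]
    have : ∀ f ∈ monicsOfDegree k d, (d : ℂ) * χ f = ∑ i ∈ Finset.Icc 1 d,
        ∑ P ∈ irreducibleMonics k N,
        if P.natDegree ∣ i ∧ P ^ (i / P.natDegree) ∣ f then (P.natDegree : ℂ) * χ f else 0 := by
      intro f hf
      rw [mem_monicsOfDegree] at hf
      have h2 := natDegree_eq_sum_irreducibleMonics hf.1 (N := N) (hf.2.le.trans hN)
      rw [hf.2] at h2
      have h3 := congrArg (fun n : ℕ => (n : ℂ) * χ f) h2
      simp only [Nat.cast_sum, Finset.sum_mul] at h3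
      rw [h3]
      refine Finset.sum_congr rfl fun i _ => Finset.sum_congr rfl fun P _ => ?_
      split_ifs <;> simp
    rw [Finset.sum_congr rfl this, Finset.sum_comm]
    refine Finset.sum_congr rfl fun i _ => ?_
    rw [Finset.sum_comm]
  rw [e1]
  refine Finset.sum_congr rfl fun i hi => ?_
  rw [Finset.mem_Icc] at hi
  rw [Finset.sum_mul]
  refine Finset.sum_congr rfl fun P hP => ?_
  rw [mem_irreducibleMonics] at hP
  by_cases hdvd : P.natDegree ∣ i
  · simp only [hdvd, true_and, if_true]
    rw [← Finset.sum_filter, Finset.mul_sum]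
    obtain ⟨j, rfl⟩ := hdvd
    have hdeg : 0 < P.natDegree := hP.2.1.natDegree_pos
    rw [Nat.mul_div_cancel_left _ hdeg]
    symm
    refine Finset.sum_bij (fun g _ => P ^ j * g) ?_ ?_ ?_ ?_
    · intro g hg
      rw [mem_monicsOfDegree] at hg
      rw [Finset.mem_filter, mem_monicsOfDegree]
      refine ⟨⟨(hP.1.pow j).mul hg.1, ?_⟩, dvd_mul_right _ _⟩
      rw [(hP.1.pow j).natDegree_mul hg.1, natDegree_pow, hg.2, mul_comm j]
      omega
    · intro g _ g' _ h
      exact mul_left_cancel₀ (hP.1.pow j).ne_zero h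
    · intro f hf
      rw [Finset.mem_filter, mem_monicsOfDegree] at hf
      obtain ⟨⟨hf1, hf2⟩, g, rfl⟩ := hf
      have hg : g.Monic := (hP.1.pow j).of_mul_monic_left hf1
      refine ⟨g, ?_, rfl⟩
      rw [mem_monicsOfDegree]
      refine ⟨hg, ?_⟩
      rw [(hP.1.pow j).natDegree_mul hg, natDegree_pow, mul_comm j] at hf2
      omega
    · intro g hg
      rw [mem_monicsOfDegree] at hg
      rw [hmul _ _ (hP.1.pow j) hg.1, hpow _ _ hP.1, mul_assoc]
  · simp [hdvd]

end MonicPolynomials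

section KloostermanChar

open Polynomial

variable {k : Type*} [Field k]

open Classical in
/-- The multiplicative function on monic polynomials with
`∏ (X - α i) ↦ ψ (∑ i, (α i + b / α i))`. -/
noncomputable def kloostermanChar (ψ : AddChar k ℂ) (b : k) (f : k[X]) : ℂ :=
  if f.coeff 0 = 0 then 0 else ψ (-f.nextCoeff - b * f.coeff 1 / f.coeff 0)

theorem kloostermanChar_one (ψ : AddChar k ℂ) (b : k) : kloostermanChar ψ b 1 = 1 := by
  simp [kloostermanChar, coeff_one, nextCoeff]

theorem kloostermanChar_mul (ψ : AddChar k ℂ) (b : k) (f g : k[X]) (hf : f.Monic)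
    (hg : g.Monic) :
    kloostermanChar ψ b (f * g) = kloostermanChar ψ b f * kloostermanChar ψ b g := by
  unfold kloostermanChar
  rw [mul_coeff_zero, mul_coeff_one, hf.nextCoeff_mul hg]
  by_cases h1 : f.coeff 0 = 0
  · simp [h1]
  by_cases h2 : g.coeff 0 = 0
  · simp [h2]
  rw [if_neg (mul_ne_zero h1 h2), if_neg h1, if_neg h2, ← AddChar.map_add_eq_mul]
  congr 1
  field_simp
  ring

theorem nextCoeff_minpoly_inv {F : Type*} [Field F] [Algebra k F] [FiniteDimensional k F] {x : F}
    (hx : x ≠ 0) :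
    (minpoly k x⁻¹).nextCoeff = (minpoly k x).coeff 1 / (minpoly k x).coeff 0 := by
  have hxi : IsIntegral k x := Algebra.IsIntegral.isIntegral x
  have hxi' : IsIntegral k x⁻¹ := Algebra.IsIntegral.isIntegral x⁻¹
  set P := minpoly k x with hP
  have hc0 : P.coeff 0 ≠ 0 := minpoly.coeff_zero_ne_zero hxi hx
  have hdeg : 0 < P.natDegree := minpoly.natDegree_pos hxi
  have htr : P.natTrailingDegree = 0 := natTrailingDegree_eq_zero_of_constantCoeff_ne_zero hc0
  set g := P.reverse * C (P.coeff 0)⁻¹ with hg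
  have hlead : P.reverse.leadingCoeff = P.coeff 0 := by
    rw [reverse_leadingCoeff, trailingCoeff, htr]
  have hgm : g.Monic := by
    rw [Monic, hg, leadingCoeff_mul, leadingCoeff_C, hlead, mul_inv_cancel₀ hc0]
  have hgdeg : g.natDegree = P.natDegree := by
    rw [hg, natDegree_mul_C (inv_ne_zero hc0), reverse_natDegree, htr, Nat.sub_zero]
  have haeval : aeval x⁻¹ g = 0 := by
    rw [hg, map_mul]
    have : aeval x⁻¹ P.reverse = 0 := by
      have : Invertible x := invertibleOfNonzero hx
      rw [aeval_def, ← invOf_eq_inv, eval₂_reverse_eq_zero_iff]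
      exact minpoly.aeval k x
    rw [this, zero_mul]
  have hfield : IntermediateField.adjoin k {x⁻¹} = IntermediateField.adjoin k {x} := by
    apply le_antisymm
    · rw [IntermediateField.adjoin_simple_le_iff]
      exact inv_mem (IntermediateField.mem_adjoin_simple_self k x)
    · rw [IntermediateField.adjoin_simple_le_iff]
      have := inv_mem (IntermediateField.mem_adjoin_simple_self k x⁻¹)
      rwa [inv_inv] at this
  have heq : minpoly k x⁻¹ = g := by
    refine (eq_of_monic_of_dvd_of_natDegree_le (minpoly.monic hxi') hgm
      (minpoly.dvd k _ haeval) ?_).symm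
    rw [hgdeg, hP, ← IntermediateField.adjoin.finrank hxi,
      ← IntermediateField.adjoin.finrank hxi', hfield]
  rw [heq, hg, nextCoeff_mul_C, div_eq_mul_inv]
  congr 1
  have h2 : P.reverse.natDegree = P.natDegree := by rw [reverse_natDegree, htr, Nat.sub_zero]
  rw [nextCoeff_of_natDegree_pos (by omega), h2, coeff_reverse, revAt_le (by omega)]
  congr 1
  omega

theorem trace_add_mul_inv_char {F : Type*} [Field F] [Algebra k F] [FiniteDimensional k F]
    (ψ : AddChar k ℂ) (b : k) (x : F) [Decidable (x = 0)] :
    (if x = 0 then 0 else ψ (Algebra.trace k F (x + algebraMap k F b * x⁻¹)))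
      = kloostermanChar ψ b (minpoly k x) ^ (Module.finrank k F / (minpoly k x).natDegree) := by
  have hxi : IsIntegral k x := Algebra.IsIntegral.isIntegral x
  have hdeg : 0 < (minpoly k x).natDegree := minpoly.natDegree_pos hxi
  have hfr : ∀ y : F, Module.finrank k F / (minpoly k y).natDegree
      = Module.finrank (IntermediateField.adjoin k {y}) F := by
    intro y
    have hy : IsIntegral k y := Algebra.IsIntegral.isIntegral y
    rw [← Module.finrank_mul_finrank k (IntermediateField.adjoin k {y}) F,
      IntermediateField.adjoin.finrank hy, Nat.mul_div_cancel_left _ (minpoly.natDegree_pos hy)]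
  have hpos : Module.finrank k F / (minpoly k x).natDegree ≠ 0 := by
    rw [hfr]; exact Module.finrank_pos.ne'
  unfold kloostermanChar
  split_ifs with h1 h2 h2
  · rw [zero_pow hpos]
  · exfalso; apply h2; rw [h1]; simp [minpoly.zero]
  · exact absurd h2 (minpoly.coeff_zero_ne_zero hxi h1)
  · rw [← AddChar.map_nsmul_eq_pow]
    congr 1
    have hfield : IntermediateField.adjoin k {x⁻¹} = IntermediateField.adjoin k {x} := by
      apply le_antisymm
      · rw [IntermediateField.adjoin_simple_le_iff]
        exact inv_mem (IntermediateField.mem_adjoin_simple_self k x)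
      · rw [IntermediateField.adjoin_simple_le_iff]
        have := inv_mem (IntermediateField.mem_adjoin_simple_self k x⁻¹)
        rwa [inv_inv] at this
    rw [map_add, ← Algebra.smul_def, map_smul, trace_eq_finrank_mul_minpoly_nextCoeff,
      trace_eq_finrank_mul_minpoly_nextCoeff, nextCoeff_minpoly_inv h1, hfield, hfr x,
      nsmul_eq_mul, smul_eq_mul]
    ring

section Finite

variable [Fintype k]

theorem sum_monicsOfDegree_zero (ψ : AddChar k ℂ) (b : k) :
    ∑ f ∈ monicsOfDegree k 0, kloostermanChar ψ b f = 1 := by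
  have : monicsOfDegree k 0 = {1} := by
    ext f
    rw [mem_monicsOfDegree, Finset.mem_singleton]
    constructor
    · rintro ⟨h1, h2⟩; exact eq_one_of_monic_natDegree_zero h1 h2
    · rintro rfl; simp
  rw [this, Finset.sum_singleton, kloostermanChar_one]

theorem sum_monicsOfDegree_one [DecidableEq k] (ψ : AddChar k ℂ) (b : k) :
    ∑ f ∈ monicsOfDegree k 1, kloostermanChar ψ b f
      = ∑ x : k, if x = 0 then 0 else ψ (x + b * x⁻¹) := by
  symm
  refine Finset.sum_bij (fun x _ => X - C x) ?_ ?_ ?_ ?_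
  · intro x _
    rw [mem_monicsOfDegree]
    exact ⟨monic_X_sub_C x, natDegree_X_sub_C x⟩
  · intro x _ y _ h
    exact C_injective (sub_right_injective h)
  · intro f hf
    rw [mem_monicsOfDegree] at hf
    refine ⟨-f.coeff 0, Finset.mem_univ _, ?_⟩
    rw [hf.1.eq_X_add_C hf.2]
    simp
  · intro x _
    unfold kloostermanChar
    by_cases hx : x = 0
    · simp [hx]
    · simp only [hx, if_false, coeff_sub, coeff_X_zero, coeff_C_zero, zero_sub, neg_eq_zero,
        nextCoeff_X_sub_C, neg_neg, coeff_X_one, coeff_C_succ, sub_zero]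
      congr 1
      field_simp
      ring

theorem sum_monicsOfDegree_two {ψ : AddChar k ℂ} (hψ : ψ ≠ 1) {b : k} (hb : b ≠ 0) :
    ∑ f ∈ monicsOfDegree k 2, kloostermanChar ψ b f = Fintype.card k := by
  classical
  have h1 : ∑ f ∈ monicsOfDegree k 2, kloostermanChar ψ b f
      = ∑ v : k × k, if v.1 = 0 then 0 else ψ (v.2 * (-1 - b / v.1)) := by
    symm
    have hc : ∀ u v : k, (X ^ 2 + C u * X + C v).coeff 0 = v ∧
        (X ^ 2 + C u * X + C v).coeff 1 = u := by
      intro u v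
      constructor
      · simp
      · simp [coeff_X_pow, coeff_C]
    have hd : ∀ u v : k, (X ^ 2 + C u * X + C v).Monic ∧
        (X ^ 2 + C u * X + C v).natDegree = 2 := by
      intro u v
      have : X ^ 2 + C u * X + C v = C 1 * X ^ 2 + C u * X + C v := by simp
      rw [this]
      exact ⟨leadingCoeff_quadratic one_ne_zero, natDegree_quadratic one_ne_zero⟩
    refine Finset.sum_bij (fun v _ => X ^ 2 + C v.2 * X + C v.1) ?_ ?_ ?_ ?_
    · intro v _
      rw [mem_monicsOfDegree]
      exact hd _ _
    · intro v _ w _ h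
      refine Prod.ext ?_ ?_
      · rw [← (hc v.2 v.1).1, ← (hc w.2 w.1).1, h]
      · rw [← (hc v.2 v.1).2, ← (hc w.2 w.1).2, h]
    · intro f hf
      rw [mem_monicsOfDegree] at hf
      refine ⟨(f.coeff 0, f.coeff 1), Finset.mem_univ _, ?_⟩
      conv_rhs => rw [hf.1.as_sum, hf.2]
      simp [Finset.sum_range_succ]
      ring
    · intro v _
      unfold kloostermanChar
      rw [nextCoeff_of_natDegree_pos (by rw [(hd _ _).2]; norm_num), (hd _ _).2, (hc _ _).1]
      norm_num only
      rw [(hc _ _).2]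
      by_cases hv : v.1 = 0
      · simp [hv]
      · rw [if_neg hv, if_neg hv]
        congr 1
        field_simp
  rw [h1, Fintype.sum_prod_type]
  have hprim := AddChar.IsPrimitive.of_ne_one hψ
  have h2 : ∀ v : k, (∑ u : k, if v = 0 then 0 else ψ (u * (-1 - b / v)))
      = if v = -b then (Fintype.card k : ℂ) else 0 := by
    intro v
    by_cases hv : v = 0
    · simp [hv, hb]
    · simp only [hv, if_false]
      rw [AddChar.sum_mulShift _ hprim]
      have : (-1 - b / v = 0) ↔ v = -b := by
        rw [sub_eq_zero, eq_div_iff hv]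
        constructor
        · intro h; linear_combination -h
        · intro h; linear_combination -h
      simp only [this]
      split_ifs <;> simp
  rw [Finset.sum_congr rfl fun v _ => h2 v]
  simp

theorem sum_monicsOfDegree_of_three_le {ψ : AddChar k ℂ} (hψ : ψ ≠ 1) (b : k) {d : ℕ}
    (hd : 3 ≤ d) : ∑ f ∈ monicsOfDegree k d, kloostermanChar ψ b f = 0 := by
  obtain ⟨c, hc⟩ := AddChar.ne_one_iff.mp hψ
  have hdeg : ∀ c : k, ∀ f ∈ monicsOfDegree k d, f + C c * X ^ (d - 1) ∈ monicsOfDegree k d := by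
    intro c f hf
    rw [mem_monicsOfDegree] at hf ⊢
    have h1 : (C c * X ^ (d - 1)).natDegree < f.natDegree := by
      refine lt_of_le_of_lt (natDegree_C_mul_X_pow_le _ _) ?_
      omega
    exact ⟨hf.1.add_of_left (degree_lt_degree h1),
      by rw [natDegree_add_eq_left_of_natDegree_lt h1, hf.2]⟩
  have h1 : ∑ f ∈ monicsOfDegree k d, kloostermanChar ψ b f
      = ∑ f ∈ monicsOfDegree k d, ψ c * kloostermanChar ψ b f := by
    refine Finset.sum_bij' (fun f _ => f + C c * X ^ (d - 1)) (fun f _ => f + C (-c) * X ^ (d - 1))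
      (fun f hf => hdeg c f hf) (fun f hf => hdeg (-c) f hf) ?_ ?_ ?_
    · intro f _; simp
    · intro f _; simp
    · intro f hf
      have hf' := hdeg c f hf
      rw [mem_monicsOfDegree] at hf hf'
      unfold kloostermanChar
      rw [nextCoeff_of_natDegree_pos (by omega), nextCoeff_of_natDegree_pos (by omega), hf.2,
        hf'.2]
      have e0 : (f + C c * X ^ (d - 1)).coeff 0 = f.coeff 0 := by
        rw [coeff_add, coeff_C_mul_X_pow, if_neg (by omega), add_zero]
      have e1 : (f + C c * X ^ (d - 1)).coeff 1 = f.coeff 1 := by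
        rw [coeff_add, coeff_C_mul_X_pow, if_neg (by omega), add_zero]
      have e2 : (f + C c * X ^ (d - 1)).coeff (d - 1) = f.coeff (d - 1) + c := by
        rw [coeff_add, coeff_C_mul_X_pow, if_pos rfl]
      rw [e0, e1, e2]
      split_ifs
      · simp
      · rw [← AddChar.map_add_eq_mul]
        congr 1
        ring
  rw [← Finset.mul_sum] at h1
  have h2 : (ψ c - 1) * ∑ f ∈ monicsOfDegree k d, kloostermanChar ψ b f = 0 := by
    linear_combination -h1
  exact (mul_eq_zero.mp h2).resolve_left (sub_ne_zero.mpr hc)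

theorem card_filter_minpoly_eq {F : Type*} [Field F] [Algebra k F] [Fintype F] {P : k[X]}
    [DecidablePred fun x : F => minpoly k x = P]
    (hP : P.Monic) (hPi : Irreducible P) (hdvd : P.natDegree ∣ Module.finrank k F) :
    (Finset.univ.filter fun x : F => minpoly k x = P).card = P.natDegree := by
  classical
  have hdvd' : P ∣ X ^ Fintype.card F - X := by
    have := (hPi.natDegree_dvd_iff_dvd_X_pow_card_pow_sub_X).mp hdvd
    rwa [Nat.card_eq_fintype_card, ← Module.card_eq_pow_finrank] at this
  have hne : (X ^ Fintype.card F - X : F[X]) ≠ 0 :=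
    FiniteField.X_pow_card_sub_X_ne_zero F Fintype.one_lt_card
  have hsplit : (P.map (algebraMap k F)).Splits := by
    have h1 := Polynomial.splits_X_pow_nat_card_sub_X (K := F)
    rw [Nat.card_eq_fintype_card] at h1
    refine h1.of_dvd hne ?_
    have := map_dvd (mapRingHom (algebraMap k F)) hdvd'
    simpa using this
  have hsep : P.Separable := PerfectField.separable_of_irreducible hPi
  rw [← card_rootSet_eq_natDegree hsep hsplit]
  rw [← Set.toFinset_card]
  congr 1
  ext x
  simp only [Finset.mem_filter, Finset.mem_univ, true_and, Set.mem_toFinset,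
    mem_rootSet_of_ne hP.ne_zero]
  constructor
  · rintro rfl; exact minpoly.aeval k x
  · intro h; exact (minpoly.eq_of_irreducible_of_monic hPi h hP).symm

theorem sum_irreducibleMonics_eq {F : Type*} [Field F] [DecidableEq F] [Algebra k F] [Fintype F]
    (ψ : AddChar k ℂ) (b : k) {n : ℕ} (hn : Module.finrank k F = n) :
    (∑ P ∈ irreducibleMonics k n, if P.natDegree ∣ n then
        (P.natDegree : ℂ) * kloostermanChar ψ b P ^ (n / P.natDegree) else 0)
      = ∑ x : F, if x = 0 then 0 else ψ (Algebra.trace k F (x + algebraMap k F b * x⁻¹)) := by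
  classical
  have hmaps : ∀ x ∈ (Finset.univ : Finset F), minpoly k x ∈ irreducibleMonics k n := by
    intro x _
    have hxi : IsIntegral k x := Algebra.IsIntegral.isIntegral x
    rw [mem_irreducibleMonics]
    exact ⟨minpoly.monic hxi, minpoly.irreducible hxi, hn ▸ minpoly.natDegree_le x⟩
  rw [← Finset.sum_fiberwise_of_maps_to hmaps]
  refine Finset.sum_congr rfl fun P hP => ?_
  rw [mem_irreducibleMonics] at hP
  have h1 : ∀ x ∈ Finset.univ.filter (fun x : F => minpoly k x = P),
      (if x = 0 then 0 else ψ (Algebra.trace k F (x + algebraMap k F b * x⁻¹)))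
        = kloostermanChar ψ b P ^ (n / P.natDegree) := by
    intro x hx
    rw [Finset.mem_filter] at hx
    rw [trace_add_mul_inv_char, hx.2, hn]
  rw [Finset.sum_congr rfl h1, Finset.sum_const, nsmul_eq_mul]
  split_ifs with hdvd
  · rw [card_filter_minpoly_eq hP.1 hP.2.1 (hn ▸ hdvd)]
  · have : Finset.univ.filter (fun x : F => minpoly k x = P) = ∅ := by
      rw [Finset.filter_eq_empty_iff]
      rintro x _ rfl
      exact hdvd (hn ▸ minpoly.degree_dvd (Algebra.IsIntegral.isIntegral x))
    simp [this]

end Finite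

end KloostermanChar

section KloostermanPrime

/-- A Newton-type recursion with vanishing coefficients beyond degree two. -/
theorem eq_neg_pow_add_pow_of_newton {S A : ℕ → ℂ} {α β : ℂ} {N : ℕ} (hA0 : A 0 = 1)
    (hA1 : A 1 = -(α + β)) (hA2 : A 2 = α * β) (hA : ∀ d, 3 ≤ d → A d = 0)
    (h : ∀ d ≤ N, (d : ℂ) * A d = ∑ i ∈ Finset.Icc 1 d, S i * A (d - i)) :
    ∀ d, 1 ≤ d → d ≤ N → S d = -(α ^ d + β ^ d) := by
  intro d
  induction d using Nat.strong_induction_on with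
  | _ d ih =>
  intro h1 hN
  obtain rfl | rfl | ⟨m, rfl⟩ : d = 1 ∨ d = 2 ∨ ∃ m, d = m + 3 := by
    rcases Nat.lt_or_ge d 3 with h3 | h3
    · omega
    · exact Or.inr (Or.inr ⟨d - 3, by omega⟩)
  · have := h 1 hN
    simp [hA0, hA1] at this
    rw [← this]; ring
  · have e1 := ih 1 (by norm_num) le_rfl (by omega)
    have := h 2 hN
    rw [Finset.sum_Icc_succ_top (by norm_num), Finset.Icc_self, Finset.sum_singleton] at this
    norm_num [hA0, hA1, hA2, e1] at this
    linear_combination -this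
  · have e1 := ih (m + 2) (by omega) (by omega) (by omega)
    have e2 := ih (m + 1) (by omega) (by omega) (by omega)
    have := h (m + 3) hN
    rw [hA _ (by omega), Finset.sum_Icc_succ_top (by omega), Finset.sum_Icc_succ_top (by omega),
      Finset.sum_Icc_succ_top (by omega)] at this
    have h0 : ∑ i ∈ Finset.Icc 1 m, S i * A (m + 3 - i) = 0 := by
      refine Finset.sum_eq_zero fun i hi => ?_
      rw [Finset.mem_Icc] at hi
      rw [hA _ (by omega), mul_zero]
    have i1 : m + 3 - (m + 1) = 2 := by omega
    have i2 : m + 3 - (m + 1 + 1) = 1 := by omega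
    have i3 : m + 3 - (m + 2 + 1) = 0 := by omega
    rw [h0, i1, i2, i3, hA0, hA1, hA2, e1, e2] at this
    linear_combination -this

variable {p : ℕ} [Fact p.Prime]

/-- The complete Kloosterman sum modulo a prime. -/
noncomputable def kloostermanPrime (ψ : AddChar (ZMod p) ℂ) (b : ZMod p) : ℂ :=
  ∑ x : ZMod p, if x = 0 then 0 else ψ (x + b * x⁻¹)

theorem conj_kloostermanPrime (ψ : AddChar (ZMod p) ℂ) (b : ZMod p) :
    (starRingEnd ℂ) (kloostermanPrime ψ b) = kloostermanPrime ψ b := by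
  unfold kloostermanPrime
  rw [map_sum]
  refine Fintype.sum_equiv (Equiv.neg _) _ _ fun x => ?_
  simp only [Equiv.neg_apply, neg_eq_zero]
  split_ifs
  · simp
  · rw [← AddChar.map_neg_eq_conj]
    congr 1
    rw [inv_neg]; ring

theorem sum_trace_eq_neg_pow_add_pow {ψ : AddChar (ZMod p) ℂ} (hψ : ψ ≠ 1) {b : ZMod p}
    (hb : b ≠ 0) {F : Type*} [Field F] [DecidableEq F] [Algebra (ZMod p) F] [Fintype F] {α β : ℂ}
    (hadd : α + β = -kloostermanPrime ψ b) (hmul : α * β = p) :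
    ∑ x : F, (if x = 0 then 0
      else ψ (Algebra.trace (ZMod p) F (x + algebraMap (ZMod p) F b * x⁻¹)))
      = -(α ^ Module.finrank (ZMod p) F + β ^ Module.finrank (ZMod p) F) := by
  set n := Module.finrank (ZMod p) F with hn
  rw [← sum_irreducibleMonics_eq ψ b hn.symm]
  refine eq_neg_pow_add_pow_of_newton (N := n)
    (S := fun i => ∑ P ∈ irreducibleMonics (ZMod p) n, if P.natDegree ∣ i then
        (P.natDegree : ℂ) * kloostermanChar ψ b P ^ (i / P.natDegree) else 0)
    (A := fun d => ∑ f ∈ monicsOfDegree (ZMod p) d, kloostermanChar ψ b f)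
    (sum_monicsOfDegree_zero ψ b) ?_ ?_ (fun d hd => sum_monicsOfDegree_of_three_le hψ b hd) ?_ n
    Module.finrank_pos le_rfl
  · rw [sum_monicsOfDegree_one, hadd, neg_neg, kloostermanPrime]
  · rw [sum_monicsOfDegree_two hψ hb, hmul, ZMod.card]
  · intro d hd
    convert natCast_mul_sum_monicsOfDegree (kloostermanChar ψ b) (kloostermanChar_one ψ b)
      (kloostermanChar_mul ψ b) hd

/-- The roots of `z² + κ z + p` are either conjugate of absolute value `√p`, or real. -/
theorem exists_roots_quadratic {p : ℝ} (hp : 0 < p) (κ : ℝ) :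
    ∃ α β : ℂ, α + β = -κ ∧ α * β = p ∧
      (∀ r : ℕ, -(2 * p ^ r) ≤ (α ^ (2 * r) + β ^ (2 * r)).re) ∧
      (4 * p < κ ^ 2 → ∃ ρ : ℝ, p < ρ ∧ ∀ r : ℕ, ρ ^ r ≤ (α ^ (2 * r) + β ^ (2 * r)).re) := by
  rcases le_or_gt (κ ^ 2) (4 * p) with h | h
  · set δ := √(4 * p - κ ^ 2) with hδ
    have hδ2 : δ ^ 2 = 4 * p - κ ^ 2 := Real.sq_sqrt (by linarith)
    have hδc : (δ : ℂ) ^ 2 = 4 * p - κ ^ 2 := by exact_mod_cast hδ2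
    refine ⟨(-κ + δ * I) / 2, (-κ - δ * I) / 2, by ring, ?_, ?_, fun h' => absurd h' (not_lt.mpr h)⟩
    · linear_combination (1 / 4 : ℂ) * hδc - (δ : ℂ) ^ 2 / 4 * I_sq
    · intro r
      have hn : ∀ z : ℂ, z = (-κ + δ * I) / 2 ∨ z = (-κ - δ * I) / 2 → ‖z ^ (2 * r)‖ = p ^ r := by
        intro z hz
        rw [norm_pow, pow_mul, ← normSq_eq_norm_sq]
        congr 1
        rcases hz with rfl | rfl <;> simp [normSq_apply] <;> nlinarith
      rw [add_re]
      have h1 := (abs_le.mp (abs_re_le_norm (((-κ + δ * I) / 2 : ℂ) ^ (2 * r)))).1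
      have h2 := (abs_le.mp (abs_re_le_norm (((-κ - δ * I) / 2 : ℂ) ^ (2 * r)))).1
      rw [hn _ (Or.inl rfl)] at h1
      rw [hn _ (Or.inr rfl)] at h2
      linarith
  · set δ := √(κ ^ 2 - 4 * p) with hδ
    have hδ2 : δ ^ 2 = κ ^ 2 - 4 * p := Real.sq_sqrt (by linarith)
    have hδ0 : 0 < δ := Real.sqrt_pos.mpr (by linarith)
    have hδc : (δ : ℂ) ^ 2 = κ ^ 2 - 4 * p := by exact_mod_cast hδ2
    have hre : ∀ r : ℕ, ((((-κ + δ) / 2 : ℂ)) ^ (2 * r) + ((-κ - δ) / 2 : ℂ) ^ (2 * r)).re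
        = (((-κ + δ) / 2) ^ 2) ^ r + (((-κ - δ) / 2) ^ 2) ^ r := by
      intro r
      rw [← pow_mul, ← pow_mul]
      have : (((-κ + δ) / 2 : ℂ)) ^ (2 * r) + ((-κ - δ) / 2 : ℂ) ^ (2 * r)
        = (((((-κ + δ) / 2) ^ (2 * r) + ((-κ - δ) / 2) ^ (2 * r)) : ℝ) : ℂ) := by push_cast; ring
      rw [this, ofReal_re]
    refine ⟨(-κ + δ) / 2, (-κ - δ) / 2, by ring, ?_, ?_, fun _ => ?_⟩
    · linear_combination (-1 / 4 : ℂ) * hδc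
    · intro r
      rw [hre]
      have : 0 ≤ p ^ r := by positivity
      have : 0 ≤ (((-κ + δ) / 2) ^ 2) ^ r := by positivity
      have : 0 ≤ (((-κ - δ) / 2) ^ 2) ^ r := by positivity
      linarith
    · rcases le_total κ 0 with hκ | hκ
      · refine ⟨((-κ + δ) / 2) ^ 2, by nlinarith, fun r => ?_⟩
        rw [hre]
        have : 0 ≤ (((-κ - δ) / 2) ^ 2) ^ r := by positivity
        linarith
      · refine ⟨((-κ - δ) / 2) ^ 2, by nlinarith, fun r => ?_⟩
        rw [hre]
        have : 0 ≤ (((-κ + δ) / 2) ^ 2) ^ r := by positivity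
        linarith

theorem sum_trace_shift_re_ge (hp2 : p ≠ 2) {ψ : AddChar (ZMod p) ℂ} (hψ : ψ ≠ 1) {b : ZMod p}
    (hb : b ≠ 0) {F : Type*} [Field F] [DecidableEq F] [Algebra (ZMod p) F] [Fintype F] {r : ℕ}
    (hr : 4 ≤ r) (hcard : Fintype.card F = (p ^ r) ^ 2) :
    -((6 * p + 6) * (p : ℝ) ^ r) ≤ ∑ c ∈ Finset.univ.erase (0 : ZMod p),
      (∑ x : F, (if x = 0 then 0 else
        ψ.mulShift c (Algebra.trace (ZMod p) F (x + algebraMap (ZMod p) F b * x⁻¹)))).re := by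
  have : CharP F p := charP_of_injective_algebraMap (algebraMap (ZMod p) F).injective p
  have hb' : algebraMap (ZMod p) F b ≠ 0 := by
    rwa [Ne, map_eq_zero]
  have hW := card_trace_add_mul_inv_eq_zero_ge hp2 hb' hr hcard
  set T := Finset.univ.filter fun x : F =>
      x ≠ 0 ∧ Algebra.trace (ZMod p) F (x + algebraMap (ZMod p) F b * x⁻¹) = 0 with hT
  have hprim := AddChar.IsPrimitive.of_ne_one hψ
  have hall : ∑ c : ZMod p, ∑ x : F, (if x = 0 then 0 else
        ψ.mulShift c (Algebra.trace (ZMod p) F (x + algebraMap (ZMod p) F b * x⁻¹)))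
        = (p : ℂ) * T.card := by
    rw [Finset.sum_comm]
    have : ∀ x : F, ∑ c : ZMod p, (if x = 0 then 0 else
        ψ.mulShift c (Algebra.trace (ZMod p) F (x + algebraMap (ZMod p) F b * x⁻¹)))
        = if x ≠ 0 ∧ Algebra.trace (ZMod p) F (x + algebraMap (ZMod p) F b * x⁻¹) = 0
          then (p : ℂ) else 0 := by
      intro x
      by_cases hx : x = 0
      · simp [hx]
      · simp only [hx, if_false, AddChar.mulShift_apply, ne_eq, not_false_eq_true, true_and]
        rw [AddChar.sum_mulShift _ hprim, ZMod.card]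
        split_ifs <;> simp
    rw [Finset.sum_congr rfl fun x _ => this x, ← Finset.sum_filter, Finset.sum_const,
      nsmul_eq_mul, mul_comm]
  have hzero : ∑ x : F, (if x = 0 then 0 else
        ψ.mulShift 0 (Algebra.trace (ZMod p) F (x + algebraMap (ZMod p) F b * x⁻¹)))
        = (((p : ℝ) ^ r) ^ 2 - 1 : ℝ) := by
    have h1 : ∀ x : F, (if x = 0 then 0 else
        ψ.mulShift 0 (Algebra.trace (ZMod p) F (x + algebraMap (ZMod p) F b * x⁻¹)))
        = 1 - if x = 0 then (1 : ℂ) else 0 := by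
      intro x
      split_ifs <;> simp
    rw [Finset.sum_congr rfl fun x _ => h1 x, Finset.sum_sub_distrib]
    simp [hcard]
  have hre := congrArg Complex.re hall
  rw [← Finset.add_sum_erase _ _ (Finset.mem_univ (0 : ZMod p)), hzero, add_re, ofReal_re,
    re_sum] at hre
  have e1 : ((p : ℂ) * T.card).re = (p : ℝ) * T.card := by
    rw [← Nat.cast_mul, natCast_re, Nat.cast_mul]
  rw [e1] at hre
  have hW' : ((p : ℝ) ^ r) ^ 2 ≤ p * T.card + (6 * p + 6) * (p : ℝ) ^ r := by exact_mod_cast hW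
  linarith

/-- Weil's bound for Kloosterman sums modulo an odd prime. -/
theorem norm_kloostermanPrime_le (hp2 : p ≠ 2) {ψ : AddChar (ZMod p) ℂ} (hψ : ψ ≠ 1)
    {b : ZMod p} (hb : b ≠ 0) : ‖kloostermanPrime ψ b‖ ≤ 2 * √p := by
  classical
  have hp := (Fact.out : p.Prime)
  have hp0 : (0 : ℝ) < p := by exact_mod_cast hp.pos
  have hreal : ∀ ψ' : AddChar (ZMod p) ℂ, ((kloostermanPrime ψ' b).re : ℂ)
      = kloostermanPrime ψ' b := fun ψ' => conj_eq_iff_re.mp (conj_kloostermanPrime ψ' b)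
  set κ := (kloostermanPrime ψ b).re with hκ
  by_contra hcon
  have hκ4 : 4 * (p : ℝ) < κ ^ 2 := by
    rw [not_le, ← hreal, norm_real, Real.norm_eq_abs] at hcon
    have h1 : (2 * √(p : ℝ)) ^ 2 < |κ| ^ 2 := by gcongr
    rw [sq_abs, mul_pow, Real.sq_sqrt hp0.le] at h1
    linarith
  obtain ⟨α, β, h1, h2, -, h4⟩ := exists_roots_quadratic hp0 κ
  obtain ⟨ρ, hρ, hρr⟩ := h4 hκ4
  have hbound : ∀ r : ℕ, 4 ≤ r → ρ ^ r ≤ (8 * p + 6) * (p : ℝ) ^ r := by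
    intro r hr
    let _ : Fintype (GaloisField p (2 * r)) :=
      @Fintype.ofFinite _ (Module.finite_of_finite (ZMod p))
    have hcardF : Fintype.card (GaloisField p (2 * r)) = (p ^ r) ^ 2 := by
      rw [← Nat.card_eq_fintype_card, GaloisField.card p _ (by omega)]
      rw [← pow_mul, mul_comm]
    have hfin : Module.finrank (ZMod p) (GaloisField p (2 * r)) = 2 * r :=
      GaloisField.finrank p (by omega)
    have hge := sum_trace_shift_re_ge hp2 hψ hb (F := GaloisField p (2 * r)) hr hcardF
    have hone : (1 : ZMod p) ∈ Finset.univ.erase (0 : ZMod p) := by simp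
    rw [← Finset.add_sum_erase _ _ hone] at hge
    have e1 := sum_trace_eq_neg_pow_add_pow hψ hb (F := GaloisField p (2 * r)) (α := α) (β := β)
      (by rw [h1, hreal]) (by exact_mod_cast h2)
    rw [hfin] at e1
    simp only [AddChar.mulShift_one] at hge
    rw [e1, neg_re] at hge
    have hrest : ∀ c ∈ (Finset.univ.erase (0 : ZMod p)).erase 1,
        (∑ x : GaloisField p (2 * r), (if x = 0 then 0 else
        ψ.mulShift c (Algebra.trace (ZMod p) (GaloisField p (2 * r))
          (x + algebraMap (ZMod p) (GaloisField p (2 * r)) b * x⁻¹)))).re ≤ 2 * (p : ℝ) ^ r := by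
      intro c hc
      have hc0 : c ≠ 0 := by
        simp only [Finset.mem_erase] at hc; exact hc.2.1
      have hψc : ψ.mulShift c ≠ 1 := (AddChar.IsPrimitive.of_ne_one hψ) hc0
      obtain ⟨α', β', g1, g2, g3, -⟩ :=
        exists_roots_quadratic hp0 (kloostermanPrime (ψ.mulShift c) b).re
      have e2 := sum_trace_eq_neg_pow_add_pow hψc hb (F := GaloisField p (2 * r)) (α := α')
        (β := β') (by rw [g1, hreal]) (by exact_mod_cast g2)
      rw [e2, hfin, neg_re]
      linarith [g3 r]
    have hsum := Finset.sum_le_sum hrest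
    rw [Finset.sum_const, nsmul_eq_mul] at hsum
    have hcard : (((Finset.univ.erase (0 : ZMod p)).erase 1).card : ℝ) ≤ p := by
      have : ((Finset.univ.erase (0 : ZMod p)).erase 1).card ≤ p := by
        refine (Finset.card_le_univ _).trans ?_
        rw [ZMod.card]
      exact_mod_cast this
    have hpr : 0 ≤ 2 * (p : ℝ) ^ r := by positivity
    have := mul_le_mul_of_nonneg_right hcard hpr
    have := hρr r
    linarith
  have hratio : 1 < ρ / p := (one_lt_div hp0).mpr hρ
  obtain ⟨r, hr1, hr2⟩ := ((Filter.eventually_ge_atTop 4).and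
    ((tendsto_pow_atTop_atTop_of_one_lt hratio).eventually_gt_atTop (8 * p + 6))).exists
  have := hbound r hr1
  rw [div_pow, lt_div_iff₀ (by positivity)] at hr2
  linarith

end KloostermanPrime

section KloostermanPrimePower

/-- The Kloosterman sum `∑ e((j u + n u⁻¹) / Q)` over the units modulo `Q`. -/
noncomputable def kloosterman (Q : ℕ) [NeZero Q] (j n : ZMod Q) : ℂ :=
  ∑ u : (ZMod Q)ˣ, ZMod.stdAddChar (j * (u : ZMod Q) + n * ((u⁻¹ : (ZMod Q)ˣ) : ZMod Q))

theorem norm_kloosterman_le_card (Q : ℕ) [NeZero Q] (j n : ZMod Q) :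
    ‖kloosterman Q j n‖ ≤ Fintype.card (ZMod Q)ˣ := by
  refine (norm_sum_le _ _).trans ?_
  simp

variable {p : ℕ}

theorem kloosterman_prime [Fact p.Prime] (j n : ZMod p) (hp2 : p ≠ 2) (hn : n ≠ 0) :
    ‖kloosterman p j n‖ ≤ 2 * √p := by
  have hp := (Fact.out : p.Prime)
  have hprim := ZMod.isPrimitive_stdAddChar p
  have hψ : (ZMod.stdAddChar : AddChar (ZMod p) ℂ) ≠ 1 := by
    have := hprim one_ne_zero
    simpa using this
  have hunits : ∀ f : ZMod p → ℂ, ∑ u : (ZMod p)ˣ, f u = ∑ x : ZMod p, if x = 0 then 0 else f x := by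
    intro f
    rw [← Finset.add_sum_erase _ _ (Finset.mem_univ (0 : ZMod p)), if_pos rfl, zero_add]
    refine Finset.sum_bij (fun u _ => (u : ZMod p)) ?_ ?_ ?_ ?_
    · intro u _; simp
    · intro u _ v _ h; exact Units.ext h
    · intro x hx
      exact ⟨Units.mk0 x (Finset.ne_of_mem_erase hx), Finset.mem_univ _, rfl⟩
    · intro u _; rw [if_neg u.ne_zero]
  have h1p : (1 : ℝ) ≤ √p := by
    rw [Real.one_le_sqrt]; exact_mod_cast hp.one_le
  by_cases hj : j = 0
  · have : kloosterman p j n = -1 := by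
      have h1 : kloosterman p j n = ∑ u : (ZMod p)ˣ, ZMod.stdAddChar (u * n : ZMod p) := by
        unfold kloosterman
        refine Fintype.sum_equiv (Equiv.inv _) _ _ fun u => ?_
        rw [hj, zero_mul, zero_add, mul_comm n, Equiv.inv_apply]
      rw [h1, hunits (fun x => ZMod.stdAddChar (x * n))]
      have h2 := AddChar.sum_mulShift n hprim
      rw [if_neg hn, ← Finset.add_sum_erase _ _ (Finset.mem_univ (0 : ZMod p))] at h2
      rw [← Finset.add_sum_erase _ _ (Finset.mem_univ (0 : ZMod p)), if_pos rfl, zero_add,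
        Finset.sum_congr rfl fun x hx => if_neg (Finset.ne_of_mem_erase hx)]
      simp only [zero_mul, AddChar.map_zero_eq_one, Nat.cast_zero] at h2
      linear_combination h2
    rw [this, norm_neg, norm_one]
    linarith
  · have : kloosterman p j n = kloostermanPrime ZMod.stdAddChar (j * n) := by
      unfold kloosterman kloostermanPrime
      rw [← hunits (fun x => ZMod.stdAddChar (x + j * n * x⁻¹))]
      refine Fintype.sum_equiv (Equiv.mulLeft (Units.mk0 j hj)) _ _ fun u => ?_
      simp only [Equiv.coe_mulLeft, Units.val_mul, Units.val_mk0, mul_inv, Units.val_inv_eq_inv_val]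
      congr 2
      field_simp
    rw [this]
    exact norm_kloostermanPrime_le hp2 hψ (mul_ne_zero hj hn)

theorem card_filter_pow_mul_eq_zero_le (hp : p.Prime) {e i : ℕ} (hi : i ≤ e) [NeZero (p ^ e)] :
    (Finset.univ.filter fun z : ZMod (p ^ e) => (p : ZMod (p ^ e)) ^ i * z = 0).card ≤ p ^ i := by
  have hpos : 0 < p ^ (e - i) := pow_pos hp.pos _
  have hsplit : p ^ e = p ^ i * p ^ (e - i) := by rw [← pow_add]; congr 1; omega
  have hdvd : ∀ z : ZMod (p ^ e), (p : ZMod (p ^ e)) ^ i * z = 0 → p ^ (e - i) ∣ z.val := by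
    intro z hz
    rw [← ZMod.natCast_zmod_val z, ← Nat.cast_pow, ← Nat.cast_mul,
      ZMod.natCast_eq_zero_iff] at hz
    exact Nat.dvd_of_mul_dvd_mul_left (pow_pos hp.pos i) (hsplit.symm.dvd.trans hz)
  rw [← Finset.card_range (p ^ i)]
  refine Finset.card_le_card_of_injOn (fun z => z.val / p ^ (e - i)) ?_ ?_
  · intro z _
    simp only [Finset.coe_range, Set.mem_Iio]
    rw [Nat.div_lt_iff_lt_mul hpos, ← hsplit]
    exact ZMod.val_lt z
  · intro z hz w hw h
    simp only [Finset.coe_filter, Finset.mem_univ, true_and, Set.mem_ofPred_eq] at hz hw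
    apply ZMod.val_injective
    rw [← Nat.div_mul_cancel (hdvd z hz), ← Nat.div_mul_cancel (hdvd w hw)]
    simp only at h
    rw [h]

theorem isUnit_zmod_pow_iff (hp : p.Prime) {e : ℕ} (he : e ≠ 0) (z : ZMod (p ^ e)) :
    IsUnit z ↔ ¬ (p : ZMod (p ^ e)) ∣ z := by
  have : NeZero (p ^ e) := ⟨pow_ne_zero _ hp.ne_zero⟩
  constructor
  · rintro hz hd
    have h1 : IsUnit (p : ZMod (p ^ e)) := isUnit_of_dvd_unit hd hz
    rw [ZMod.isUnit_iff_coprime, Nat.coprime_pow_right_iff (Nat.pos_of_ne_zero he),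
      Nat.coprime_self] at h1
    exact hp.one_lt.ne' h1
  · intro hd
    rw [← ZMod.natCast_zmod_val z, ZMod.isUnit_iff_coprime]
    apply Nat.Coprime.pow_right
    rw [Nat.coprime_comm, hp.coprime_iff_not_dvd]
    intro h
    apply hd
    rw [← ZMod.natCast_zmod_val z]
    exact Nat.cast_dvd_cast h

theorem card_stationary_le (hp : p.Prime) (hp2 : p ≠ 2) {e i : ℕ} (hi : i < e) [NeZero (p ^ e)]
    (j n : ZMod (p ^ e)) (hn : IsUnit n) :
    (Finset.univ.filter fun u : (ZMod (p ^ e))ˣ =>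
      (p : ZMod (p ^ e)) ^ i * (j * (u : ZMod (p ^ e)) - n * ((u⁻¹ : (ZMod (p ^ e))ˣ) : ZMod (p ^ e))) = 0).card ≤ 2 * p ^ i := by
  classical
  have he : e ≠ 0 := by omega
  set U := Finset.univ.filter fun u : (ZMod (p ^ e))ˣ =>
      (p : ZMod (p ^ e)) ^ i * (j * (u : ZMod (p ^ e)) - n * ((u⁻¹ : (ZMod (p ^ e))ˣ) : ZMod (p ^ e))) = 0 with hU
  rcases U.eq_empty_or_nonempty with h0 | ⟨u₀, hu₀⟩
  · simp [h0]
  have hmem : ∀ u ∈ U, (p : ZMod (p ^ e)) ^ i * (j * u ^ 2 - n) = 0 := by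
    intro u hu
    have h1 := (Finset.mem_filter.mp hu).2
    have h2 : ((u⁻¹ : (ZMod (p ^ e))ˣ) : ZMod (p ^ e)) * u = 1 := by simp
    linear_combination (u : ZMod (p ^ e)) * h1 + (p : ZMod (p ^ e)) ^ i * n * h2
  have hcancel : ∀ x y : ZMod (p ^ e), IsUnit y → (p : ZMod (p ^ e)) ^ i * (x * y) = 0 →
      (p : ZMod (p ^ e)) ^ i * x = 0 := by
    intro x y hy h
    rw [← mul_assoc] at h
    exact (hy.mul_left_eq_zero).mp h
  have hpi : (p : ZMod (p ^ e)) ^ i ≠ 0 := by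
    rw [← Nat.cast_pow, Ne, ZMod.natCast_eq_zero_iff, Nat.pow_dvd_pow_iff_le_right hp.one_lt]
    omega
  have hj : IsUnit j := by
    rw [isUnit_zmod_pow_iff hp he]
    intro hd
    have h1 := hmem u₀ hu₀
    have h2 : IsUnit (j * (u₀ : ZMod (p ^ e)) ^ 2 - n) := by
      rw [isUnit_zmod_pow_iff hp he] at hn ⊢
      intro h
      exact hn ((dvd_sub_right (hd.mul_right _)).mp h)
    have h3 := hcancel 1 _ h2 (by rw [one_mul]; exact h1)
    rw [mul_one] at h3
    exact hpi h3
  have h2u : IsUnit (2 : ZMod (p ^ e)) := by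
    have : (2 : ZMod (p ^ e)) = ((2 : ℕ) : ZMod (p ^ e)) := by norm_num
    rw [this, ZMod.isUnit_iff_coprime]
    exact Nat.Coprime.pow_right _ ((Nat.coprime_primes Nat.prime_two hp).mpr hp2.symm)
  have hcase : ∀ u ∈ U, (p : ZMod (p ^ e)) ^ i * ((u : ZMod (p ^ e)) - u₀) = 0 ∨
      (p : ZMod (p ^ e)) ^ i * ((u : ZMod (p ^ e)) + u₀) = 0 := by
    intro u hu
    have h1 := hmem u hu
    have h2 := hmem u₀ hu₀
    have h3 : (p : ZMod (p ^ e)) ^ i * (((u : ZMod (p ^ e)) - u₀) * (u + u₀)) = 0 := by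
      apply hcancel _ j hj
      linear_combination h1 - h2
    by_cases h4 : IsUnit ((u : ZMod (p ^ e)) + u₀)
    · exact Or.inl (hcancel _ _ h4 h3)
    · right
      refine hcancel _ ((u : ZMod (p ^ e)) - u₀) ?_ (by rw [mul_comm ((u : ZMod (p ^ e)) + u₀)]; exact h3)
      by_contra h5
      rw [isUnit_zmod_pow_iff hp he, not_not] at h4 h5
      have h6 : (p : ZMod (p ^ e)) ∣ 2 * u₀ := by
        have := dvd_sub h4 h5
        convert this using 1; ring
      exact (isUnit_zmod_pow_iff hp he _).mp (h2u.mul u₀.isUnit) h6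
  set Z := Finset.univ.filter fun z : ZMod (p ^ e) => (p : ZMod (p ^ e)) ^ i * z = 0 with hZ
  have hZc : Z.card ≤ p ^ i := card_filter_pow_mul_eq_zero_le hp hi.le
  have hsub : U.image (fun u : (ZMod (p ^ e))ˣ => (u : ZMod (p ^ e))) ⊆
      Z.image (fun z => z + u₀) ∪ Z.image (fun z => z - u₀) := by
    intro x hx
    obtain ⟨u, hu, rfl⟩ := Finset.mem_image.mp hx
    rw [Finset.mem_union, Finset.mem_image, Finset.mem_image]
    rcases hcase u hu with h | h
    · exact Or.inl ⟨_, by simpa [hZ] using h, by ring⟩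
    · exact Or.inr ⟨_, by simpa [hZ] using h, by ring⟩
  have h1 := Finset.card_le_card hsub
  rw [Finset.card_image_of_injective _ Units.val_injective] at h1
  have h2 := Finset.card_union_le (Z.image (fun z => z + (u₀ : ZMod (p ^ e))))
    (Z.image (fun z => z - (u₀ : ZMod (p ^ e))))
  have h3 := Finset.card_image_le (s := Z) (f := fun z => z + (u₀ : ZMod (p ^ e)))
  have h4 := Finset.card_image_le (s := Z) (f := fun z => z - (u₀ : ZMod (p ^ e)))
  omega

/-- Averaging a Kloosterman sum over the subgroup `1 + c (ZMod Q)`, `c² = 0`. -/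
theorem kloosterman_eq_sum_stationary (Q : ℕ) [NeZero Q] (j n c : ZMod Q) (hc : c ^ 2 = 0) :
    kloosterman Q j n = ∑ u ∈ Finset.univ.filter
      (fun u : (ZMod Q)ˣ => c * (j * (u : ZMod Q) - n * ((u⁻¹ : (ZMod Q)ˣ) : ZMod Q)) = 0),
      ZMod.stdAddChar (j * (u : ZMod Q) + n * ((u⁻¹ : (ZMod Q)ˣ) : ZMod Q)) := by
  have hprim := ZMod.isPrimitive_stdAddChar Q
  have hQ : (Q : ℂ) ≠ 0 := Nat.cast_ne_zero.mpr (NeZero.ne Q)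
  have hshift : ∀ t : ZMod Q, kloosterman Q j n = ∑ u : (ZMod Q)ˣ,
      ZMod.stdAddChar (j * (u : ZMod Q) + n * ((u⁻¹ : (ZMod Q)ˣ) : ZMod Q)) *
      ZMod.stdAddChar (t * (c * (j * (u : ZMod Q) - n * ((u⁻¹ : (ZMod Q)ˣ) : ZMod Q)))) := by
    intro t
    let w : (ZMod Q)ˣ := ⟨1 + c * t, 1 - c * t, by linear_combination -t ^ 2 * hc,
      by linear_combination -t ^ 2 * hc⟩
    unfold kloosterman
    symm
    refine Fintype.sum_equiv (Equiv.mulLeft w) _ _ fun u => ?_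
    rw [← AddChar.map_add_eq_mul]
    congr 1
    have hw : ((w : (ZMod Q)ˣ) : ZMod Q) = 1 + c * t := rfl
    have hw' : ((w⁻¹ : (ZMod Q)ˣ) : ZMod Q) = 1 - c * t := rfl
    rw [Equiv.coe_mulLeft, mul_inv, Units.val_mul, Units.val_mul, hw, hw']
    ring
  have h1 : (Q : ℂ) * kloosterman Q j n = ∑ t : ZMod Q, kloosterman Q j n := by simp [ZMod.card]
  rw [Finset.sum_congr rfl fun t _ => hshift t, Finset.sum_comm] at h1
  simp_rw [← Finset.mul_sum, AddChar.sum_mulShift _ hprim, ZMod.card] at h1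
  apply mul_left_cancel₀ hQ
  rw [h1, Finset.sum_filter, Finset.mul_sum]
  refine Finset.sum_congr rfl fun u _ => ?_
  split_ifs <;> simp [mul_comm]

/-- A bound for degenerate quadratic Gauss sums. -/
theorem normSq_quadratic_sum_le (hp : p.Prime) (hp2 : p ≠ 2) {e i : ℕ} (hi : i < e)
    {Q : ℕ} [NeZero Q] (hQ : Q = p ^ e) (c d : ZMod Q) (hd : IsUnit d) :
    ‖∑ w : ZMod Q, ZMod.stdAddChar ((p : ZMod Q) ^ i * (c * w + d * w ^ 2))‖ ^ 2
      ≤ (p ^ e : ℝ) * p ^ i := by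
  subst hQ
  have hprim := ZMod.isPrimitive_stdAddChar (p ^ e)
  have h2u : IsUnit (2 : ZMod (p ^ e)) := by
    have : (2 : ZMod (p ^ e)) = ((2 : ℕ) : ZMod (p ^ e)) := by norm_num
    rw [this, ZMod.isUnit_iff_coprime]
    exact Nat.Coprime.pow_right _ ((Nat.coprime_primes Nat.prime_two hp).mpr hp2.symm)
  set P := (p : ZMod (p ^ e)) ^ i with hP
  set g : ZMod (p ^ e) → ℂ := fun w => ZMod.stdAddChar (P * (c * w + d * w ^ 2)) with hg
  have hsq : ((‖∑ w, g w‖ ^ 2 : ℝ) : ℂ)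
      = ∑ h : ZMod (p ^ e), g h * if P * h = 0 then ((p ^ e : ℕ) : ℂ) else 0 := by
    have e0 : ((‖∑ w, g w‖ ^ 2 : ℝ) : ℂ) = (∑ w, g w) * (starRingEnd ℂ) (∑ w, g w) := by
      rw [mul_conj, normSq_eq_norm_sq]
    rw [e0, map_sum, Finset.sum_mul_sum, Finset.sum_comm]
    have e1 : ∀ w : ZMod (p ^ e), ∑ x, g x * (starRingEnd ℂ) (g w)
        = ∑ h, g h * ZMod.stdAddChar (w * (P * (2 * d * h))) := by
      intro w
      refine Fintype.sum_equiv (Equiv.subRight w) _ _ fun x => ?_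
      simp only [hg, Equiv.subRight_apply]
      rw [← AddChar.map_neg_eq_conj, ← AddChar.map_add_eq_mul, ← AddChar.map_add_eq_mul]
      congr 1
      ring
    rw [Finset.sum_congr rfl fun w _ => e1 w, Finset.sum_comm]
    refine Finset.sum_congr rfl fun h _ => ?_
    rw [← Finset.mul_sum, AddChar.sum_mulShift _ hprim, ZMod.card]
    have e2 : P * (2 * d * h) = 0 ↔ P * h = 0 := by
      have : P * (2 * d * h) = (P * h) * (2 * d) := by ring
      rw [this]
      exact (h2u.mul hd).mul_left_eq_zero
    simp only [e2]
    split_ifs <;> simp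
  have hnorm := congrArg norm hsq
  rw [norm_real, Real.norm_eq_abs, abs_of_nonneg (by positivity)] at hnorm
  rw [hnorm]
  refine (norm_sum_le _ _).trans ?_
  have e3 : ∀ h : ZMod (p ^ e), ‖g h * if P * h = 0 then ((p ^ e : ℕ) : ℂ) else 0‖
      = if P * h = 0 then (p ^ e : ℝ) else 0 := by
    intro h
    rw [norm_mul, hg]
    split_ifs <;> simp
  rw [Finset.sum_congr rfl fun h _ => e3 h, ← Finset.sum_filter, Finset.sum_const, nsmul_eq_mul,
    mul_comm]
  refine mul_le_mul_of_nonneg_left ?_ (by positivity)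
  have h := card_filter_pow_mul_eq_zero_le hp hi.le
  rw [← hP] at h
  exact_mod_cast h

theorem norm_kloosterman_even_le (hp : p.Prime) (hp2 : p ≠ 2) {f : ℕ} (hf : 0 < f)
    [NeZero (p ^ (2 * f))] (j n : ZMod (p ^ (2 * f))) (hn : IsUnit n) :
    ‖kloosterman (p ^ (2 * f)) j n‖ ≤ 2 * (p : ℝ) ^ f := by
  have hc : ((p : ZMod (p ^ (2 * f))) ^ f) ^ 2 = 0 := by
    rw [← pow_mul, ← Nat.cast_pow, mul_comm f 2, ZMod.natCast_self]
  rw [kloosterman_eq_sum_stationary _ j n _ hc]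
  refine (norm_sum_le _ _).trans ?_
  simp only [AddChar.norm_apply, Finset.sum_const, nsmul_eq_mul, mul_one]
  exact_mod_cast card_stationary_le hp hp2 (by omega) j n hn

theorem norm_kloosterman_odd_le (hp : p.Prime) (hp2 : p ≠ 2) {f : ℕ} (hf : 0 < f)
    {Q : ℕ} [NeZero Q] (hQ : Q = p ^ (2 * f + 1)) (j n : ZMod Q) (hn : IsUnit n) :
    ‖kloosterman Q j n‖ ≤ 2 * √((p : ℝ) ^ (2 * f + 1)) := by
  set P : ZMod Q := (p : ZMod Q) with hPdef
  have hP0 : ∀ m, 2 * f + 1 ≤ m → P ^ m = 0 := by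
    intro m hm
    rw [hPdef, ← Nat.cast_pow, ZMod.natCast_eq_zero_iff]
    exact hQ ▸ pow_dvd_pow p hm
  have hpR : (0 : ℝ) < p := by exact_mod_cast hp.pos
  have hQR : (Q : ℝ) = (p : ℝ) ^ (2 * f + 1) := by rw [hQ]; push_cast; ring
  have hc : (P ^ (f + 1)) ^ 2 = 0 := by rw [← pow_mul]; exact hP0 _ (by omega)
  rw [kloosterman_eq_sum_stationary _ j n _ hc]
  set U := Finset.univ.filter
      (fun u : (ZMod Q)ˣ => P ^ (f + 1) * (j * (u : ZMod Q) - n * ((u⁻¹ : (ZMod Q)ˣ) : ZMod Q)) = 0) with hU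
  have hUcard : U.card ≤ 2 * p ^ (f + 1) := by
    subst hQ; exact card_stationary_le hp hp2 (by omega) j n hn
  set φ : (ZMod Q)ˣ → ℂ := fun u => ZMod.stdAddChar (j * (u : ZMod Q) + n * ((u⁻¹ : (ZMod Q)ˣ) : ZMod Q)) with hφ
  have hw : ∀ w : ZMod Q, (1 + P ^ f * w) * (1 - P ^ f * w + P ^ (2 * f) * w ^ 2) = 1 := by
    intro w
    have h3 := hP0 (3 * f) (by omega)
    have e1 : P ^ (2 * f) = P ^ f * P ^ f := by rw [← pow_add]; congr 1; omega
    have e2 : P ^ (3 * f) = P ^ f * P ^ f * P ^ f := by rw [← pow_add, ← pow_add]; congr 1; omega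
    rw [e2] at h3
    rw [e1]
    linear_combination w ^ 3 * h3
  let W : ZMod Q → (ZMod Q)ˣ := fun w => ⟨_, _, hw w, by rw [mul_comm]; exact hw w⟩
  have hW1 : ∀ w, ((W w : (ZMod Q)ˣ) : ZMod Q) = 1 + P ^ f * w := fun _ => rfl
  have hW2 : ∀ w, (((W w)⁻¹ : (ZMod Q)ˣ) : ZMod Q) = 1 - P ^ f * w + P ^ (2 * f) * w ^ 2 :=
    fun _ => rfl
  have hz : P ^ (f + 1) * P ^ f = 0 := by rw [← pow_add]; exact hP0 _ (by omega)
  have hUW : ∀ w u, W w * u ∈ U ↔ u ∈ U := by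
    intro w u
    rw [hU, Finset.mem_filter, Finset.mem_filter, mul_inv, Units.val_mul, Units.val_mul, hW1, hW2]
    have e1 : P ^ (2 * f) = P ^ f * P ^ f := by rw [← pow_add]; congr 1; omega
    have : P ^ (f + 1) * (j * ((1 + P ^ f * w) * u) -
        n * ((1 - P ^ f * w + P ^ (2 * f) * w ^ 2) * ((u⁻¹ : (ZMod Q)ˣ) : ZMod Q)))
        = P ^ (f + 1) * (j * (u : ZMod Q) - n * ((u⁻¹ : (ZMod Q)ˣ) : ZMod Q)) := by
      rw [e1]
      linear_combination (j * w * u + n * w * ((u⁻¹ : (ZMod Q)ˣ) : ZMod Q) -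
        n * P ^ f * w ^ 2 * ((u⁻¹ : (ZMod Q)ˣ) : ZMod Q)) * hz
    rw [this]
    simp
  have hshift : ∀ w : ZMod Q, ∑ u ∈ U, φ u = ∑ u ∈ U, φ (W w * u) := by
    intro w
    symm
    refine Finset.sum_bij (fun u _ => W w * u) (fun u hu => (hUW w u).mpr hu)
      (fun u _ v _ h => mul_left_cancel h) (fun u hu => ?_) (fun _ _ => rfl)
    refine ⟨(W w)⁻¹ * u, ?_, by simp⟩
    rw [← hUW w]; simpa using hu
  have hQ0 : (Q : ℂ) ≠ 0 := Nat.cast_ne_zero.mpr (NeZero.ne Q)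
  have hsum : (Q : ℂ) * ∑ u ∈ U, φ u = ∑ u ∈ U, ∑ w : ZMod Q, φ (W w * u) := by
    rw [Finset.sum_comm, ← Finset.sum_congr rfl fun w _ => hshift w]
    simp [ZMod.card]
  have hinner : ∀ u ∈ U, ‖∑ w : ZMod Q, φ (W w * u)‖ ≤ √((Q : ℝ) * p ^ (2 * f)) := by
    intro u hu
    have h1 := (Finset.mem_filter.mp hu).2
    obtain ⟨c, hc⟩ : ∃ c, j * (u : ZMod Q) - n * ((u⁻¹ : (ZMod Q)ˣ) : ZMod Q) = P ^ f * c := by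
      set z := j * (u : ZMod Q) - n * ((u⁻¹ : (ZMod Q)ˣ) : ZMod Q) with hz
      rw [hPdef, ← ZMod.natCast_zmod_val z, ← Nat.cast_pow, ← Nat.cast_mul,
        ZMod.natCast_eq_zero_iff] at h1
      have e1 : p ^ (2 * f + 1) = p ^ (f + 1) * p ^ f := by rw [← pow_add]; congr 1; omega
      have h2 := Nat.dvd_of_mul_dvd_mul_left (pow_pos hp.pos (f + 1))
        ((hQ.trans e1).symm.dvd.trans h1)
      obtain ⟨m, hm⟩ := h2
      refine ⟨(m : ZMod Q), ?_⟩
      rw [← ZMod.natCast_zmod_val z, hm]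
      push_cast
      rfl
    have e1 : P ^ (2 * f) = P ^ f * P ^ f := by rw [← pow_add]; congr 1; omega
    have h2 : ∀ w : ZMod Q, φ (W w * u) = φ u * ZMod.stdAddChar
        (P ^ (2 * f) * (c * w + n * ((u⁻¹ : (ZMod Q)ˣ) : ZMod Q) * w ^ 2)) := by
      intro w
      simp only [hφ]
      rw [← AddChar.map_add_eq_mul, mul_inv, Units.val_mul, Units.val_mul, hW1, hW2]
      congr 1
      rw [e1]
      linear_combination (P ^ f * w) * hc
    rw [Finset.sum_congr rfl fun w _ => h2 w, ← Finset.mul_sum, norm_mul]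
    have h3 : ‖φ u‖ = 1 := by simp [hφ]
    rw [h3, one_mul]
    apply Real.le_sqrt_of_sq_le
    have := normSq_quadratic_sum_le hp hp2 (e := 2 * f + 1) (i := 2 * f) (by omega) hQ c
      (n * ((u⁻¹ : (ZMod Q)ˣ) : ZMod Q)) (hn.mul (Units.isUnit _))
    rw [hQR]
    rw [← hPdef] at this
    exact this
  have hfin : (Q : ℝ) * ‖∑ u ∈ U, φ u‖ ≤ (2 * p ^ (f + 1)) * √((Q : ℝ) * p ^ (2 * f)) := by
    have h1 := congrArg norm hsum
    rw [norm_mul, Complex.norm_natCast] at h1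
    rw [h1]
    refine (norm_sum_le _ _).trans ((Finset.sum_le_sum hinner).trans ?_)
    rw [Finset.sum_const, nsmul_eq_mul]
    refine mul_le_mul_of_nonneg_right ?_ (Real.sqrt_nonneg _)
    exact_mod_cast hUcard
  have hs : √((p : ℝ) ^ (2 * f + 1)) = p ^ f * √p := by
    rw [pow_succ, mul_comm 2 f, pow_mul, Real.sqrt_mul (by positivity), Real.sqrt_sq (by positivity)]
  have hs2 : √((Q : ℝ) * p ^ (2 * f)) = p ^ f * √p * p ^ f := by
    rw [hQR, Real.sqrt_mul (by positivity), hs]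
    congr 1
    rw [mul_comm 2 f, pow_mul, Real.sqrt_sq (by positivity)]
  have hQpos : (0 : ℝ) < Q := by rw [hQR]; positivity
  rw [hs2] at hfin
  rw [hs]
  refine le_of_mul_le_mul_left (hfin.trans (le_of_eq ?_)) hQpos
  rw [hQR]
  ring

theorem stdAddChar_intCast_mul {p Q R : ℕ} [NeZero Q] [NeZero R] (hp : p ≠ 0) (hQ : Q = p * R)
    (m : ℤ) : ZMod.stdAddChar (((p : ℤ) * m : ℤ) : ZMod Q) = ZMod.stdAddChar ((m : ℤ) : ZMod R) := by
  rw [ZMod.stdAddChar_coe, ZMod.stdAddChar_coe, hQ]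
  congr 1
  have h1 : (p : ℂ) ≠ 0 := Nat.cast_ne_zero.mpr hp
  have h2 : (R : ℂ) ≠ 0 := Nat.cast_ne_zero.mpr (NeZero.ne R)
  push_cast
  field_simp

theorem sum_units_comp_unitsMap {Q R : ℕ} [NeZero Q] [NeZero R] (h : R ∣ Q) (g : (ZMod R)ˣ → ℂ) :
    (R.totient : ℂ) * ∑ u : (ZMod Q)ˣ, g (ZMod.unitsMap h u) = Q.totient * ∑ v, g v := by
  classical
  set m := (Finset.univ.filter fun u : (ZMod Q)ˣ => ZMod.unitsMap h u = 1).card with hm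
  have hfib : ∀ v : (ZMod R)ˣ,
      (Finset.univ.filter fun u : (ZMod Q)ˣ => ZMod.unitsMap h u = v).card = m := fun v =>
    MonoidHom.card_fiber_eq_of_mem_range _ (ZMod.unitsMap_surjective h v)
      ⟨1, map_one _⟩
  have h1 : ∀ g : (ZMod R)ˣ → ℂ, ∑ u : (ZMod Q)ˣ, g (ZMod.unitsMap h u) = m * ∑ v, g v := by
    intro g
    rw [← Finset.sum_fiberwise Finset.univ (fun u => ZMod.unitsMap h u), Finset.mul_sum]
    refine Finset.sum_congr rfl fun v _ => ?_
    rw [Finset.sum_congr rfl fun u hu => by rw [(Finset.mem_filter.mp hu).2], Finset.sum_const,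
      hfib v, nsmul_eq_mul]
  have h2 := h1 fun _ => 1
  simp only [Finset.sum_const, Finset.card_univ, ZMod.card_units_eq_totient, nsmul_eq_mul,
    mul_one] at h2
  rw [h1, h2]
  ring

theorem kloosterman_mul {p Q R : ℕ} [NeZero Q] [NeZero R] (hp : p.Prime) (hQ : Q = p * R)
    (hR : p ∣ R) (j n : ℤ) :
    kloosterman Q ((p : ℤ) * j : ℤ) ((p : ℤ) * n : ℤ) = p * kloosterman R j n := by
  have hd : R ∣ Q := ⟨p, by rw [hQ, mul_comm]⟩
  have htot : Q.totient = p * R.totient := by rw [hQ, Nat.totient_mul_of_prime_of_dvd hp hR]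
  have hR0 : (R.totient : ℂ) ≠ 0 :=
    Nat.cast_ne_zero.mpr (Nat.totient_pos.mpr (Nat.pos_of_ne_zero (NeZero.ne R))).ne'
  have h1 := sum_units_comp_unitsMap hd fun v : (ZMod R)ˣ =>
    (ZMod.stdAddChar ((j : ZMod R) * (v : ZMod R) + (n : ZMod R) * ((v⁻¹ : (ZMod R)ˣ) : ZMod R)) : ℂ)
  have h2 : kloosterman Q ((p : ℤ) * j : ℤ) ((p : ℤ) * n : ℤ) = ∑ u : (ZMod Q)ˣ,
      ZMod.stdAddChar ((j : ZMod R) * (ZMod.unitsMap hd u : ZMod R) +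
        (n : ZMod R) * (((ZMod.unitsMap hd u)⁻¹ : (ZMod R)ˣ) : ZMod R)) := by
    refine Finset.sum_congr rfl fun u _ => ?_
    have e1 : ∀ w : (ZMod Q)ˣ, (ZMod.unitsMap hd w : ZMod R) = (((w : ZMod Q).val : ℤ) : ZMod R) := by
      intro w
      rw [ZMod.unitsMap_val, Int.cast_natCast, ZMod.natCast_val]
    have e2 : ∀ w : (ZMod Q)ˣ, (w : ZMod Q) = (((w : ZMod Q).val : ℤ) : ZMod Q) := by
      intro w
      rw [Int.cast_natCast, ZMod.natCast_zmod_val]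
    rw [← map_inv, e1, e1]
    conv_lhs => rw [e2 u, e2 u⁻¹]
    rw [← Int.cast_mul, ← Int.cast_mul, ← Int.cast_mul, ← Int.cast_mul, ← Int.cast_add,
      ← Int.cast_add, ← stdAddChar_intCast_mul hp.ne_zero hQ]
    congr 2
    ring
  apply mul_left_cancel₀ hR0
  rw [h2, h1, htot, kloosterman]
  push_cast
  ring

theorem norm_kloosterman_primePow_le (hp : p.Prime) (hp2 : p ≠ 2) (e : ℕ) :
    ∀ (Q : ℕ) [NeZero Q], Q = p ^ e → ∀ j n : ℤ,
      ‖kloosterman Q j n‖ ≤ 2 * √((Q : ℝ) * (n.gcd Q : ℝ)) := by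
  induction e with
  | zero =>
    intro Q _ hQ j n
    rw [pow_zero] at hQ
    subst hQ
    refine (norm_kloosterman_le_card _ _ _).trans ?_
    simp
  | succ e ih =>
    intro Q _ hQ j n
    have hQpos : (0 : ℝ) < Q := by exact_mod_cast Nat.pos_of_ne_zero (NeZero.ne Q)
    by_cases hn : (p : ℤ) ∣ n
    · obtain ⟨n, rfl⟩ := hn
      rcases Nat.eq_zero_or_pos e with rfl | he
      · refine (norm_kloosterman_le_card _ _ _).trans ?_
        have h1 : Int.gcd (p * n) Q = Q := by
          rw [hQ, zero_add, pow_one]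
          simp
        rw [h1, Real.sqrt_mul_self hQpos.le, ZMod.card_units_eq_totient]
        have : (Q.totient : ℝ) ≤ Q := by exact_mod_cast Nat.totient_le Q
        linarith
      · by_cases hj : (p : ℤ) ∣ j
        · obtain ⟨j, rfl⟩ := hj
          have : NeZero (p ^ e) := ⟨pow_ne_zero _ hp.ne_zero⟩
          have hQ' : Q = p * p ^ e := by rw [hQ, pow_succ, mul_comm]
          rw [kloosterman_mul hp hQ' (dvd_pow_self p he.ne'), norm_mul, Complex.norm_natCast]
          have h1 := ih (p ^ e) rfl j n
          have h2 : Int.gcd (p * n) Q = p * n.gcd (p ^ e : ℕ) := by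
            rw [hQ']
            push_cast
            rw [Int.gcd_mul_left, Int.natAbs_natCast]
          have h3 : (Q : ℝ) * (Int.gcd (p * n) Q : ℝ)
              = (p : ℝ) ^ 2 * ((p ^ e : ℕ) * (n.gcd (p ^ e : ℕ) : ℝ)) := by
            rw [h2, hQ']; push_cast; ring
          rw [h3, Real.sqrt_mul (by positivity), Real.sqrt_sq (by positivity)]
          calc (p : ℝ) * ‖kloosterman (p ^ e) j n‖
              ≤ p * (2 * √((p ^ e : ℕ) * (n.gcd (p ^ e : ℕ) : ℝ))) := by gcongr
            _ = _ := by ring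
        · have hc : ((p : ZMod Q) ^ e) ^ 2 = 0 := by
            rw [← pow_mul, ← Nat.cast_pow, ZMod.natCast_eq_zero_iff, hQ]
            exact pow_dvd_pow p (by omega)
          rw [kloosterman_eq_sum_stationary _ _ _ _ hc, Finset.sum_eq_zero]
          · rw [norm_zero]; positivity
          · intro u hu
            exfalso
            have h1 := (Finset.mem_filter.mp hu).2
            have h0 : (p : ZMod Q) ^ e * p = 0 := by
              rw [← pow_succ, ← Nat.cast_pow, ← hQ, ZMod.natCast_self]
            have h2 : (p : ZMod Q) ^ e * j = 0 := by
              have h3 : ((u⁻¹ : (ZMod Q)ˣ) : ZMod Q) * u = 1 := by simp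
              push_cast at h1
              linear_combination ((u⁻¹ : (ZMod Q)ˣ) : ZMod Q) * h1
                + n * ((u⁻¹ : (ZMod Q)ˣ) : ZMod Q) ^ 2 * h0 - (p : ZMod Q) ^ e * j * h3
            have h3 : (((p ^ e : ℕ) * j : ℤ) : ZMod Q) = 0 := by
              push_cast; exact h2
            rw [ZMod.intCast_zmod_eq_zero_iff_dvd, hQ, pow_succ] at h3
            push_cast at h3
            exact hj (Int.dvd_of_mul_dvd_mul_left (by
              exact_mod_cast pow_ne_zero e hp.ne_zero) h3)
    · have hcop : IsCoprime n (Q : ℤ) := by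
        rw [hQ]
        push_cast
        exact (((Nat.prime_iff_prime_int.mp hp).coprime_iff_not_dvd).mpr hn).symm.pow_right
      have h1 : n.gcd Q = 1 := Int.isCoprime_iff_gcd_eq_one.mp hcop
      have hu : IsUnit ((n : ℤ) : ZMod Q) := by
        rw [ZMod.coe_int_isUnit_iff_isCoprime]
        exact hcop.symm
      rw [h1, Nat.cast_one, mul_one]
      rcases Nat.even_or_odd' (e + 1) with ⟨f, hf | hf⟩
      · rw [hf] at hQ
        have hf0 : 0 < f := by omega
        subst hQ
        refine (norm_kloosterman_even_le hp hp2 hf0 _ _ hu).trans (le_of_eq ?_)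
        push_cast
        rw [mul_comm 2 f, pow_mul, Real.sqrt_sq (by positivity)]
      · rcases Nat.eq_zero_or_pos f with rfl | hf0
        · have : Q = p := by rw [hQ, hf]; simp
          subst this
          have : Fact Q.Prime := ⟨hp⟩
          refine kloosterman_prime _ _ hp2 ?_
          rw [Ne, ZMod.intCast_zmod_eq_zero_iff_dvd]
          exact hn
        · rw [hf] at hQ
          refine (norm_kloosterman_odd_le hp hp2 hf0 hQ _ _ hu).trans (le_of_eq ?_)
          rw [hQ]; push_cast; rfl

end KloostermanPrimePower

section DivisorBound

theorem succ_le_mul_rpow {ε : ℝ} (hε : 0 < ε) {p : ℝ} (hp : 2 ≤ p) (a : ℕ) :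
    (a + 1 : ℝ) ≤ (1 + 1 / (ε * Real.log 2)) * (p ^ a) ^ ε := by
  have hlog : 0 < Real.log 2 := Real.log_pos (by norm_num)
  have h1 : ((2 : ℝ) ^ a) ^ ε ≤ (p ^ a) ^ ε := by gcongr
  have h2 : 1 + a * (ε * Real.log 2) ≤ ((2 : ℝ) ^ a) ^ ε := by
    rw [← Real.rpow_natCast, ← Real.rpow_mul (by norm_num), Real.rpow_def_of_pos (by norm_num)]
    have := Real.add_one_le_exp (Real.log 2 * (a * ε))
    linarith
  have hc : 0 < ε * Real.log 2 := by positivity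
  calc (a + 1 : ℝ) ≤ (1 + 1 / (ε * Real.log 2)) * (1 + a * (ε * Real.log 2)) := by
        have : (1 + 1 / (ε * Real.log 2)) * (1 + a * (ε * Real.log 2))
          = a + 1 + (1 / (ε * Real.log 2) + a * (ε * Real.log 2)) := by field_simp; ring
        rw [this]
        have : 0 ≤ 1 / (ε * Real.log 2) + a * (ε * Real.log 2) := by positivity
        linarith
    _ ≤ _ := by gcongr; exact h2.trans h1

theorem succ_le_rpow_of_le {ε p : ℝ} (hε : 0 < ε) (hp : (2 : ℝ) ^ (1 / ε) ≤ p) (a : ℕ) :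
    (a + 1 : ℝ) ≤ (p ^ a) ^ ε := by
  have hp0 : 0 < p := lt_of_lt_of_le (by positivity) hp
  have h1 : 2 ≤ p ^ ε := by
    calc (2 : ℝ) = ((2 : ℝ) ^ (1 / ε)) ^ ε := by
          rw [← Real.rpow_mul (by norm_num), one_div_mul_cancel hε.ne', Real.rpow_one]
      _ ≤ _ := by gcongr
  have h2 : (p ^ a) ^ ε = (p ^ ε) ^ a := by
    rw [← Real.rpow_natCast, ← Real.rpow_mul hp0.le, mul_comm, Real.rpow_mul hp0.le,
      Real.rpow_natCast]
  rw [h2]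
  calc (a + 1 : ℝ) ≤ 2 ^ a := by exact_mod_cast Nat.lt_two_pow_self
    _ ≤ _ := by gcongr

/-- The divisor bound `d(n) ≪ n ^ ε`. -/
theorem exists_card_divisors_le_rpow {ε : ℝ} (hε : 0 < ε) :
    ∃ C : ℝ, 1 ≤ C ∧ ∀ n : ℕ, n ≠ 0 → (n.divisors.card : ℝ) ≤ C * (n : ℝ) ^ ε := by
  have hlog : 0 < Real.log 2 := Real.log_pos (by norm_num)
  set K : ℝ := 1 + 1 / (ε * Real.log 2) with hK
  have hK1 : 1 ≤ K := by
    have : 0 ≤ 1 / (ε * Real.log 2) := by positivity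
    linarith
  set P : ℕ := ⌈(2 : ℝ) ^ (1 / ε)⌉₊ with hP
  refine ⟨K ^ P, one_le_pow₀ hK1, fun n hn => ?_⟩
  have hprod : (n : ℝ) ^ ε = ∏ p ∈ n.primeFactors, ((p : ℝ) ^ n.factorization p) ^ ε := by
    rw [Real.finsetProd_rpow _ _ fun p _ => by positivity]
    congr 1
    have h := Nat.prod_factorization_pow_eq_self hn
    rw [Nat.prod_factorization_eq_prod_primeFactors] at h
    exact_mod_cast h.symm
  rw [Nat.card_divisors hn, hprod]
  push_cast
  calc ∏ p ∈ n.primeFactors, ((n.factorization p : ℝ) + 1)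
      ≤ ∏ p ∈ n.primeFactors, ((if p < P then K else 1) * ((p : ℝ) ^ n.factorization p) ^ ε) := by
        refine Finset.prod_le_prod (fun p _ => by positivity) fun p hp => ?_
        have hp2 : (2 : ℝ) ≤ p := by exact_mod_cast (Nat.prime_of_mem_primeFactors hp).two_le
        split_ifs with h
        · exact succ_le_mul_rpow hε hp2 _
        · rw [one_mul]
          refine succ_le_rpow_of_le hε ?_ _
          exact (Nat.le_ceil _).trans (by exact_mod_cast not_lt.mp h)
    _ = (∏ p ∈ n.primeFactors, if p < P then K else 1) *
          ∏ p ∈ n.primeFactors, ((p : ℝ) ^ n.factorization p) ^ ε := Finset.prod_mul_distrib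
    _ ≤ _ := by
        refine mul_le_mul_of_nonneg_right ?_ (Finset.prod_nonneg fun p _ => by positivity)
        rw [Finset.prod_ite, Finset.prod_const, Finset.prod_const_one, mul_one]
        refine pow_le_pow_right₀ hK1 ?_
        calc _ ≤ (Finset.range P).card := Finset.card_le_card fun p hp => by
              simpa using (Finset.mem_filter.mp hp).2
          _ = P := Finset.card_range P

end DivisorBound

section PeriodicPoisson

/-- An integer is determined by its residue class modulo `Q` and its quotient by `Q`. -/
def residueEquiv (Q : ℕ) [NeZero Q] : ZMod Q × ℤ ≃ ℤ where
  toFun z := z.1.val + Q * z.2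
  invFun m := ((m : ZMod Q), m / Q)
  left_inv z := by
    have hQ : (Q : ℤ) ≠ 0 := by exact_mod_cast NeZero.ne Q
    ext
    · simp
    · have h : ((z.1.val : ℤ)) / Q = 0 :=
        Int.ediv_eq_zero_of_lt (by positivity) (by exact_mod_cast ZMod.val_lt z.1)
      simp only
      rw [Int.add_mul_ediv_left _ _ hQ, h, zero_add]
  right_inv m := by
    simp only
    rw [ZMod.val_intCast, Int.emod_add_mul_ediv]

theorem tsum_eq_sum_residue (Q : ℕ) [NeZero Q] {f : ℤ → ℂ} (hf : Summable f) :
    ∑' m, f m = ∑ u : ZMod Q, ∑' l : ℤ, f (u.val + Q * l) := by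
  rw [← (residueEquiv Q).tsum_eq f]
  have hs : Summable fun z => f (residueEquiv Q z) := (residueEquiv Q).summable_iff.mpr hf
  rw [hs.tsum_prod, tsum_fintype]
  rfl

theorem summable_gaussian {α : ℝ} (hα : 0 < α) (x : ℝ) :
    Summable fun m : ℤ => Real.exp (-Real.pi * α * (m + x) ^ 2) := by
  refine (HurwitzZeta.hasSum_int_evenKernel x hα).summable.congr fun m => ?_
  ring_nf

theorem tsum_gaussian_eq {β : ℝ} (hβ : 0 < β) (z : ℝ) :
    ∑' l : ℤ, (Real.exp (-Real.pi * β * (l + z) ^ 2) : ℂ)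
      = (1 / √β : ℝ) * ∑' j : ℤ, (Real.exp (-Real.pi * j ^ 2 / β) : ℂ) *
        cexp (2 * Real.pi * I * (j * z)) := by
  have h1 := (HurwitzZeta.hasSum_int_evenKernel z hβ).tsum_eq
  have h2 := (HurwitzZeta.hasSum_int_cosKernel z (one_div_pos.mpr hβ)).tsum_eq
  have h3 : ∑' l : ℤ, (Real.exp (-Real.pi * β * (l + z) ^ 2) : ℂ)
      = (HurwitzZeta.evenKernel z β : ℂ) := by
    rw [← h1, ofReal_tsum]
    refine tsum_congr fun l => ?_
    ring_nf
  have h4 : ∑' j : ℤ, (Real.exp (-Real.pi * j ^ 2 / β) : ℂ) *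
        cexp (2 * Real.pi * I * (j * z)) = (HurwitzZeta.cosKernel z (1 / β) : ℂ) := by
    rw [← h2]
    refine tsum_congr fun l => ?_
    rw [mul_comm]
    congr 2
    · ring
    · ring_nf
  rw [h3, h4, HurwitzZeta.evenKernel_functional_equation, ofReal_mul, Real.sqrt_eq_rpow]

theorem summable_gaussian_mul_exp {β : ℝ} (hβ : 0 < β) (z : ℝ) :
    Summable fun j : ℤ => (Real.exp (-Real.pi * j ^ 2 / β) : ℂ) *
        cexp (2 * Real.pi * I * (j * z)) := by
  have h2 := (HurwitzZeta.hasSum_int_cosKernel z (one_div_pos.mpr hβ)).summable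
  refine h2.congr fun l => ?_
  rw [mul_comm]
  congr 2
  · ring_nf
  · ring_nf

theorem Summable.mul_bounded_periodic {Q : ℕ} [NeZero Q] (c : ZMod Q → ℂ) {f : ℤ → ℂ}
    (hf : Summable f) : Summable fun m : ℤ => c m * f m := by
  refine Summable.of_norm_bounded (g := fun m => (∑ u, ‖c u‖) * ‖f m‖) (hf.norm.mul_left _) ?_
  intro m
  rw [norm_mul]
  refine mul_le_mul_of_nonneg_right ?_ (norm_nonneg _)
  exact Finset.single_le_sum (f := fun u => ‖c u‖) (fun _ _ => norm_nonneg _) (Finset.mem_univ _)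

/-- Poisson summation for Gaussians with periodic coefficients. -/
theorem tsum_periodic_gaussian (Q : ℕ) [NeZero Q] (c : ZMod Q → ℂ) {α : ℝ} (hα : 0 < α) (x : ℝ) :
    ∑' m : ℤ, c m * (Real.exp (-Real.pi * α * (m + x) ^ 2) : ℂ)
      = (1 / (Q * √α) : ℝ) * ∑' j : ℤ, (∑ u : ZMod Q, c u * ZMod.stdAddChar ((j : ZMod Q) * u)) *
        ((Real.exp (-Real.pi * j ^ 2 / (Q ^ 2 * α)) : ℂ) *
          cexp (2 * Real.pi * I * (j * x / Q))) := by
  have hQ : (0 : ℝ) < Q := by exact_mod_cast Nat.pos_of_ne_zero (NeZero.ne Q)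
  have hβ : 0 < (Q : ℝ) ^ 2 * α := by positivity
  have hsqrt : √((Q : ℝ) ^ 2 * α) = Q * √α := by
    rw [Real.sqrt_mul (by positivity), Real.sqrt_sq hQ.le]
  have hs : Summable fun m : ℤ => (Real.exp (-Real.pi * α * (m + x) ^ 2) : ℂ) := by
    exact_mod_cast (summable_gaussian hα x)
  rw [tsum_eq_sum_residue Q (hs.mul_bounded_periodic c)]
  have h1 : ∀ u : ZMod Q, ∑' l : ℤ, c ((u.val + Q * l : ℤ) : ZMod Q) *
      (Real.exp (-Real.pi * α * (((u.val + Q * l : ℤ) : ℝ) + x) ^ 2) : ℂ)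
      = (1 / (Q * √α) : ℝ) * ∑' j : ℤ, c u * ZMod.stdAddChar ((j : ZMod Q) * u) *
        ((Real.exp (-Real.pi * j ^ 2 / (Q ^ 2 * α)) : ℂ) *
          cexp (2 * Real.pi * I * (j * x / Q))) := by
    intro u
    have e1 : ∀ l : ℤ, c ((u.val + Q * l : ℤ) : ZMod Q) *
        (Real.exp (-Real.pi * α * (((u.val + Q * l : ℤ) : ℝ) + x) ^ 2) : ℂ)
        = c u * (Real.exp (-Real.pi * (Q ^ 2 * α) * (l + (u.val + x) / Q) ^ 2) : ℂ) := by
      intro l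
      congr 2
      · simp
      · congr 1
        push_cast
        field_simp
        ring
    rw [tsum_congr e1, tsum_mul_left, tsum_gaussian_eq hβ, hsqrt, mul_left_comm, ← tsum_mul_left]
    congr 1
    refine tsum_congr fun j => ?_
    have e2 : (ZMod.stdAddChar ((j : ZMod Q) * u) : ℂ) = cexp (2 * Real.pi * I * (j * u.val) / Q) := by
      have : (j : ZMod Q) * u = ((j * u.val : ℤ) : ZMod Q) := by simp
      rw [this, ZMod.stdAddChar_coe]
      push_cast
      rfl
    have e3 : cexp (2 * Real.pi * I * (j * ((((u.val : ℝ) + x) / Q : ℝ) : ℂ)))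
        = cexp (2 * Real.pi * I * (j * u.val) / Q) * cexp (2 * Real.pi * I * (j * x / Q)) := by
      rw [← Complex.exp_add]
      congr 1
      push_cast
      ring
    rw [e2, e3]
    ring
  rw [Finset.sum_congr rfl fun u _ => h1 u, ← Finset.mul_sum]
  congr 1
  have hs2 : Summable fun j : ℤ => (Real.exp (-Real.pi * j ^ 2 / (Q ^ 2 * α)) : ℂ) *
          cexp (2 * Real.pi * I * (j * x / Q)) := by
    refine (summable_gaussian_mul_exp hβ (x / Q)).congr fun j => ?_
    push_cast
    ring_nf
  have h2 : ∀ u : ZMod Q, Summable fun j : ℤ => c u * ZMod.stdAddChar ((j : ZMod Q) * u) *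
        ((Real.exp (-Real.pi * j ^ 2 / (Q ^ 2 * α)) : ℂ) *
          cexp (2 * Real.pi * I * (j * x / Q))) := fun u =>
    hs2.mul_bounded_periodic fun w => c u * ZMod.stdAddChar (w * u)
  rw [← Summable.tsum_finsetSum fun u _ => h2 u]
  refine tsum_congr fun j => ?_
  rw [Finset.sum_mul]

end PeriodicPoisson

section GaussianSums

theorem sum_exp_neg_sq_le {x : ℝ} (hx : 0 < x) (N : ℕ) :
    ∑ i ∈ Finset.range N, Real.exp (-Real.pi * x * ((i + 1 : ℕ) : ℝ) ^ 2) ≤ 1 / (2 * √x) := by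
  have hanti : AntitoneOn (fun s : ℝ => Real.exp (-(Real.pi * x) * s ^ 2)) (Set.Icc (0 : ℝ) (0 + N)) := by
    intro s hs r _ hsr
    have h1 : s ^ 2 ≤ r ^ 2 := pow_le_pow_left₀ hs.1 hsr 2
    have h2 : 0 < Real.pi * x := by positivity
    exact Real.exp_le_exp.mpr (by nlinarith)
  have h1 := hanti.sum_le_integral
  simp only [zero_add] at h1
  have hxi : MeasureTheory.Integrable (fun s : ℝ => Real.exp (-(Real.pi * x) * s ^ 2)) :=
    integrable_exp_neg_mul_sq (by positivity)
  have h2 : ∫ s in (0 : ℝ)..N, Real.exp (-(Real.pi * x) * s ^ 2)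
      ≤ ∫ s in Set.Ioi (0 : ℝ), Real.exp (-(Real.pi * x) * s ^ 2) := by
    rw [intervalIntegral.integral_of_le (by positivity)]
    exact MeasureTheory.setIntegral_mono_set hxi.integrableOn
      (Filter.Eventually.of_forall fun s => (Real.exp_pos _).le)
      (Filter.Eventually.of_forall Set.Ioc_subset_Ioi_self)
  rw [integral_gaussian_Ioi] at h2
  have h3 : √(Real.pi / (Real.pi * x)) / 2 = 1 / (2 * √x) := by
    rw [div_mul_eq_div_div, div_self Real.pi_ne_zero, Real.sqrt_div zero_le_one, Real.sqrt_one]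
    field_simp
  rw [h3] at h2
  refine le_trans (le_of_eq ?_) (h1.trans h2)
  refine Finset.sum_congr rfl fun i _ => ?_
  ring_nf

theorem summable_nat_exp_neg_sq {x : ℝ} (hx : 0 < x) :
    Summable fun i : ℕ => Real.exp (-Real.pi * x * ((i + 1 : ℕ) : ℝ) ^ 2) :=
  summable_of_sum_range_le (fun _ => (Real.exp_pos _).le) (sum_exp_neg_sq_le hx)

theorem tsum_nat_exp_neg_sq_le {x : ℝ} (hx : 0 < x) :
    ∑' i : ℕ, Real.exp (-Real.pi * x * ((i + 1 : ℕ) : ℝ) ^ 2) ≤ 1 / (2 * √x) :=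
  Real.tsum_le_of_sum_range_le (fun _ => (Real.exp_pos _).le) (sum_exp_neg_sq_le hx)

end GaussianSums

section LogCoordinates

open MeasureTheory Set

theorem Real.exp_image_univ : Real.exp '' univ = Ioi 0 := by
  rw [Set.image_univ, Real.range_exp]

theorem integral_Ioi_eq_integral_exp (f : ℝ → ℂ) :
    ∫ t in Ioi 0, f t = ∫ x : ℝ, (Real.exp x : ℂ) * f (Real.exp x) := by
  rw [← Real.exp_image_univ, integral_image_eq_integral_abs_deriv_smul MeasurableSet.univ
    (fun x _ => (Real.hasDerivAt_exp x).hasDerivWithinAt) Real.exp_injective.injOn]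
  simp

theorem integrableOn_Ioi_iff_integrable_exp (f : ℝ → ℂ) :
    IntegrableOn f (Ioi 0) ↔ Integrable fun x : ℝ => (Real.exp x : ℂ) * f (Real.exp x) := by
  rw [← Real.exp_image_univ, integrableOn_image_iff_integrableOn_abs_deriv_smul MeasurableSet.univ
    (fun x _ => (Real.hasDerivAt_exp x).hasDerivWithinAt) Real.exp_injective.injOn,
    integrableOn_univ]
  simp

theorem exp_mul_exp_cpow (x s : ℝ) :
    (Real.exp x : ℂ) * (Real.exp x : ℂ) ^ ((s : ℂ) - 1) = (Real.exp (s * x) : ℂ) := by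
  rw [← ofReal_one, ← ofReal_sub, ← ofReal_cpow (Real.exp_pos x).le, ← ofReal_mul,
    ← Real.exp_mul, ← Real.exp_add]
  ring_nf

theorem hasMellin_iff_exp (f : ℝ → ℂ) (s : ℝ) (m : ℂ) :
    HasMellin f s m ↔ Integrable (fun x : ℝ => (Real.exp (s * x) : ℂ) * f (Real.exp x)) ∧
      ∫ x : ℝ, (Real.exp (s * x) : ℂ) * f (Real.exp x) = m := by
  rw [HasMellin, MellinConvergent, mellin, integral_Ioi_eq_integral_exp,
    integrableOn_Ioi_iff_integrable_exp]
  simp only [smul_eq_mul, ← mul_assoc, exp_mul_exp_cpow]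

end LogCoordinates

section Theta

open MeasureTheory Set

/-- The theta series `∑ χ(n) e^{-π n² t / q}` over all integers `n`. -/
noncomputable def thetaChar {q : ℕ} (χ : DirichletCharacter ℂ q) (t : ℝ) : ℂ :=
  ∑' n : ℤ, χ (n : ZMod q) * (Real.exp (-Real.pi * n ^ 2 * t / q) : ℂ)

theorem summable_exp_neg_sq {c : ℝ} (hc : 0 < c) :
    Summable fun n : ℤ => Real.exp (-Real.pi * n ^ 2 * c) := by
  refine (summable_gaussian hc 0).congr fun m => ?_
  ring_nf

theorem summable_thetaChar {q : ℕ} [NeZero q] (χ : DirichletCharacter ℂ q) {t : ℝ} (ht : 0 < t) :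
    Summable fun n : ℤ => χ (n : ZMod q) * (Real.exp (-Real.pi * n ^ 2 * t / q) : ℂ) := by
  have hq : (0 : ℝ) < q := by exact_mod_cast Nat.pos_of_ne_zero (NeZero.ne q)
  refine Summable.of_norm_bounded (summable_exp_neg_sq (div_pos ht hq)) fun n => ?_
  rw [norm_mul, norm_real, Real.norm_of_nonneg (Real.exp_pos _).le, mul_div_assoc]
  exact mul_le_of_le_one_left (Real.exp_pos _).le (χ.norm_le_one _)

theorem sum_mul_evenKernel {q : ℕ} [NeZero q] (χ : DirichletCharacter ℂ q) {t : ℝ} (ht : 0 < t) :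
    ∑ j : ZMod q, χ j * (HurwitzZeta.evenKernel (ZMod.toAddCircle j) t : ℂ)
      = thetaChar χ (t / q) := by
  have hq : (0 : ℝ) < q := by exact_mod_cast Nat.pos_of_ne_zero (NeZero.ne q)
  rw [thetaChar, tsum_eq_sum_residue q (summable_thetaChar χ (div_pos ht hq))]
  refine Finset.sum_congr rfl fun j _ => ?_
  rw [ZMod.toAddCircle_apply]
  have h := (HurwitzZeta.hasSum_int_evenKernel ((j.val : ℝ) / q) ht).tsum_eq
  rw [← h, ofReal_tsum, ← tsum_mul_left]
  refine tsum_congr fun l => ?_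
  have h1 : (((j.val + q * l : ℤ)) : ZMod q) = j := by simp
  rw [h1]
  congr 3
  push_cast
  field_simp
  ring

theorem sum_f_modif_hurwitz {q : ℕ} [NeZero q] (hq1 : q ≠ 1) {χ : DirichletCharacter ℂ q}
    (hχ : χ ≠ 1) {t : ℝ} (ht : 0 < t) (ht1 : t ≠ 1) :
    ∑ j : ZMod q, χ j * (HurwitzZeta.hurwitzEvenFEPair (ZMod.toAddCircle j)).f_modif t
      = thetaChar χ (t / q) := by
  rw [← sum_mul_evenKernel χ ht]
  have h0 : χ 0 = 0 := χ.map_zero' hq1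
  have hs : ∑ j : ZMod q, χ j = 0 := χ.sum_eq_zero_of_ne_one hχ
  rcases lt_or_gt_of_ne ht1 with h | h
  · have h2 : ∀ a, (HurwitzZeta.hurwitzEvenFEPair a).f_modif t
        = HurwitzZeta.evenKernel a t - (t ^ (-(1 / 2 : ℝ)) : ℝ) := fun a => by
      simp [WeakFEPair.f_modif, HurwitzZeta.hurwitzEvenFEPair, h.le, ht, h]
    simp_rw [h2, mul_sub, Finset.sum_sub_distrib, ← Finset.sum_mul, hs]
    simp
  · have h2 : ∀ a, (HurwitzZeta.hurwitzEvenFEPair a).f_modif t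
        = HurwitzZeta.evenKernel a t - (if a = 0 then 1 else 0) := fun a => by
      simp [WeakFEPair.f_modif, HurwitzZeta.hurwitzEvenFEPair, h.not_gt, h]
    simp_rw [h2, mul_sub, Finset.sum_sub_distrib, ZMod.toAddCircle_eq_zero]
    simp [h0]

theorem hasMellin_sum_f_modif {q : ℕ} [NeZero q] (χ : DirichletCharacter ℂ q) (s : ℂ) :
    HasMellin (fun t => ∑ j : ZMod q,
        χ j * (HurwitzZeta.hurwitzEvenFEPair (ZMod.toAddCircle j)).f_modif t) s
      (∑ j : ZMod q, χ j * (HurwitzZeta.hurwitzEvenFEPair (ZMod.toAddCircle j)).Λ₀ s) := by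
  have h : ∀ j : ZMod q, HasMellin
      (fun t => χ j * (HurwitzZeta.hurwitzEvenFEPair (ZMod.toAddCircle j)).f_modif t) s
      (χ j * (HurwitzZeta.hurwitzEvenFEPair (ZMod.toAddCircle j)).Λ₀ s) := fun j => by
    have h1 := (HurwitzZeta.hurwitzEvenFEPair
      (ZMod.toAddCircle j)).isStrongFEPair_toStrongFEPair.hasMellin s
    refine ⟨h1.1.const_smul (χ j), ?_⟩
    exact mellin_const_smul _ s (χ j)
  constructor
  · have := integrable_finsetSum Finset.univ fun j _ => (h j).1
    simpa only [MellinConvergent, IntegrableOn, smul_eq_mul, Finset.mul_sum] using! this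
  · have := integral_finsetSum Finset.univ fun j _ => (h j).1
    simp only [mellin, smul_eq_mul, Finset.mul_sum] at this ⊢
    rw [this]
    refine Finset.sum_congr rfl fun j _ => ?_
    simpa only [mellin, smul_eq_mul] using (h j).2

theorem completedLFunction_half {q : ℕ} [NeZero q] (hq1 : q ≠ 1) {χ : DirichletCharacter ℂ q}
    (hχ : χ ≠ 1) (he : χ.Even) :
    χ.completedLFunction (1 / 2) = (q : ℂ) ^ (-(1 / 2 : ℂ)) * ((1 / 2) *
      ∑ j : ZMod q, χ j * (HurwitzZeta.hurwitzEvenFEPair (ZMod.toAddCircle j)).Λ₀ (1 / 4)) := by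
  have h0 : χ 0 = 0 := χ.map_zero' hq1
  have hs : ∑ j : ZMod q, χ j = 0 := χ.sum_eq_zero_of_ne_one hχ
  rw [DirichletCharacter.completedLFunction, ZMod.completedLFunction_def_even he.to_fun]
  congr 1
  simp_rw [HurwitzZeta.completedHurwitzZetaEven_eq, HurwitzZeta.completedHurwitzZetaEven₀,
    mul_sub, Finset.sum_sub_distrib, ZMod.toAddCircle_eq_zero, ← Finset.sum_mul, hs, Finset.mul_sum]
  norm_num
  rw [Finset.sum_eq_zero (s := Finset.univ) (f := fun x => χ x * ((if x = 0 then 1 else 0) / (1 / 2))),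
    sub_zero]
  · exact Finset.sum_congr rfl fun j _ => by ring
  · intro j _
    by_cases hj : j = 0 <;> simp [hj, h0]

theorem integral_thetaChar_exp {q : ℕ} [NeZero q] (hq1 : q ≠ 1) {χ : DirichletCharacter ℂ q}
    (hχ : χ ≠ 1) (he : χ.Even) :
    Integrable (fun x : ℝ => (Real.exp (x / 4) : ℂ) * thetaChar χ (Real.exp x)) ∧
    ∫ x : ℝ, (Real.exp (x / 4) : ℂ) * thetaChar χ (Real.exp x)
      = 2 * (((q / Real.pi) ^ (1 / 4 : ℝ) * Real.Gamma (1 / 4) : ℝ) : ℂ) * χ.LFunction (1 / 2) := by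
  have hq : (0 : ℝ) < q := by exact_mod_cast Nat.pos_of_ne_zero (NeZero.ne q)
  set m := ∑ j : ZMod q, χ j * (HurwitzZeta.hurwitzEvenFEPair (ZMod.toAddCircle j)).Λ₀ (1 / 4)
    with hm
  have h1 := hasMellin_sum_f_modif χ (1 / 4)
  rw [show (1 / 4 : ℂ) = ((1 / 4 : ℝ) : ℂ) by push_cast; rfl, hasMellin_iff_exp] at h1
  have h2 : (fun x : ℝ => (Real.exp (1 / 4 * x) : ℂ) * ∑ j : ZMod q, χ j *
      (HurwitzZeta.hurwitzEvenFEPair (ZMod.toAddCircle j)).f_modif (Real.exp x)) =ᵐ[volume]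
      fun x => (Real.exp (1 / 4 * x) : ℂ) * thetaChar χ (Real.exp x / q) := by
    have : ∀ᵐ x : ℝ, x ≠ 0 := by simp [ae_iff]
    filter_upwards [this] with x hx
    rw [sum_f_modif_hurwitz hq1 hχ (Real.exp_pos x) (by simpa using hx)]
  rw [integral_congr_ae h2, integrable_congr h2] at h1
  have h3 : ∀ x : ℝ, (Real.exp (1 / 4 * (x + Real.log q)) : ℂ) *
      thetaChar χ (Real.exp (x + Real.log q) / q)
      = (q ^ (1 / 4 : ℝ) : ℝ) * ((Real.exp (x / 4) : ℂ) * thetaChar χ (Real.exp x)) := fun x => by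
    rw [Real.exp_add, Real.exp_log hq, mul_div_cancel_right₀ _ hq.ne', mul_add, Real.exp_add,
      Real.rpow_def_of_pos hq]
    push_cast
    ring_nf
  have hq4 : ((q ^ (1 / 4 : ℝ) : ℝ) : ℂ) ≠ 0 :=
    ofReal_ne_zero.mpr (Real.rpow_pos_of_pos hq _).ne'
  have h4 := h1.1.comp_add_right (Real.log q)
  simp only [h3] at h4
  have h5 : Integrable (fun x : ℝ => (Real.exp (x / 4) : ℂ) * thetaChar χ (Real.exp x)) := by
    refine (h4.const_mul (((q ^ (1 / 4 : ℝ) : ℝ) : ℂ)⁻¹)).congr (ae_of_all _ fun x => ?_)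
    simp only
    rw [← mul_assoc, inv_mul_cancel₀ hq4, one_mul]
  refine ⟨h5, ?_⟩
  have h6 := h1.2
  rw [← integral_add_right_eq_self _ (Real.log q)] at h6
  simp only [h3] at h6
  rw [integral_const_mul] at h6
  have h7 := completedLFunction_half hq1 hχ he
  rw [show (1 / 4 : ℂ) = ((1 / 4 : ℝ) : ℂ) by push_cast; rfl, ← h6] at h7
  rw [DirichletCharacter.LFunction_eq_completed_div_gammaFactor χ _ (Or.inr hq1),
    he.gammaFactor_def, h7, Gammaℝ]
  have h8 : (q : ℂ) ^ (-(1 / 2 : ℂ)) = (((q ^ (1 / 4 : ℝ) : ℝ) : ℂ)⁻¹) ^ 2 := by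
    rw [← ofReal_inv, ← ofReal_pow, ← Real.rpow_neg hq.le, ← Real.rpow_natCast,
      ← Real.rpow_mul hq.le, ofReal_cpow hq.le]
    norm_num
  have h9 : (Real.pi : ℂ) ^ (-(1 / 2 : ℂ) / 2) = ((Real.pi ^ (1 / 4 : ℝ) : ℝ) : ℂ)⁻¹ := by
    rw [← ofReal_inv, ← Real.rpow_neg Real.pi_pos.le, ofReal_cpow Real.pi_pos.le]
    norm_num
  have h10 : Complex.Gamma (1 / 2 / 2) = (Real.Gamma (1 / 4) : ℂ) := by
    rw [← Complex.Gamma_ofReal]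
    norm_num
  rw [h8, h9, h10, Real.div_rpow hq.le Real.pi_pos.le]
  have hp4 : ((Real.pi ^ (1 / 4 : ℝ) : ℝ) : ℂ) ≠ 0 :=
    ofReal_ne_zero.mpr (Real.rpow_pos_of_pos Real.pi_pos _).ne'
  have hg : (Real.Gamma (1 / 4) : ℂ) ≠ 0 :=
    ofReal_ne_zero.mpr (Real.Gamma_pos_of_pos (by norm_num)).ne'
  push_cast
  field_simp

theorem thetaChar_eq_zero_of_odd {q : ℕ} {χ : DirichletCharacter ℂ q} (ho : χ.Odd) (t : ℝ) :
    thetaChar χ t = 0 := by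
  have h : thetaChar χ t = - thetaChar χ t := by
    conv_lhs => rw [thetaChar, ← (Equiv.neg ℤ).tsum_eq]
    rw [thetaChar, ← tsum_neg]
    refine tsum_congr fun n => ?_
    have : χ (((-n : ℤ)) : ZMod q) = - χ (n : ZMod q) := by
      rw [Int.cast_neg]; exact ho.to_fun _
    rw [Equiv.neg_apply, this]
    push_cast
    ring_nf
  exact self_eq_neg.mp h

end Theta

/-- The arithmetic data of a coset problem: `q = q₀ Q` are powers of the odd prime `p` with
`Q ∣ q₀`, and `χ` restricted to `1 + q₀ ℤ` is the additive character `x ↦ e(a x / Q)`. -/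
structure IsCosetData (p q q₀ Q : ℕ) [NeZero q] [NeZero q₀] [NeZero Q]
    (χ : DirichletCharacter ℂ q) (a : ℤ) : Prop where
  prime : p.Prime
  ne_two : p ≠ 2
  q₀_eq : ∃ j, j ≠ 0 ∧ q₀ = p ^ j
  Q_eq : ∃ e, e ≠ 0 ∧ Q = p ^ e
  q_eq : q = q₀ * Q
  Q_dvd : Q ∣ q₀
  map_one_add : ∀ x : ℤ, χ ((1 + q₀ * x : ℤ) : ZMod q) = ZMod.stdAddChar ((a * x : ℤ) : ZMod Q)
  not_dvd : ¬ (p : ℤ) ∣ a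

section Units

theorem isUnit_intCast_primePow_iff {p N : ℕ} (hp : p.Prime) (hN : ∃ e, e ≠ 0 ∧ N = p ^ e) (m : ℤ) :
    IsUnit (m : ZMod N) ↔ ¬ (p : ℤ) ∣ m := by
  obtain ⟨e, he, rfl⟩ := hN
  rw [ZMod.coe_int_isUnit_iff_isCoprime, Nat.cast_pow, IsCoprime.pow_left_iff (Nat.pos_of_ne_zero he),
    Prime.coprime_iff_not_dvd (Nat.prime_iff_prime_int.mp hp)]

variable {p q q₀ Q : ℕ} [NeZero q] [NeZero q₀] [NeZero Q] {χ : DirichletCharacter ℂ q} {a : ℤ}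

theorem IsCosetData.exists_q_eq (D : IsCosetData p q q₀ Q χ a) : ∃ e, e ≠ 0 ∧ q = p ^ e := by
  obtain ⟨j, hj, h1⟩ := D.q₀_eq
  obtain ⟨e, he, h2⟩ := D.Q_eq
  exact ⟨j + e, by omega, by rw [D.q_eq, h1, h2, pow_add]⟩

theorem IsCosetData.dvd (D : IsCosetData p q q₀ Q χ a) : q₀ ∣ q := ⟨Q, D.q_eq⟩

end Units

section Orthogonality

theorem DirichletCharacter.conj_apply_of_isUnit {n : ℕ} [NeZero n] (ψ : DirichletCharacter ℂ n)
    {b : ZMod n} (hb : IsUnit b) : (starRingEnd ℂ) (ψ b) = ψ b⁻¹ := by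
  have h1 : ψ b⁻¹ * ψ b = 1 := by
    rw [← map_mul, mul_comm, ZMod.mul_inv_of_unit _ hb, map_one]
  have h2 : ‖ψ b‖ = 1 := by
    obtain ⟨u, rfl⟩ := hb
    exact ψ.unit_norm_eq_one u
  have h3 : (starRingEnd ℂ) (ψ b) * ψ b = 1 := by
    rw [mul_comm, Complex.mul_conj, Complex.normSq_eq_norm_sq, h2]; norm_num
  have h4 : ψ b ≠ 0 := right_ne_zero_of_mul_eq_one h1
  exact mul_right_cancel₀ h4 (h3.trans h1.symm)

theorem sum_mul_conj_dirichletCharacter {n : ℕ} [NeZero n] (b : ZMod n) {c : ZMod n}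
    (hc : IsUnit c) : ∑ ψ : DirichletCharacter ℂ n, ψ b * (starRingEnd ℂ) (ψ c)
      = if c = b then (n.totient : ℂ) else 0 := by
  rw [← DirichletCharacter.sum_char_inv_mul_char_eq ℂ hc b]
  refine Finset.sum_congr rfl fun ψ _ => ?_
  rw [ψ.conj_apply_of_isUnit hc, mul_comm]

theorem changeLevel_apply_intCast {n m : ℕ} (h : n ∣ m) (ψ : DirichletCharacter ℂ n) {x : ℤ}
    (hx : IsUnit (x : ZMod m)) : DirichletCharacter.changeLevel h ψ (x : ZMod m) = ψ (x : ZMod n) := by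
  obtain ⟨u, hu⟩ := hx
  rw [← hu, DirichletCharacter.changeLevel_eq_cast_of_dvd, hu, ZMod.cast_intCast h]

variable {p q q₀ Q : ℕ} [NeZero q] [NeZero q₀] [NeZero Q] {χ : DirichletCharacter ℂ q} {a : ℤ}

theorem IsCosetData.sum_twist (D : IsCosetData p q q₀ Q χ a) (m n : ℤ) :
    ∑ ψ : DirichletCharacter ℂ q₀, (χ * DirichletCharacter.changeLevel D.dvd ψ) (m : ZMod q) *
        (starRingEnd ℂ) ((χ * DirichletCharacter.changeLevel D.dvd ψ) (n : ZMod q))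
      = q₀.totient * (if (p : ℤ) ∣ m then 0 else if (n : ZMod q₀) = (m : ZMod q₀) then
          χ (m : ZMod q) * (starRingEnd ℂ) (χ (n : ZMod q)) else 0) := by
  have hu := isUnit_intCast_primePow_iff D.prime D.exists_q_eq
  have hu₀ := isUnit_intCast_primePow_iff D.prime D.q₀_eq
  by_cases hm : (p : ℤ) ∣ m
  · have : χ (m : ZMod q) = 0 := χ.map_nonunit (by rw [hu]; exact not_not.mpr hm)
    simp [hm, this]
  by_cases hn : (p : ℤ) ∣ n
  · have : χ (n : ZMod q) = 0 := χ.map_nonunit (by rw [hu]; exact not_not.mpr hn)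
    simp [this]
  have hm' := (hu m).mpr hm
  have hn' := (hu n).mpr hn
  have hn₀ := (hu₀ n).mpr hn
  rw [if_neg hm]
  have h := sum_mul_conj_dirichletCharacter (m : ZMod q₀) hn₀
  calc _ = ∑ ψ : DirichletCharacter ℂ q₀, (χ (m : ZMod q) * (starRingEnd ℂ) (χ (n : ZMod q))) *
        (ψ (m : ZMod q₀) * (starRingEnd ℂ) (ψ (n : ZMod q₀))) := by
        refine Finset.sum_congr rfl fun ψ _ => ?_
        rw [MulChar.mul_apply, MulChar.mul_apply, changeLevel_apply_intCast _ _ hm',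
          changeLevel_apply_intCast _ _ hn', map_mul]
        ring
    _ = _ := by
        rw [← Finset.mul_sum, h]
        split_ifs <;> ring

theorem IsCosetData.mul_conj_shift (D : IsCosetData p q q₀ Q χ a) {m : ℤ} (hm : ¬ (p : ℤ) ∣ m)
    (h : ℤ) : χ (m : ZMod q) * (starRingEnd ℂ) (χ ((m + q₀ * h : ℤ) : ZMod q))
      = ZMod.stdAddChar (-((a : ZMod Q) * (m : ZMod Q)⁻¹ * (h : ZMod Q))) := by
  have hm' := (isUnit_intCast_primePow_iff D.prime D.exists_q_eq m).mpr hm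
  have hmQ := (isUnit_intCast_primePow_iff D.prime D.Q_eq m).mpr hm
  obtain ⟨m', hm1⟩ := ZMod.intCast_surjective ((m : ZMod q)⁻¹)
  have h1 : (m : ZMod q) * (m' : ZMod q) = 1 := by rw [hm1, ZMod.mul_inv_of_unit _ hm']
  have h2 : (m : ZMod Q) * (m' : ZMod Q) = 1 := by
    have := congrArg (ZMod.castHom (⟨q₀, by rw [D.q_eq, mul_comm]⟩ : Q ∣ q) (ZMod Q)) h1
    rwa [map_mul, map_intCast, map_intCast, map_one] at this
  have h3 : (m' : ZMod Q) = (m : ZMod Q)⁻¹ := by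
    refine hmQ.mul_left_cancel ?_
    rw [h2, ZMod.mul_inv_of_unit _ hmQ]
  have h4 : ((m + q₀ * h : ℤ) : ZMod q) = (m : ZMod q) * ((1 + q₀ * (m' * h) : ℤ) : ZMod q) := by
    push_cast
    linear_combination -(q₀ * h : ZMod q) * h1
  rw [h4, map_mul, D.map_one_add, map_mul, ← mul_assoc, Complex.mul_conj,
    Complex.normSq_eq_norm_sq]
  have h5 : ‖χ (m : ZMod q)‖ = 1 := by
    obtain ⟨u, hu⟩ := hm'
    rw [← hu]; exact χ.unit_norm_eq_one u
  rw [h5, AddChar.map_neg_eq_conj, ← h3]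
  push_cast
  rw [one_pow, one_mul, mul_assoc]

end Orthogonality

section CosetKernel

variable {p q q₀ Q : ℕ} [NeZero q] [NeZero q₀] [NeZero Q] {χ : DirichletCharacter ℂ q} {a : ℤ}

/-- The average of `θ(t) conj θ(v)` over the coset of `χ`, written as a sum over `m` and the
shift `h`. -/
noncomputable def cosetKernel (p q q₀ Q : ℕ) [NeZero Q] (a : ℤ) (t v : ℝ) : ℂ :=
  ∑' m : ℤ, if (p : ℤ) ∣ m then 0 else ∑' h : ℤ,
    ZMod.stdAddChar (-((a : ZMod Q) * (m : ZMod Q)⁻¹ * (h : ZMod Q))) *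
      (Real.exp (-Real.pi * (m ^ 2 * t + (m + q₀ * h) ^ 2 * v) / q) : ℂ)

theorem tsum_residue_eq (N : ℕ) [NeZero N] (m : ℤ) (f : ℤ → ℂ) :
    ∑' n : ℤ, (if (n : ZMod N) = (m : ZMod N) then f n else 0) = ∑' h : ℤ, f (m + N * h) := by
  have hN : (N : ℤ) ≠ 0 := by exact_mod_cast NeZero.ne N
  have hinj : Function.Injective fun h : ℤ => m + N * h := fun x y hxy => by
    exact mul_left_cancel₀ hN (add_left_cancel hxy)
  rw [← hinj.tsum_eq (f := fun n : ℤ => if (n : ZMod N) = (m : ZMod N) then f n else 0)]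
  · exact tsum_congr fun h => by simp
  · intro n hn
    have h1 : (n : ZMod N) = (m : ZMod N) := by
      by_contra h
      simp [h] at hn
    rw [eq_comm, ZMod.intCast_eq_intCast_iff_dvd_sub] at h1
    obtain ⟨c, hc⟩ := h1
    exact ⟨c, by simp only; linarith⟩

theorem hasSum_thetaChar_mul_conj (η : DirichletCharacter ℂ q) {t v : ℝ} (ht : 0 < t)
    (hv : 0 < v) :
    HasSum (fun z : ℤ × ℤ => η (z.1 : ZMod q) * (starRingEnd ℂ) (η (z.2 : ZMod q)) *
        ((Real.exp (-Real.pi * z.1 ^ 2 * t / q) : ℂ) * (Real.exp (-Real.pi * z.2 ^ 2 * v / q) : ℂ)))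
      (thetaChar η t * (starRingEnd ℂ) (thetaChar η v)) := by
  have h1 := (summable_thetaChar η ht).norm
  have h2 : Summable fun n : ℤ => ‖(starRingEnd ℂ) (η (n : ZMod q)) *
      (Real.exp (-Real.pi * n ^ 2 * v / q) : ℂ)‖ := by
    refine (summable_thetaChar η hv).norm.congr fun n => ?_
    rw [norm_mul, norm_mul, RCLike.norm_conj]
  have hconj : (starRingEnd ℂ) (thetaChar η v) = ∑' n : ℤ, (starRingEnd ℂ) (η (n : ZMod q)) *
      (Real.exp (-Real.pi * n ^ 2 * v / q) : ℂ) := by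
    rw [thetaChar, Complex.conj_tsum]
    exact tsum_congr fun n => by rw [map_mul, Complex.conj_ofReal]
  rw [hconj, thetaChar, tsum_mul_tsum_of_summable_norm h1 h2]
  have h3 := (summable_mul_of_summable_norm h1 h2).hasSum
  convert! h3 using 2 with z
  ring

theorem IsCosetData.hasSum_sum_thetaChar (D : IsCosetData p q q₀ Q χ a) {t v : ℝ} (ht : 0 < t)
    (hv : 0 < v) :
    HasSum (fun z : ℤ × ℤ => q₀.totient * (if (p : ℤ) ∣ z.1 then 0 else
        if (z.2 : ZMod q₀) = (z.1 : ZMod q₀) then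
          χ (z.1 : ZMod q) * (starRingEnd ℂ) (χ (z.2 : ZMod q)) else 0) *
        ((Real.exp (-Real.pi * z.1 ^ 2 * t / q) : ℂ) * (Real.exp (-Real.pi * z.2 ^ 2 * v / q) : ℂ)))
      (∑ ψ : DirichletCharacter ℂ q₀, thetaChar (χ * DirichletCharacter.changeLevel D.dvd ψ) t *
        (starRingEnd ℂ) (thetaChar (χ * DirichletCharacter.changeLevel D.dvd ψ) v)) := by
  have h := hasSum_sum fun ψ (_ : ψ ∈ (Finset.univ : Finset (DirichletCharacter ℂ q₀))) =>
    hasSum_thetaChar_mul_conj (χ * DirichletCharacter.changeLevel D.dvd ψ) ht hv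
  refine h.congr_fun ?_
  intro z
  rw [← D.sum_twist, Finset.sum_mul]

theorem IsCosetData.sum_thetaChar (D : IsCosetData p q q₀ Q χ a) {t v : ℝ} (ht : 0 < t)
    (hv : 0 < v) :
    ∑ ψ : DirichletCharacter ℂ q₀, thetaChar (χ * DirichletCharacter.changeLevel D.dvd ψ) t *
      (starRingEnd ℂ) (thetaChar (χ * DirichletCharacter.changeLevel D.dvd ψ) v)
      = q₀.totient * cosetKernel p q q₀ Q a t v := by
  have hs := D.hasSum_sum_thetaChar ht hv
  rw [← hs.tsum_eq, hs.summable.tsum_prod, cosetKernel, ← tsum_mul_left]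
  refine tsum_congr fun m => ?_
  by_cases hm : (p : ℤ) ∣ m
  · simp [hm]
  simp only [hm, if_false]
  have h3 : ∀ n : ℤ, q₀.totient * (if (n : ZMod q₀) = (m : ZMod q₀) then
      χ (m : ZMod q) * (starRingEnd ℂ) (χ (n : ZMod q)) else 0) *
        ((Real.exp (-Real.pi * m ^ 2 * t / q) : ℂ) * (Real.exp (-Real.pi * n ^ 2 * v / q) : ℂ))
      = q₀.totient * if (n : ZMod q₀) = (m : ZMod q₀) then
      (χ (m : ZMod q) * (starRingEnd ℂ) (χ (n : ZMod q))) *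
        ((Real.exp (-Real.pi * m ^ 2 * t / q) : ℂ) * (Real.exp (-Real.pi * n ^ 2 * v / q) : ℂ))
      else 0 := fun n => by
    split_ifs <;> ring
  simp_rw [h3]
  rw [tsum_mul_left, tsum_residue_eq q₀ m fun n => (χ (m : ZMod q) * (starRingEnd ℂ)
    (χ (n : ZMod q))) * ((Real.exp (-Real.pi * m ^ 2 * t / q) : ℂ) *
      (Real.exp (-Real.pi * n ^ 2 * v / q) : ℂ))]
  congr 1
  refine tsum_congr fun h => ?_
  rw [D.mul_conj_shift hm, ← ofReal_mul, ← Real.exp_add]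
  congr 3
  push_cast
  ring

end CosetKernel

section DualKernel

/-- The sum over pairs `m n ≡ a` modulo `Q` dual to `cosetKernel`. -/
noncomputable def dualKernel (q Q : ℕ) [NeZero q] (a : ℤ) (t u : ℝ) : ℂ :=
  ∑' z : ℤ × ℤ, if ((z.1 * z.2 : ℤ) : ZMod Q) = (a : ZMod Q) then
    ZMod.stdAddChar ((z.1 * z.2 : ℤ) : ZMod q) *
      (Real.exp (-Real.pi * (z.1 ^ 2 * t + z.2 ^ 2 * u) / q) : ℂ) else 0

variable {p q q₀ Q : ℕ} [NeZero q] {a : ℤ}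

theorem norm_stdAddChar {N : ℕ} [NeZero N] (x : ZMod N) : ‖ZMod.stdAddChar x‖ = 1 :=
  AddChar.norm_apply _ _

theorem summable_exp_neg_sq_add_sq {c d : ℝ} (hc : 0 < c) (hd : 0 < d) :
    Summable fun z : ℤ × ℤ => Real.exp (-Real.pi * (z.1 ^ 2 * c + z.2 ^ 2 * d)) := by
  have h := (summable_exp_neg_sq hc).mul_of_nonneg (summable_exp_neg_sq hd)
    (fun n => (Real.exp_pos _).le) (fun n => (Real.exp_pos _).le)
  refine h.congr fun z => ?_
  rw [← Real.exp_add]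
  ring_nf

theorem norm_dualKernel_term_le (z : ℤ × ℤ) (t u : ℝ) :
    ‖if ((z.1 * z.2 : ℤ) : ZMod Q) = (a : ZMod Q) then
      ZMod.stdAddChar ((z.1 * z.2 : ℤ) : ZMod q) *
        (Real.exp (-Real.pi * (z.1 ^ 2 * t + z.2 ^ 2 * u) / q) : ℂ) else 0‖
      ≤ Real.exp (-Real.pi * (z.1 ^ 2 * t + z.2 ^ 2 * u) / q) := by
  split_ifs
  · rw [norm_mul, norm_stdAddChar, one_mul, norm_real, Real.norm_of_nonneg (Real.exp_pos _).le]
  · rw [norm_zero]; exact (Real.exp_pos _).le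

theorem summable_exp_neg_sq_add_sq_div {t u : ℝ} (ht : 0 < t) (hu : 0 < u) :
    Summable fun z : ℤ × ℤ => Real.exp (-Real.pi * (z.1 ^ 2 * t + z.2 ^ 2 * u) / q) := by
  have hq : (0 : ℝ) < q := by exact_mod_cast Nat.pos_of_ne_zero (NeZero.ne q)
  refine (summable_exp_neg_sq_add_sq (div_pos ht hq) (div_pos hu hq)).congr fun z => ?_
  ring_nf

theorem summable_dualKernel {t u : ℝ} (ht : 0 < t) (hu : 0 < u) :
    Summable fun z : ℤ × ℤ => if ((z.1 * z.2 : ℤ) : ZMod Q) = (a : ZMod Q) then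
      ZMod.stdAddChar ((z.1 * z.2 : ℤ) : ZMod q) *
        (Real.exp (-Real.pi * (z.1 ^ 2 * t + z.2 ^ 2 * u) / q) : ℂ) else 0 :=
  Summable.of_norm_bounded (summable_exp_neg_sq_add_sq_div ht hu)
    fun z => norm_dualKernel_term_le z t u

theorem dualKernel_comm (t u : ℝ) : dualKernel q Q a u t = dualKernel q Q a t u := by
  rw [dualKernel, dualKernel, ← (Equiv.prodComm ℤ ℤ).tsum_eq]
  refine tsum_congr fun z => ?_
  simp only [Equiv.prodComm_apply, Prod.fst_swap, Prod.snd_swap, mul_comm z.2 z.1, add_comm]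

variable [NeZero q₀] [NeZero Q] {χ : DirichletCharacter ℂ q}

theorem sum_stdAddChar_mul_sub (b j : ZMod Q) :
    ∑ u : ZMod Q, ZMod.stdAddChar (-(b * u)) * ZMod.stdAddChar (j * u)
      = if j = b then (Q : ℂ) else 0 := by
  have h := AddChar.sum_mulShift (j - b) (ZMod.isPrimitive_stdAddChar Q)
  rw [ZMod.card] at h
  simp only [sub_eq_zero] at h
  push_cast at h
  rw [← h]
  refine Finset.sum_congr rfl fun u _ => ?_
  rw [← AddChar.map_add_eq_mul]
  congr 1
  ring

theorem IsCosetData.intCast_mul_eq_iff (D : IsCosetData p q q₀ Q χ a) {m : ℤ} (hm : ¬ (p : ℤ) ∣ m)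
    (n : ℤ) : ((m * n : ℤ) : ZMod Q) = (a : ZMod Q) ↔ (n : ZMod Q) = a * (m : ZMod Q)⁻¹ := by
  have hmQ := ZMod.mul_inv_of_unit _ ((isUnit_intCast_primePow_iff D.prime D.Q_eq m).mpr hm)
  push_cast
  constructor
  · intro h
    rw [← h]
    linear_combination -(n : ZMod Q) * hmQ
  · intro h
    rw [h]
    linear_combination (a : ZMod Q) * hmQ

theorem IsCosetData.intCast_mul_ne (D : IsCosetData p q q₀ Q χ a) {m : ℤ} (hm : (p : ℤ) ∣ m)
    (n : ℤ) : ((m * n : ℤ) : ZMod Q) ≠ (a : ZMod Q) := by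
  intro h
  have h1 := (isUnit_intCast_primePow_iff D.prime D.Q_eq a).mpr D.not_dvd
  rw [← h, isUnit_intCast_primePow_iff D.prime D.Q_eq] at h1
  exact h1 (hm.mul_right n)

theorem IsCosetData.tsum_shift_eq (D : IsCosetData p q q₀ Q χ a) {v : ℝ} (hv : 0 < v) (t : ℝ)
    {m : ℤ} (hm : ¬ (p : ℤ) ∣ m) :
    ∑' h : ℤ, ZMod.stdAddChar (-((a : ZMod Q) * (m : ZMod Q)⁻¹ * (h : ZMod Q))) *
      (Real.exp (-Real.pi * (m ^ 2 * t + (m + q₀ * h) ^ 2 * v) / q) : ℂ)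
    = (√(Q / (q₀ * v)) : ℝ) * ∑' n : ℤ, if ((m * n : ℤ) : ZMod Q) = (a : ZMod Q) then
      ZMod.stdAddChar ((m * n : ℤ) : ZMod q) *
      (Real.exp (-Real.pi * (m ^ 2 * t + n ^ 2 * (1 / v)) / q) : ℂ) else 0 := by
  have hQ : (0 : ℝ) < Q := by exact_mod_cast Nat.pos_of_ne_zero (NeZero.ne Q)
  have hq₀ : (0 : ℝ) < q₀ := by exact_mod_cast Nat.pos_of_ne_zero (NeZero.ne q₀)
  have hq : (q : ℝ) = q₀ * Q := by exact_mod_cast D.q_eq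
  have hα : 0 < (q₀ : ℝ) * v / Q := by positivity
  have h1 := tsum_periodic_gaussian Q
    (fun u => ZMod.stdAddChar (-((a : ZMod Q) * (m : ZMod Q)⁻¹ * u))) hα (m / q₀)
  simp only [sum_stdAddChar_mul_sub] at h1
  have h2 : ∀ h : ℤ, ZMod.stdAddChar (-((a : ZMod Q) * (m : ZMod Q)⁻¹ * (h : ZMod Q))) *
      (Real.exp (-Real.pi * (m ^ 2 * t + (m + q₀ * h) ^ 2 * v) / q) : ℂ)
      = (Real.exp (-Real.pi * m ^ 2 * t / q) : ℂ) *
        (ZMod.stdAddChar (-((a : ZMod Q) * (m : ZMod Q)⁻¹ * (h : ZMod Q))) *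
        (Real.exp (-Real.pi * (q₀ * v / Q) * (h + m / q₀) ^ 2) : ℂ)) := fun h => by
    rw [mul_left_comm, ← ofReal_mul, ← Real.exp_add, hq]
    congr 3
    field_simp
    ring
  simp_rw [h2]
  rw [tsum_mul_left, h1, mul_left_comm, ← tsum_mul_left, ← tsum_mul_left, ← tsum_mul_left]
  refine tsum_congr fun n => ?_
  simp only [D.intCast_mul_eq_iff hm]
  split_ifs with hn
  · have h3 : (1 / (Q * √(q₀ * v / Q)) : ℝ) * Q = √(Q / (q₀ * v)) := by
      rw [← inv_div (q₀ * v : ℝ) (Q : ℝ), Real.sqrt_inv]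
      field_simp
    have h4 : cexp (2 * Real.pi * I * (n * ((m : ℝ) / q₀ : ℝ) / Q))
        = ZMod.stdAddChar ((m * n : ℤ) : ZMod q) := by
      rw [ZMod.stdAddChar_coe, D.q_eq]
      congr 1
      have := (NeZero.ne (q₀ : ℂ)); have := (NeZero.ne (Q : ℂ))
      push_cast
      field_simp
    have h5 : Real.exp (-Real.pi * (m ^ 2 * t + n ^ 2 * (1 / v)) / q)
        = Real.exp (-Real.pi * m ^ 2 * t / q) *
          Real.exp (-Real.pi * n ^ 2 / (Q ^ 2 * (q₀ * v / Q))) := by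
      rw [← Real.exp_add, hq]
      congr 1
      field_simp
      ring
    rw [← h3, h5, ← h4]
    push_cast
    ring
  · simp

theorem IsCosetData.cosetKernel_eq (D : IsCosetData p q q₀ Q χ a) {t v : ℝ} (ht : 0 < t)
    (hv : 0 < v) : cosetKernel p q q₀ Q a t v
      = (√(Q / (q₀ * v)) : ℝ) * dualKernel q Q a t (1 / v) := by
  rw [dualKernel, (summable_dualKernel ht (one_div_pos.mpr hv)).tsum_prod, cosetKernel,
    ← tsum_mul_left]
  refine tsum_congr fun m => ?_
  split_ifs with hm
  · simp only [D.intCast_mul_ne hm, if_false, tsum_zero, mul_zero]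
  · exact D.tsum_shift_eq hv t hm

theorem IsCosetData.cosetKernel_comm (D : IsCosetData p q q₀ Q χ a) {t v : ℝ} (ht : 0 < t)
    (hv : 0 < v) : cosetKernel p q q₀ Q a v t = (starRingEnd ℂ) (cosetKernel p q q₀ Q a t v) := by
  have h0 : (q₀.totient : ℂ) ≠ 0 := by
    exact_mod_cast (Nat.totient_pos.mpr (Nat.pos_of_ne_zero (NeZero.ne q₀))).ne'
  refine mul_left_cancel₀ h0 ?_
  have h := congrArg (starRingEnd ℂ) (D.sum_thetaChar ht hv)
  rw [map_mul, Complex.conj_natCast] at h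
  rw [← h, ← D.sum_thetaChar hv ht, map_sum]
  refine Finset.sum_congr rfl fun ψ _ => ?_
  rw [map_mul, Complex.conj_conj, mul_comm]

end DualKernel

section HalfHeaviside

open MeasureTheory

/-- The Heaviside function with value `1/2` at the origin. -/
noncomputable def halfHeaviside (s : ℝ) : ℝ := if 0 < s then 1 else if s = 0 then 1 / 2 else 0

theorem halfHeaviside_add_neg (s : ℝ) : halfHeaviside s + halfHeaviside (-s) = 1 := by
  rcases lt_trichotomy s 0 with h | h | h
  · simp [halfHeaviside, h, h.not_gt, h.ne]
  · simp [halfHeaviside, h]; norm_num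
  · simp [halfHeaviside, h, h.not_gt, h.ne']

theorem halfHeaviside_nonneg (s : ℝ) : 0 ≤ halfHeaviside s := by
  unfold halfHeaviside; split_ifs <;> norm_num

theorem halfHeaviside_le_one (s : ℝ) : halfHeaviside s ≤ 1 := by
  unfold halfHeaviside; split_ifs <;> norm_num

theorem halfHeaviside_of_neg {s : ℝ} (hs : s < 0) : halfHeaviside s = 0 := by
  simp [halfHeaviside, hs.not_gt, hs.ne]

theorem halfHeaviside_of_pos {s : ℝ} (hs : 0 < s) : halfHeaviside s = 1 := by
  simp [halfHeaviside, hs]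

theorem measurable_halfHeaviside : Measurable halfHeaviside :=
  Measurable.ite measurableSet_Ioi measurable_const
    (Measurable.ite (measurableSet_singleton 0) measurable_const measurable_const)

theorem MeasureTheory.Integrable.mul_halfHeaviside {f g : ℝ × ℝ → ℝ} (hf : Integrable f)
    (hg : Measurable g) : Integrable fun z => f z * halfHeaviside (g z) := by
  refine hf.mul_bdd (c := 1) (measurable_halfHeaviside.comp hg).aestronglyMeasurable
    (ae_of_all _ fun z => ?_)
  rw [Real.norm_of_nonneg (halfHeaviside_nonneg _)]
  exact halfHeaviside_le_one _

theorem integral_comp_swap (f : ℝ × ℝ → ℝ) : ∫ z : ℝ × ℝ, f z.swap = ∫ z, f z :=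
  integral_prod_swap (μ := (volume : Measure ℝ)) (ν := (volume : Measure ℝ)) f

theorem integral_eq_two_mul_halfHeaviside {f g : ℝ × ℝ → ℝ} (hf : Integrable f)
    (hg : Measurable g) {T : ℝ × ℝ → ℝ × ℝ} (hT : ∀ h : ℝ × ℝ → ℝ, ∫ z, h (T z) = ∫ z, h z)
    (hfT : ∀ z, f (T z) = f z) (hgT : ∀ z, g (T z) = - g z) :
    ∫ z, f z = 2 * ∫ z, f z * halfHeaviside (g z) := by
  have h1 : ∫ z, f z * halfHeaviside (- g z) = ∫ z, f z * halfHeaviside (g z) := by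
    rw [← hT]
    simp only [hfT, hgT, neg_neg]
  rw [two_mul]
  nth_rewrite 2 [← h1]
  rw [← integral_add (hf.mul_halfHeaviside hg) (hf.mul_halfHeaviside (g := fun z => -g z) hg.neg)]
  refine integral_congr_ae (ae_of_all _ fun z => ?_)
  simp only [← mul_add, halfHeaviside_add_neg, mul_one]

theorem integral_eq_four_mul_halfHeaviside {f : ℝ × ℝ → ℝ} (hf : Integrable f)
    (h1 : ∀ z, f z.swap = f z) (h2 : ∀ z, f (-z.swap) = f z) :
    ∫ z, f z = 4 * ∫ z, f z * halfHeaviside (z.1 - z.2) * halfHeaviside (z.1 + z.2) := by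
  have hm1 : Measurable fun z : ℝ × ℝ => z.1 - z.2 := measurable_fst.sub measurable_snd
  have hm2 : Measurable fun z : ℝ × ℝ => z.1 + z.2 := measurable_fst.add measurable_snd
  rw [integral_eq_two_mul_halfHeaviside hf hm1 (T := Prod.swap) integral_comp_swap h1
    fun z => by simp]
  rw [integral_eq_two_mul_halfHeaviside (hf.mul_halfHeaviside hm1) hm2 (T := fun z => -z.swap)]
  · ring
  · intro h
    rw [integral_comp_swap (fun z => h (-z))]
    exact integral_neg_eq_self h _
  · intro z
    simp only [h2]
    congr 2
    simp only [Prod.fst_neg, Prod.snd_neg, Prod.fst_swap, Prod.snd_swap]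
    ring
  · intro z
    simp only [Prod.fst_neg, Prod.snd_neg, Prod.fst_swap, Prod.snd_swap]
    ring

end HalfHeaviside

section SecondMoment

open MeasureTheory

variable {p q q₀ Q : ℕ} [NeZero q] [NeZero q₀] [NeZero Q] {χ : DirichletCharacter ℂ q} {a : ℤ}

/-- The real part of the coset kernel in logarithmic coordinates. -/
noncomputable def logKernel (p q q₀ Q : ℕ) [NeZero Q] (a : ℤ) (z : ℝ × ℝ) : ℝ :=
  Real.exp ((z.1 + z.2) / 4) * (cosetKernel p q q₀ Q a (Real.exp z.1) (Real.exp z.2)).re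

theorem IsCosetData.logKernel_swap (D : IsCosetData p q q₀ Q χ a) (z : ℝ × ℝ) :
    logKernel p q q₀ Q a z.swap = logKernel p q q₀ Q a z := by
  rw [logKernel, logKernel, Prod.fst_swap, Prod.snd_swap,
    D.cosetKernel_comm (Real.exp_pos z.1) (Real.exp_pos z.2), Complex.conj_re, add_comm]

theorem IsCosetData.logKernel_eq_dual (D : IsCosetData p q q₀ Q χ a) (z : ℝ × ℝ) :
    logKernel p q q₀ Q a z = √(Q / q₀) * Real.exp ((z.1 - z.2) / 4) *
      (dualKernel q Q a (Real.exp z.1) (Real.exp (-z.2))).re := by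
  rw [logKernel, D.cosetKernel_eq (Real.exp_pos z.1) (Real.exp_pos z.2), Complex.re_ofReal_mul,
    one_div, ← Real.exp_neg]
  have h1 : √((Q : ℝ) / (q₀ * Real.exp z.2)) = √(Q / q₀) * Real.exp (-(z.2 / 2)) := by
    rw [← div_div, Real.sqrt_div' _ (Real.exp_pos _).le, Real.exp_neg, Real.exp_half, div_eq_mul_inv]
  rw [h1, show (z.1 - z.2) / 4 = (z.1 + z.2) / 4 + -(z.2 / 2) by ring, Real.exp_add]
  ring

theorem IsCosetData.logKernel_neg_swap (D : IsCosetData p q q₀ Q χ a) (z : ℝ × ℝ) :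
    logKernel p q q₀ Q a (-z.swap) = logKernel p q q₀ Q a z := by
  rw [D.logKernel_eq_dual, D.logKernel_eq_dual]
  simp only [Prod.fst_neg, Prod.snd_neg, Prod.fst_swap, Prod.snd_swap, neg_neg]
  rw [dualKernel_comm, show -z.2 - -z.1 = z.1 - z.2 by ring]

theorem IsCosetData.twist_ne_one (D : IsCosetData p q q₀ Q χ a) (ψ : DirichletCharacter ℂ q₀) :
    χ * DirichletCharacter.changeLevel D.dvd ψ ≠ 1 := by
  intro h
  have hu : IsUnit ((1 + q₀ * 1 : ℤ) : ZMod q) := by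
    rw [isUnit_intCast_primePow_iff D.prime D.exists_q_eq]
    obtain ⟨j, hj, h1⟩ := D.q₀_eq
    intro hd
    have h2 : (p : ℤ) ∣ q₀ * 1 := by
      rw [h1]; push_cast; exact (dvd_pow_self _ hj).mul_right 1
    have h3 : (p : ℤ) ∣ 1 := (Int.dvd_add_left h2).mp hd
    exact D.prime.one_lt.ne' (by exact_mod_cast Int.eq_one_of_dvd_one (by positivity) h3)
  have h1 := congrArg (fun η : DirichletCharacter ℂ q => η ((1 + q₀ * 1 : ℤ) : ZMod q)) h
  simp only [MulChar.mul_apply] at h1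
  rw [changeLevel_apply_intCast _ _ hu, MulChar.one_apply hu, D.map_one_add, mul_one] at h1
  have h2 : (((1 + q₀ * 1 : ℤ)) : ZMod q₀) = 1 := by simp
  rw [h2, map_one, mul_one] at h1
  have h3 : (a : ZMod Q) = 0 := by
    refine ZMod.injective_stdAddChar ?_
    rw [h1, AddChar.map_zero_eq_one]
  obtain ⟨e, he, hQ⟩ := D.Q_eq
  rw [ZMod.intCast_zmod_eq_zero_iff_dvd, hQ, Nat.cast_pow] at h3
  exact D.not_dvd ((dvd_pow_self _ he).trans h3)

theorem IsCosetData.q_ne_one (D : IsCosetData p q q₀ Q χ a) : q ≠ 1 := by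
  obtain ⟨e, he, hq⟩ := D.exists_q_eq
  rw [hq]
  exact (one_lt_pow₀ D.prime.one_lt he).ne'

theorem twist_even_iff {q n : ℕ} {h : n ∣ q} {χ : DirichletCharacter ℂ q} (he : χ.Even) (ψ : DirichletCharacter ℂ n) :
    (χ * DirichletCharacter.changeLevel h ψ).Even ↔ ψ.Even := by
  have hu : IsUnit (((-1 : ℤ)) : ZMod q) := by
    rw [Int.cast_neg, Int.cast_one]; exact isUnit_one.neg
  have h1 := changeLevel_apply_intCast h ψ hu
  push_cast at h1
  rw [DirichletCharacter.Even, DirichletCharacter.Even, MulChar.mul_apply, he, h1, one_mul]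

open Classical in
theorem IsCosetData.integral_twist (D : IsCosetData p q q₀ Q χ a) (he : χ.Even)
    (ψ : DirichletCharacter ℂ q₀) :
    Integrable (fun x : ℝ => (Real.exp (x / 4) : ℂ) *
      thetaChar (χ * DirichletCharacter.changeLevel D.dvd ψ) (Real.exp x)) ∧
    ∫ x : ℝ, (Real.exp (x / 4) : ℂ) *
      thetaChar (χ * DirichletCharacter.changeLevel D.dvd ψ) (Real.exp x)
      = if ψ.Even then 2 * (((q / Real.pi) ^ (1 / 4 : ℝ) * Real.Gamma (1 / 4) : ℝ) : ℂ) *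
        (χ * DirichletCharacter.changeLevel D.dvd ψ).LFunction (1 / 2) else 0 := by
  split_ifs with h
  · exact integral_thetaChar_exp D.q_ne_one (D.twist_ne_one ψ) ((twist_even_iff he ψ).mpr h)
  · have ho : (χ * DirichletCharacter.changeLevel D.dvd ψ).Odd :=
      ((χ * DirichletCharacter.changeLevel D.dvd ψ).even_or_odd).resolve_left
        fun h' => h ((twist_even_iff he ψ).mp h')
    simp [thetaChar_eq_zero_of_odd ho]

open Classical in
theorem IsCosetData.integral_logKernel (D : IsCosetData p q q₀ Q χ a) (he : χ.Even) :
    Integrable (logKernel p q q₀ Q a) ∧ q₀.totient * ∫ z, logKernel p q q₀ Q a z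
      = 4 * √(q / Real.pi) * Real.Gamma (1 / 4) ^ 2 *
        ∑ ψ : DirichletCharacter ℂ q₀, if ψ.Even then
          ‖(χ * DirichletCharacter.changeLevel D.dvd ψ).LFunction (1 / 2)‖ ^ 2 else 0 := by
  set F : DirichletCharacter ℂ q₀ → ℝ → ℂ := fun ψ x => (Real.exp (x / 4) : ℂ) *
      thetaChar (χ * DirichletCharacter.changeLevel D.dvd ψ) (Real.exp x) with hF
  have hFi : ∀ ψ, Integrable (F ψ) := fun ψ => (D.integral_twist he ψ).1
  have hFc : ∀ ψ, Integrable fun y => (starRingEnd ℂ) (F ψ y) := fun ψ =>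
    LinearIsometryEquiv.integrable_comp_iff Complex.conjLIE |>.mpr (hFi ψ)
  have hprod : ∀ ψ, Integrable fun z : ℝ × ℝ => F ψ z.1 * (starRingEnd ℂ) (F ψ z.2) :=
    fun ψ => (hFi ψ).mul_prod (hFc ψ)
  have hsum : (fun z : ℝ × ℝ => ∑ ψ, F ψ z.1 * (starRingEnd ℂ) (F ψ z.2)) = fun z =>
      (q₀.totient : ℂ) * ((Real.exp ((z.1 + z.2) / 4) : ℂ) *
        cosetKernel p q q₀ Q a (Real.exp z.1) (Real.exp z.2)) := by
    funext z
    rw [mul_left_comm, ← D.sum_thetaChar (Real.exp_pos z.1) (Real.exp_pos z.2), Finset.mul_sum,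
      add_div, Real.exp_add]
    refine Finset.sum_congr rfl fun ψ _ => ?_
    simp only [hF, map_mul, Complex.conj_ofReal, ofReal_mul]
    ring
  have hre : ∀ z : ℝ × ℝ, q₀.totient * logKernel p q q₀ Q a z
      = (∑ ψ, F ψ z.1 * (starRingEnd ℂ) (F ψ z.2)).re := fun z => by
    have := congrFun hsum z
    rw [this, logKernel, ← ofReal_natCast, Complex.re_ofReal_mul, Complex.re_ofReal_mul]
  have hxi : Integrable fun z : ℝ × ℝ => ∑ ψ, F ψ z.1 * (starRingEnd ℂ) (F ψ z.2) :=
    integrable_finsetSum _ fun ψ _ => hprod ψ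
  have h0 : (q₀.totient : ℝ) ≠ 0 := by
    exact_mod_cast (Nat.totient_pos.mpr (Nat.pos_of_ne_zero (NeZero.ne q₀))).ne'
  constructor
  · refine (hxi.re.const_mul ((q₀.totient : ℝ)⁻¹)).congr (ae_of_all _ fun z => ?_)
    change (q₀.totient : ℝ)⁻¹ * (∑ ψ, F ψ z.1 * (starRingEnd ℂ) (F ψ z.2)).re = _
    rw [← hre, ← mul_assoc, inv_mul_cancel₀ h0, one_mul]
  · rw [← integral_const_mul]
    rw [integral_congr_ae (ae_of_all _ hre)]
    have h1 : ∫ z : ℝ × ℝ, (∑ ψ, F ψ z.1 * (starRingEnd ℂ) (F ψ z.2)).re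
        = (∫ z : ℝ × ℝ, ∑ ψ, F ψ z.1 * (starRingEnd ℂ) (F ψ z.2)).re := integral_re hxi
    rw [h1, integral_finsetSum _ fun ψ _ => hprod ψ, Complex.re_sum, Finset.mul_sum]
    refine Finset.sum_congr rfl fun ψ _ => ?_
    have h2 : ∫ z : ℝ × ℝ, F ψ z.1 * (starRingEnd ℂ) (F ψ z.2)
        = (∫ x, F ψ x) * ∫ y, (starRingEnd ℂ) (F ψ y) :=
      integral_prod_mul (F ψ) fun y => (starRingEnd ℂ) (F ψ y)
    rw [h2, integral_conj, Complex.mul_conj, ofReal_re, Complex.normSq_eq_norm_sq,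
      (D.integral_twist he ψ).2]
    split_ifs
    · rw [norm_mul, norm_mul, norm_real, Real.norm_of_nonneg (mul_nonneg (by positivity)
        (Real.Gamma_pos_of_pos (by norm_num)).le), Complex.norm_ofNat, Real.sqrt_eq_rpow,
        show (1 / 2 : ℝ) = 1 / 4 * (2 : ℕ) by norm_num, Real.rpow_mul (by positivity),
        Real.rpow_natCast]
      ring
    · simp

end SecondMoment

section IntegerSums

theorem tsum_int_eq {g : ℤ → ℂ} (hg : Summable g) :
    ∑' h, g h = g 0 + ∑' n : ℕ, g ((n + 1 : ℕ) : ℤ) + ∑' n : ℕ, g (-((n + 1 : ℕ) : ℤ)) := by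
  have h1 : Summable fun n : ℕ => g n := hg.comp_injective Nat.cast_injective
  have h2 : Summable fun n : ℕ => g (-((n + 1 : ℕ) : ℤ)) := by
    refine hg.comp_injective fun x y hxy => ?_
    simpa using hxy
  have h3 : HasSum g (∑' n : ℕ, g n + ∑' n : ℕ, g (-((n + 1 : ℕ) : ℤ))) := by
    refine HasSum.of_nat_of_neg_add_one h1.hasSum ?_
    simpa using h2.hasSum
  rw [h3.tsum_eq, h1.tsum_eq_zero_add, Nat.cast_zero]

theorem norm_tsum_int_sub_le {g : ℤ → ℂ} (hg : Summable g) {b : ℕ → ℝ} (hb : Summable b)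
    (h1 : ∀ h : ℤ, h ≠ 0 → ‖g h‖ ≤ b (h.natAbs - 1)) : ‖∑' h, g h - g 0‖ ≤ 2 * ∑' n, b n := by
  have h2 : ‖∑' n : ℕ, g ((n + 1 : ℕ) : ℤ)‖ ≤ ∑' n, b n :=
    tsum_of_norm_bounded hb.hasSum fun n => by
      simpa only [Int.natAbs_natCast, Nat.add_sub_cancel] using
        h1 ((n + 1 : ℕ) : ℤ) (by positivity)
  have h3 : ‖∑' n : ℕ, g (-((n + 1 : ℕ) : ℤ))‖ ≤ ∑' n, b n :=
    tsum_of_norm_bounded hb.hasSum fun n => by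
      simpa only [Int.natAbs_neg, Int.natAbs_natCast, Nat.add_sub_cancel] using
        h1 (-((n + 1 : ℕ) : ℤ)) (neg_ne_zero.mpr (by positivity))
  rw [tsum_int_eq hg, show ∀ x y z : ℂ, x + y + z - x = y + z by intros; ring]
  calc _ ≤ _ := norm_add_le _ _
    _ ≤ _ := by linarith

theorem tsum_int_exp_neg_sq_le {β : ℝ} (hβ : 0 < β) :
    ∑' j : ℤ, Real.exp (-Real.pi * j ^ 2 * β) ≤ 1 + 1 / √β := by
  have h := norm_tsum_int_sub_le (g := fun j => (Real.exp (-Real.pi * j ^ 2 * β) : ℂ))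
    (ofRealCLM.summable (summable_exp_neg_sq hβ)) (summable_nat_exp_neg_sq hβ) fun h hh => by
      have h1 : h.natAbs - 1 + 1 = h.natAbs := Nat.sub_add_cancel (Int.natAbs_pos.mpr hh)
      rw [h1, norm_real, Real.norm_of_nonneg (Real.exp_pos _).le, ← Int.cast_natCast (R := ℝ),
        Int.natCast_natAbs, Int.cast_abs, sq_abs]
      exact le_of_eq (by ring_nf)
  rw [← ofReal_tsum] at h
  simp only [Int.cast_zero, ne_eq, OfNat.ofNat_ne_zero, not_false_eq_true, zero_pow, mul_zero,
    zero_mul, Real.exp_zero, ← ofReal_sub, norm_real] at h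
  have h2 := (le_abs_self _).trans h
  have h3 := tsum_nat_exp_neg_sq_le hβ
  have h4 : 2 * (1 / (2 * √β)) = 1 / √β := by ring
  linarith

end IntegerSums

section GcdSums

theorem summable_dvd_exp_neg_sq {X : ℝ} (hX : 0 < X) {d : ℕ} (hd : 0 < d) :
    Summable (fun n : ℕ => if d ∣ n + 1 then Real.exp (-Real.pi * X * ((n + 1 : ℕ) : ℝ) ^ 2) else 0)
    ∧ ∑' n : ℕ, (if d ∣ n + 1 then Real.exp (-Real.pi * X * ((n + 1 : ℕ) : ℝ) ^ 2) else 0)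
      ≤ 1 / (2 * √X * d) := by
  have hd' : (0 : ℝ) < d := by exact_mod_cast hd
  constructor
  · refine Summable.of_nonneg_of_le (fun n => ?_) (fun n => ?_) (summable_nat_exp_neg_sq hX)
    · split_ifs; exacts [(Real.exp_pos _).le, le_rfl]
    · split_ifs; exacts [le_rfl, (Real.exp_pos _).le]
  set f : ℕ → ℝ := fun n => if d ∣ n + 1 then
    Real.exp (-Real.pi * X * ((n + 1 : ℕ) : ℝ) ^ 2) else 0 with hf
  have hpos : ∀ l : ℕ, d * (l + 1) - 1 + 1 = d * (l + 1) := fun l =>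
    Nat.sub_add_cancel (Nat.mul_pos hd l.succ_pos)
  have hinj : Function.Injective fun l : ℕ => d * (l + 1) - 1 := fun x y hxy => by
    have h0 : d * (x + 1) - 1 = d * (y + 1) - 1 := hxy
    have h1 : d * (x + 1) = d * (y + 1) := by rw [← hpos x, ← hpos y, h0]
    exact Nat.succ_injective (Nat.eq_of_mul_eq_mul_left hd h1)
  have h1 : ∑' l : ℕ, f (d * (l + 1) - 1) = ∑' n, f n := by
    refine hinj.tsum_eq fun n hn => ?_
    have h2 : d ∣ n + 1 := by
      by_contra h
      simp [hf, h] at hn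
    obtain ⟨c, hc⟩ := h2
    have hc0 : c ≠ 0 := by rintro rfl; simp at hc
    refine ⟨c - 1, ?_⟩
    simp only
    rw [Nat.sub_add_cancel (Nat.pos_of_ne_zero hc0), ← hc, Nat.add_sub_cancel]
  have h2 : ∀ l : ℕ, f (d * (l + 1) - 1)
      = Real.exp (-Real.pi * (X * d ^ 2) * ((l + 1 : ℕ) : ℝ) ^ 2) := fun l => by
    simp only [hf, hpos, dvd_mul_right, if_true]
    congr 1
    push_cast
    ring
  rw [← h1]
  simp_rw [h2]
  refine (tsum_nat_exp_neg_sq_le (by positivity)).trans (le_of_eq ?_)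
  rw [Real.sqrt_mul hX.le, Real.sqrt_sq hd'.le]
  ring

theorem sqrt_gcd_le_sum {p : ℕ} (hp : p.Prime) (e n : ℕ) :
    √((n.gcd (p ^ e) : ℕ) : ℝ) ≤ ∑ i ∈ Finset.range (e + 1), if p ^ i ∣ n then √(p : ℝ) ^ i else 0 := by
  obtain ⟨i, hi, h⟩ := (Nat.dvd_prime_pow hp).mp (Nat.gcd_dvd_right n (p ^ e))
  have h1 : p ^ i ∣ n := h ▸ Nat.gcd_dvd_left n (p ^ e)
  have h2 := Finset.single_le_sum (f := fun i => if p ^ i ∣ n then √(p : ℝ) ^ i else 0)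
    (fun i _ => by split_ifs <;> positivity) (Finset.mem_range.mpr (Nat.lt_succ_of_le hi))
  simp only [h1, if_true] at h2
  rw [h, Nat.cast_pow]
  refine le_trans (le_of_eq ?_) h2
  rw [Real.sqrt_eq_iff_eq_sq (by positivity) (by positivity), ← pow_mul, mul_comm, pow_mul,
    Real.sq_sqrt (by positivity)]

theorem tsum_sqrt_gcd_exp_le {p : ℕ} (hp : p.Prime) (e : ℕ) {X : ℝ} (hX : 0 < X) :
    Summable (fun n : ℕ => √(((n + 1).gcd (p ^ e) : ℕ) : ℝ) *
      Real.exp (-Real.pi * X * ((n + 1 : ℕ) : ℝ) ^ 2)) ∧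
    ∑' n : ℕ, √(((n + 1).gcd (p ^ e) : ℕ) : ℝ) *
      Real.exp (-Real.pi * X * ((n + 1 : ℕ) : ℝ) ^ 2) ≤ 2 / √X := by
  have hp0 : (0 : ℝ) < p := by exact_mod_cast hp.pos
  set s := √(p : ℝ) with hs
  have hs0 : 0 < s := Real.sqrt_pos.mpr hp0
  have hss : s ^ 2 = p := Real.sq_sqrt hp0.le
  have hs1 : (7 / 5 : ℝ) ≤ s := by
    refine Real.le_sqrt_of_sq_le ?_
    have : (2 : ℝ) ≤ p := by exact_mod_cast hp.two_le
    norm_num; linarith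
  set E : ℕ → ℝ := fun n => Real.exp (-Real.pi * X * ((n + 1 : ℕ) : ℝ) ^ 2) with hE
  have hle : ∀ n : ℕ, √(((n + 1).gcd (p ^ e) : ℕ) : ℝ) * E n
      ≤ ∑ i ∈ Finset.range (e + 1), s ^ i * (if p ^ i ∣ n + 1 then E n else 0) := fun n => by
    refine (mul_le_mul_of_nonneg_right (sqrt_gcd_le_sum hp e (n + 1)) (Real.exp_pos _).le).trans
      (le_of_eq ?_)
    rw [Finset.sum_mul]
    refine Finset.sum_congr rfl fun i _ => ?_
    split_ifs
    · rfl
    · simp only [zero_mul, mul_zero]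
  have hd := fun i : ℕ => summable_dvd_exp_neg_sq hX (pow_pos hp.pos i)
  have hsum : Summable fun n : ℕ => ∑ i ∈ Finset.range (e + 1),
      s ^ i * (if p ^ i ∣ n + 1 then E n else 0) :=
    summable_sum fun i _ => (hd i).1.mul_left _
  have hsum' := Summable.of_nonneg_of_le
    (fun n => mul_nonneg (Real.sqrt_nonneg _) (Real.exp_pos _).le) hle hsum
  refine ⟨hsum', (hsum'.tsum_le_tsum hle hsum).trans ?_⟩
  rw [Summable.tsum_finsetSum fun i _ => (hd i).1.mul_left _]
  have hX' : 0 < √X := Real.sqrt_pos.mpr hX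
  have h1 : ∀ i ∈ Finset.range (e + 1), ∑' n : ℕ, s ^ i * (if p ^ i ∣ n + 1 then E n else 0)
      ≤ 1 / (2 * √X) * (5 / 7) ^ i := fun i _ => by
    rw [tsum_mul_left]
    refine (mul_le_mul_of_nonneg_left (hd i).2 (by positivity)).trans ?_
    rw [Nat.cast_pow, ← hss, ← pow_mul, mul_comm 2 i, pow_mul, sq]
    have h2 : s ^ i * (1 / (2 * √X * (s ^ i * s ^ i))) = 1 / (2 * √X) * (1 / s) ^ i := by
      rw [one_div_pow]; field_simp
    have h3 : 1 / s ≤ 5 / 7 := by rw [div_le_div_iff₀ hs0 (by norm_num)]; linarith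
    rw [← mul_pow, mul_pow, h2]
    gcongr
  refine (Finset.sum_le_sum h1).trans ?_
  rw [← Finset.mul_sum]
  have h4 : ∑ i ∈ Finset.range (e + 1), (5 / 7 : ℝ) ^ i ≤ 4 := by
    rw [geom_sum_eq (by norm_num)]
    have : (0 : ℝ) ≤ (5 / 7) ^ (e + 1) := by positivity
    rw [div_le_iff_of_neg (by norm_num)]
    linarith
  calc _ ≤ 1 / (2 * √X) * 4 := by gcongr
    _ = 2 / √X := by ring

end GcdSums

section DiagonalApproximation

/-- The contribution of the trivial shift to `cosetKernel`. -/
noncomputable def diagKernel (p q : ℕ) (s : ℝ) : ℝ :=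
  ∑' m : ℤ, if (p : ℤ) ∣ m then 0 else Real.exp (-Real.pi * m ^ 2 * s / q)

/-- The terms of `cosetKernel` with a given shift `h`. -/
noncomputable def shiftKernel (p q q₀ Q : ℕ) [NeZero Q] (a : ℤ) (t v : ℝ) (h : ℤ) : ℂ :=
  ∑' m : ℤ, if (p : ℤ) ∣ m then 0 else
    ZMod.stdAddChar (-((a : ZMod Q) * (m : ZMod Q)⁻¹ * (h : ZMod Q))) *
      (Real.exp (-Real.pi * (m ^ 2 * t + (m + q₀ * h) ^ 2 * v) / q) : ℂ)

theorem shiftKernel_zero {p q q₀ Q : ℕ} [NeZero Q] {a : ℤ} (t v : ℝ) : shiftKernel p q q₀ Q a t v 0 = diagKernel p q (t + v) := by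
  rw [shiftKernel, diagKernel, ofReal_tsum]
  refine tsum_congr fun m => ?_
  split_ifs
  · simp
  · rw [Int.cast_zero, mul_zero, neg_zero, AddChar.map_zero_eq_one, one_mul]
    congr 2
    push_cast
    ring

variable {p q q₀ Q : ℕ} [NeZero q] [NeZero q₀] [NeZero Q] {χ : DirichletCharacter ℂ q} {a : ℤ}

theorem hasSum_shiftKernel {t v : ℝ} (ht : 0 < t) (hv : 0 < v) :
    Summable (shiftKernel p q q₀ Q a t v) ∧
      cosetKernel p q q₀ Q a t v = ∑' h, shiftKernel p q q₀ Q a t v h := by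
  set F : ℤ → ℤ → ℂ := fun m h => if (p : ℤ) ∣ m then 0 else
    ZMod.stdAddChar (-((a : ZMod Q) * (m : ZMod Q)⁻¹ * (h : ZMod Q))) *
      (Real.exp (-Real.pi * (m ^ 2 * t + (m + q₀ * h) ^ 2 * v) / q) : ℂ) with hF
  have hinj : Function.Injective fun z : ℤ × ℤ => (z.1, z.1 + q₀ * z.2) := by
    rintro ⟨m, h⟩ ⟨m', h'⟩ hz
    simp only [Prod.mk.injEq] at hz
    obtain ⟨rfl, hz⟩ := hz
    have := NeZero.ne q₀
    simpa [this] using hz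
  have hs : Summable (Function.uncurry F) := by
    refine Summable.of_norm_bounded
      ((summable_exp_neg_sq_add_sq_div (q := q) ht hv).comp_injective hinj) fun z => ?_
    simp only [hF, Function.uncurry, Function.comp]
    split_ifs
    · rw [norm_zero]; exact (Real.exp_pos _).le
    · rw [norm_mul, norm_stdAddChar, one_mul, norm_real, Real.norm_of_nonneg (Real.exp_pos _).le]
      push_cast
      exact le_rfl
  refine ⟨hs.prod_symm.prod, ?_⟩
  have h1 : cosetKernel p q q₀ Q a t v = ∑' m, ∑' h, F m h := by
    refine tsum_congr fun m => ?_
    simp only [hF]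
    split_ifs <;> simp
  rw [h1]
  exact hs.tsum_comm.symm

theorem sum_isUnit_stdAddChar (b j : ZMod Q) [DecidablePred fun u : ZMod Q => IsUnit u] :
    ∑ u : ZMod Q, (if IsUnit u then ZMod.stdAddChar (b * u⁻¹) else 0) * ZMod.stdAddChar (j * u)
      = kloosterman Q j b := by
  rw [kloosterman]
  symm
  refine Fintype.sum_of_injective (fun u : (ZMod Q)ˣ => (u : ZMod Q)) Units.val_injective _ _
    (fun u hu => ?_) fun u => ?_
  · have hu' : ¬ IsUnit u := hu
    rw [if_neg hu', zero_mul]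
  · rw [if_pos u.isUnit, ZMod.inv_coe_unit, ← AddChar.map_add_eq_mul, add_comm]

theorem IsCosetData.gcd_eq (D : IsCosetData p q q₀ Q χ a) (h : ℤ) :
    (-(a * h)).gcd Q = h.natAbs.gcd Q := by
  obtain ⟨e, -, rfl⟩ := D.Q_eq
  rw [Int.neg_gcd, Int.gcd, Int.natAbs_mul, Int.natAbs_natCast]
  refine Nat.Coprime.gcd_mul_left_cancel _ ?_
  refine Nat.Coprime.pow_right e (Nat.Coprime.symm <|
    (Nat.Prime.coprime_iff_not_dvd D.prime).mpr fun h => ?_)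
  exact D.not_dvd (Int.natCast_dvd.mpr h)

theorem IsCosetData.norm_shiftKernel_le (D : IsCosetData p q q₀ Q χ a) {t v : ℝ} (ht : 0 < t)
    (hv : 0 < v) (h : ℤ) : ‖shiftKernel p q q₀ Q a t v h‖ ≤
      2 * √Q * (√(q₀ / (Q * (t + v))) + 1) * (√((h.natAbs.gcd Q : ℕ) : ℝ) *
        Real.exp (-Real.pi * (q₀ / Q * (t * v / (t + v))) * h ^ 2)) := by
  classical
  have hQ : (0 : ℝ) < Q := by exact_mod_cast Nat.pos_of_ne_zero (NeZero.ne Q)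
  have hq₀ : (0 : ℝ) < q₀ := by exact_mod_cast Nat.pos_of_ne_zero (NeZero.ne q₀)
  have hq : (q : ℝ) = q₀ * Q := by exact_mod_cast D.q_eq
  have htv : 0 < t + v := by positivity
  have hα : 0 < (t + v) / (q₀ * Q) := by positivity
  set β : ℝ := q₀ / (Q * (t + v)) with hβ
  have hβ0 : 0 < β := by positivity
  set E : ℝ := Real.exp (-Real.pi * (q₀ / Q * (t * v / (t + v))) * h ^ 2) with hE
  have h1 : shiftKernel p q q₀ Q a t v h = (E : ℂ) * ((1 / (Q * √((t + v) / (q₀ * Q))) : ℝ) *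
      ∑' j : ℤ, kloosterman Q (j : ZMod Q) ((-(a * h) : ℤ) : ZMod Q) *
        ((Real.exp (-Real.pi * j ^ 2 / (Q ^ 2 * ((t + v) / (q₀ * Q)))) : ℂ) *
          cexp (2 * Real.pi * I * (j * (q₀ * h * v / (t + v) : ℝ) / Q)))) := by
    rw [shiftKernel]
    have h2 := tsum_periodic_gaussian Q
      (fun u => if IsUnit u then ZMod.stdAddChar (((-(a * h) : ℤ) : ZMod Q) * u⁻¹) else 0) hα
      (q₀ * h * v / (t + v))
    simp only [sum_isUnit_stdAddChar] at h2
    rw [← h2, ← tsum_mul_left]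
    refine tsum_congr fun m => ?_
    simp only [isUnit_intCast_primePow_iff D.prime D.Q_eq, ite_not]
    split_ifs
    · simp
    · rw [mul_left_comm, ← ofReal_mul, ← Real.exp_add, hq]
      congr 3
      · push_cast; ring
      · field_simp
        ring
  have hK : ∀ j : ℤ, ‖kloosterman Q (j : ZMod Q) ((-(a * h) : ℤ) : ZMod Q) *
        ((Real.exp (-Real.pi * j ^ 2 / (Q ^ 2 * ((t + v) / (q₀ * Q)))) : ℂ) *
          cexp (2 * Real.pi * I * (j * (q₀ * h * v / (t + v) : ℝ) / Q)))‖
      ≤ 2 * √Q * √((h.natAbs.gcd Q : ℕ) : ℝ) * Real.exp (-Real.pi * j ^ 2 * β) := fun j => by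
    obtain ⟨e, -, he⟩ := D.Q_eq
    have h3 := norm_kloosterman_primePow_le D.prime D.ne_two e Q he j (-(a * h))
    rw [D.gcd_eq, Real.sqrt_mul hQ.le, ← mul_assoc] at h3
    have h4 : cexp (2 * Real.pi * I * (j * (q₀ * h * v / (t + v) : ℝ) / Q))
        = cexp ((2 * Real.pi * (j * (q₀ * h * v / (t + v)) / Q) : ℝ) * I) := by
      congr 1; push_cast; ring
    have h5 : -Real.pi * j ^ 2 / (Q ^ 2 * ((t + v) / (q₀ * Q))) = -Real.pi * j ^ 2 * β := by
      rw [hβ]; field_simp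
    rw [norm_mul, norm_mul, h4, norm_exp_ofReal_mul_I, mul_one, norm_real, h5,
      Real.norm_of_nonneg (Real.exp_pos _).le]
    gcongr
  have h6 := tsum_of_norm_bounded (((summable_exp_neg_sq hβ0).mul_left _).hasSum) hK
  rw [tsum_mul_left] at h6
  have h7 : 1 / (Q * √((t + v) / (q₀ * Q))) = √β := by
    rw [eq_comm, Real.sqrt_eq_iff_eq_sq hβ0.le (by positivity), div_pow, mul_pow,
      Real.sq_sqrt (by positivity), hβ]
    field_simp
  rw [h1, h7, norm_mul, norm_mul, norm_real, norm_real, Real.norm_of_nonneg (Real.exp_pos _).le,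
    Real.norm_of_nonneg (Real.sqrt_nonneg _)]
  have h8 : √β * (1 + 1 / √β) = √β + 1 := by
    have := (Real.sqrt_pos.mpr hβ0).ne'
    field_simp
  calc _ ≤ E * (√β * (2 * √Q * √((h.natAbs.gcd Q : ℕ) : ℝ) * (1 + 1 / √β))) := by
        gcongr
        exact h6.trans (by gcongr; exact tsum_int_exp_neg_sq_le hβ0)
    _ = 2 * √Q * (√β * (1 + 1 / √β)) * (√((h.natAbs.gcd Q : ℕ) : ℝ) * E) := by ring
    _ = _ := by rw [h8]

theorem IsCosetData.norm_cosetKernel_sub_le (D : IsCosetData p q q₀ Q χ a) {t v : ℝ} (ht : 1 ≤ t)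
    (hv : 0 < v) (hvt : v ≤ t) :
    ‖cosetKernel p q q₀ Q a t v - diagKernel p q (t + v)‖ ≤ 20 * √(Q / v) := by
  have hQ : (0 : ℝ) < Q := by exact_mod_cast Nat.pos_of_ne_zero (NeZero.ne Q)
  have hq₀ : (0 : ℝ) < q₀ := by exact_mod_cast Nat.pos_of_ne_zero (NeZero.ne q₀)
  have hQq : (Q : ℝ) ≤ q₀ := by
    exact_mod_cast Nat.le_of_dvd (Nat.pos_of_ne_zero (NeZero.ne q₀)) D.Q_dvd
  have ht0 : 0 < t := by linarith
  obtain ⟨hs, h1⟩ := hasSum_shiftKernel (p := p) (q := q) (q₀ := q₀) (Q := Q) (a := a) ht0 hv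
  obtain ⟨e, -, he⟩ := D.Q_eq
  set β : ℝ := q₀ / (Q * (t + v)) with hβ
  set X : ℝ := q₀ / Q * (t * v / (t + v)) with hX
  have hX0 : 0 < X := by positivity
  have hβ0 : 0 < β := by positivity
  obtain ⟨h2, h3⟩ := tsum_sqrt_gcd_exp_le D.prime e hX0
  have h4 := norm_tsum_int_sub_le hs (h2.mul_left (2 * √Q * (√β + 1))) fun h hh => by
    have h5 : h.natAbs - 1 + 1 = h.natAbs := Nat.sub_add_cancel (Int.natAbs_pos.mpr hh)
    rw [h5, ← he, ← Int.cast_natCast (R := ℝ) h.natAbs, Int.natCast_natAbs, Int.cast_abs, sq_abs]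
    exact D.norm_shiftKernel_le ht0 hv h
  rw [h1, ← shiftKernel_zero (q₀ := q₀) (Q := Q) (a := a)]
  refine h4.trans ?_
  rw [tsum_mul_left]
  have h6 : √β / √X ≤ 1 / √v := by
    rw [← Real.sqrt_div hβ0.le, ← Real.sqrt_one, ← Real.sqrt_div zero_le_one, hβ, hX]
    refine Real.sqrt_le_sqrt ?_
    have : (q₀ : ℝ) / (Q * (t + v)) / (q₀ / Q * (t * v / (t + v))) = 1 / (t * v) := by
      field_simp
    rw [this]
    exact one_div_le_one_div_of_le hv (le_mul_of_one_le_left hv.le ht)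
  have h7 : 1 / √X ≤ 3 / 2 * (1 / √v) := by
    have h8 : v / 2 ≤ X := by
      have h9 : v / 2 ≤ t * v / (t + v) := by
        rw [div_le_div_iff₀ (by norm_num) (by positivity)]
        nlinarith
      have h10 : 1 ≤ (q₀ : ℝ) / Q := (one_le_div hQ).mpr hQq
      exact h9.trans (le_mul_of_one_le_left (by positivity) h10)
    have h11 : (2 / 3) * √v ≤ √X := by
      refine Real.le_sqrt_of_sq_le ?_
      rw [mul_pow, Real.sq_sqrt hv.le]
      linarith
    have h12 : 0 < √v := Real.sqrt_pos.mpr hv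
    calc 1 / √X ≤ 1 / ((2 / 3) * √v) := one_div_le_one_div_of_le (by positivity) h11
      _ = _ := by field_simp
  rw [Real.sqrt_div hQ.le]
  calc _ ≤ 2 * (2 * √Q * (√β + 1) * (2 / √X)) := by gcongr
    _ = 8 * √Q * (√β / √X + 1 / √X) := by ring
    _ ≤ 8 * √Q * (1 / √v + 3 / 2 * (1 / √v)) := by gcongr
    _ = _ := by ring

end DiagonalApproximation

section ExponentialSums

theorem rpow_le_exp {x ε : ℝ} (hx : 0 ≤ x) (hε : 0 ≤ ε) (hε1 : ε ≤ 1) : x ^ ε ≤ Real.exp x := by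
  rcases le_total x 1 with h | h
  · exact (Real.rpow_le_one hx h hε).trans (Real.one_le_exp hx)
  · calc x ^ ε ≤ x ^ (1 : ℝ) := Real.rpow_le_rpow_of_exponent_le h hε1
      _ = x := Real.rpow_one x
      _ ≤ x + 1 := by linarith
      _ ≤ _ := Real.add_one_le_exp x

theorem tsum_rpow_mul_exp_le {ε Y : ℝ} (hε : 0 ≤ ε) (hε1 : ε ≤ 1) (hY : 0 < Y) :
    Summable (fun n : ℕ => ((n + 1 : ℕ) : ℝ) ^ ε * Real.exp (-Real.pi * ((n + 1 : ℕ) : ℝ) * Y)) ∧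
    ∑' n : ℕ, ((n + 1 : ℕ) : ℝ) ^ ε * Real.exp (-Real.pi * ((n + 1 : ℕ) : ℝ) * Y)
      ≤ Y ^ (-(1 + ε)) := by
  set r := Real.exp (-Y) with hr
  have hr1 : r < 1 := Real.exp_lt_one_iff.mpr (by linarith)
  have hr0 : 0 < r := Real.exp_pos _
  have hle : ∀ n : ℕ, ((n + 1 : ℕ) : ℝ) ^ ε * Real.exp (-Real.pi * ((n + 1 : ℕ) : ℝ) * Y)
      ≤ Y ^ (-ε) * r * r ^ n := fun n => by
    set N : ℝ := ((n + 1 : ℕ) : ℝ) with hN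
    have hN0 : 0 < N := by positivity
    have h1 := rpow_le_exp (mul_pos hN0 hY).le hε hε1
    rw [Real.mul_rpow hN0.le hY.le] at h1
    have h2 : N ^ ε ≤ Y ^ (-ε) * Real.exp (N * Y) := by
      rw [Real.rpow_neg hY.le, inv_mul_eq_div, le_div_iff₀ (Real.rpow_pos_of_pos hY _)]
      exact h1
    have h3 : r * r ^ n = Real.exp (-(N * Y)) := by
      rw [← pow_succ', hr, ← Real.exp_nat_mul, hN]
      ring_nf
    have h4 : Real.exp (N * Y) * Real.exp (-Real.pi * N * Y) ≤ Real.exp (-(N * Y)) := by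
      rw [← Real.exp_add, Real.exp_le_exp]
      nlinarith [Real.pi_gt_three, mul_pos hN0 hY]
    calc _ ≤ Y ^ (-ε) * Real.exp (N * Y) * Real.exp (-Real.pi * N * Y) := by gcongr
      _ ≤ Y ^ (-ε) * Real.exp (-(N * Y)) := by
        rw [mul_assoc]
        gcongr
      _ = _ := by rw [← h3, mul_assoc]
  have hg := hasSum_geometric_of_lt_one hr0.le hr1
  have hs := Summable.of_nonneg_of_le (fun n => by positivity) hle (hg.summable.mul_left _)
  refine ⟨hs, (hs.tsum_le_tsum hle (hg.summable.mul_left _)).trans ?_⟩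
  rw [tsum_mul_left, hg.tsum_eq, neg_add_rev, Real.rpow_add hY, mul_assoc]
  refine mul_le_mul_of_nonneg_left ?_ (Real.rpow_nonneg hY.le _)
  rw [Real.rpow_neg_one, ← div_eq_mul_inv, div_le_iff₀ (by linarith), inv_mul_eq_div,
    le_div_iff₀ hY]
  have h5 : r * Real.exp Y = 1 := by rw [hr, ← Real.exp_add]; simp
  nlinarith [Real.add_one_le_exp Y]

theorem Int.card_divisorsAntidiag (l : ℤ) : l.divisorsAntidiag.card = 2 * l.natAbs.divisors.card := by
  have h : ∀ n : ℕ, n.divisorsAntidiagonal.card = n.divisors.card := fun n => by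
    rw [← Nat.map_div_right_divisors, Finset.card_map]
  cases l with
  | ofNat n =>
    simp only [Int.ofNat_eq_natCast, Int.divisorsAntidiag, Finset.card_disjUnion, Finset.card_map, h,
      two_mul, Int.natAbs_natCast]
  | negSucc n =>
    simp only [Int.divisorsAntidiag, Finset.card_disjUnion, Finset.card_map, h, two_mul,
      Int.natAbs_negSucc, Nat.succ_eq_add_one]

end ExponentialSums

section OffDiagonal

/-- The terms of `dualKernel` with `m n = a`. -/
noncomputable def mainKernel (q : ℕ) (a : ℤ) (t u : ℝ) : ℝ :=
  ∑ z ∈ a.divisorsAntidiag, Real.exp (-Real.pi * (z.1 ^ 2 * t + z.2 ^ 2 * u) / q)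

theorem exp_offDiagonal_le {q q₀ Q : ℕ} [NeZero q] {a s : ℤ} (hq : q = q₀ * Q) (ha : 2 * |a| < Q)
    (hs : s ≠ 0) {z : ℤ × ℤ} (hz : z.1 * z.2 = a + s * Q) {t u : ℝ} (ht : 0 < t) (hu : 0 < u) :
    Real.exp (-Real.pi * (z.1 ^ 2 * t + z.2 ^ 2 * u) / q) ≤ Real.exp (-Real.pi * t / (2 * q)) *
      Real.exp (-Real.pi * |(s : ℝ)| * (√(t * u) / (2 * q₀))) := by
  have hq0 : q ≠ 0 := NeZero.ne q
  have hq₀0 : (0 : ℝ) < q₀ := by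
    exact_mod_cast Nat.pos_of_ne_zero fun h => hq0 (by rw [hq, h, zero_mul])
  have hQ0 : (0 : ℝ) < Q := by
    exact_mod_cast Nat.pos_of_ne_zero fun h => hq0 (by rw [hq, h, mul_zero])
  have hs1 : (1 : ℝ) ≤ |(s : ℝ)| := by exact_mod_cast Int.one_le_abs hs
  have ha' : 2 * |(a : ℝ)| < Q := by exact_mod_cast ha
  have hz' : (z.1 : ℝ) * z.2 = a + s * Q := by exact_mod_cast hz
  have h1 : |(s : ℝ)| * Q / 2 ≤ |(z.1 : ℝ)| * |(z.2 : ℝ)| := by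
    rw [← abs_mul, hz']
    have h2 : |(s : ℝ)| * Q ≤ |(a + s * Q : ℝ)| + |(a : ℝ)| := by
      have := abs_sub (a + s * Q : ℝ) a
      rwa [add_sub_cancel_left, abs_mul, abs_of_pos hQ0] at this
    nlinarith
  have hm : (1 : ℝ) ≤ (z.1 : ℝ) ^ 2 := by
    have h3 : z.1 ≠ 0 := fun h => by
      rw [h] at h1
      simp only [Int.cast_zero, abs_zero, zero_mul] at h1
      nlinarith
    have h4 : (1 : ℝ) ≤ |(z.1 : ℝ)| := by exact_mod_cast Int.one_le_abs h3
    rw [← sq_abs]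
    exact one_le_pow₀ h4
  have h5 : 2 * (|(z.1 : ℝ)| * |(z.2 : ℝ)| * √(t * u)) ≤ z.1 ^ 2 * t + z.2 ^ 2 * u := by
    have := sq_nonneg (|(z.1 : ℝ)| * √t - |(z.2 : ℝ)| * √u)
    rw [sub_sq, mul_pow, mul_pow, sq_abs, sq_abs, Real.sq_sqrt ht.le, Real.sq_sqrt hu.le] at this
    rw [Real.sqrt_mul ht.le]
    linarith
  have hw : 0 ≤ √(t * u) := Real.sqrt_nonneg _
  have h6 : t / 2 + |(s : ℝ)| * Q / 2 * √(t * u) ≤ z.1 ^ 2 * t + z.2 ^ 2 * u := by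
    have h7 := mul_le_mul_of_nonneg_right h1 hw
    have h8 := mul_le_mul_of_nonneg_right hm ht.le
    have h9 : (0 : ℝ) ≤ z.2 ^ 2 * u := by positivity
    nlinarith
  rw [← Real.exp_add, Real.exp_le_exp]
  have hqr : (q : ℝ) = q₀ * Q := by exact_mod_cast hq
  have h10 : -Real.pi * t / (2 * q) + -Real.pi * |(s : ℝ)| * (√(t * u) / (2 * q₀))
      = -(Real.pi / q * (t / 2 + |(s : ℝ)| * Q / 2 * √(t * u))) := by
    rw [hqr]; field_simp; ring
  have h11 : -Real.pi * (z.1 ^ 2 * t + z.2 ^ 2 * u) / q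
      = -(Real.pi / q * (z.1 ^ 2 * t + z.2 ^ 2 * u)) := by ring
  rw [h10, h11, neg_le_neg_iff]
  gcongr

theorem card_offDiagonal_le {Q : ℕ} {a : ℤ} (ha : 2 * |a| < Q) {ε C : ℝ} (hε : 0 ≤ ε)
    (hC : ∀ n : ℕ, n ≠ 0 → (n.divisors.card : ℝ) ≤ C * (n : ℝ) ^ ε) (s : ℤ) (hs : s ≠ 0) (hC0 : 0 ≤ C) :
    ((a + s * Q).divisorsAntidiag.card : ℝ) ≤ 2 * C * (2 * Q) ^ ε * (s.natAbs : ℝ) ^ ε := by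
  have hQ0 : (0 : ℤ) < Q := by have := abs_nonneg a; omega
  have hs1 := Int.one_le_abs hs
  have h1 : |a + s * Q| ≤ 2 * (|s| * Q) := by
    have := abs_add_le a (s * Q)
    rw [abs_mul, abs_of_pos hQ0] at this
    nlinarith
  have h2 : (a + s * Q) ≠ 0 := fun h => by
    have h3 : |a| = |s| * Q := by
      rw [eq_neg_of_add_eq_zero_left h, abs_neg, abs_mul, abs_of_pos hQ0]
    nlinarith
  have h4 : ((a + s * Q).natAbs : ℝ) ≤ 2 * Q * (s.natAbs : ℝ) := by
    have : ((a + s * Q).natAbs : ℤ) ≤ 2 * Q * (s.natAbs : ℤ) := by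
      rw [Int.natCast_natAbs, Int.natCast_natAbs]; linarith
    exact_mod_cast this
  rw [Int.card_divisorsAntidiag]
  push_cast
  rw [mul_assoc, mul_assoc, ← Real.mul_rpow (by positivity) (by positivity)]
  refine mul_le_mul_of_nonneg_left ?_ (by norm_num)
  exact (hC _ (Int.natAbs_ne_zero.mpr h2)).trans (by gcongr)

theorem sum_offDiagonal_le {q q₀ Q : ℕ} [NeZero q] {a : ℤ} (hq : q = q₀ * Q) (ha : 2 * |a| < Q)
    {t u : ℝ} (ht : 0 < t) (hu : 0 < u) {ε C : ℝ} (hε : 0 ≤ ε) (hε1 : ε ≤ 1) (hC0 : 0 ≤ C)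
    (hC : ∀ n : ℕ, n ≠ 0 → (n.divisors.card : ℝ) ≤ C * (n : ℝ) ^ ε) (F : Finset (ℤ × ℤ))
    (hF : ∀ z ∈ F, ∃ s : ℤ, s ≠ 0 ∧ z.1 * z.2 = a + s * Q) :
    ∑ z ∈ F, Real.exp (-Real.pi * (z.1 ^ 2 * t + z.2 ^ 2 * u) / q) ≤
      4 * C * (2 * Q) ^ ε * Real.exp (-Real.pi * t / (2 * q)) *
        (√(t * u) / (2 * q₀)) ^ (-(1 + ε)) := by
  classical
  have hq0 : q ≠ 0 := NeZero.ne q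
  have hq₀0 : (0 : ℝ) < q₀ := by
    exact_mod_cast Nat.pos_of_ne_zero fun h => hq0 (by rw [hq, h, zero_mul])
  have hY : 0 < √(t * u) / (2 * q₀) := by positivity
  choose! s hs0 hs using hF
  obtain ⟨h1, h2⟩ := tsum_rpow_mul_exp_le hε hε1 hY
  set Y := √(t * u) / (2 * q₀) with hYdef
  set E := Real.exp (-Real.pi * t / (2 * q)) with hE
  set g : ℤ × ℤ → ℕ := fun z => (s z).natAbs - 1 with hg
  have hgs : ∀ z ∈ F, ((s z).natAbs : ℝ) = ((g z + 1 : ℕ) : ℝ) := fun z hz => by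
    rw [hg, Nat.sub_add_cancel (Int.natAbs_pos.mpr (hs0 z hz))]
  have h3 : ∑ z ∈ F, Real.exp (-Real.pi * (z.1 ^ 2 * t + z.2 ^ 2 * u) / q)
      ≤ ∑ z ∈ F, (fun n : ℕ => E * Real.exp (-Real.pi * ((n + 1 : ℕ) : ℝ) * Y)) (g z) := by
    refine Finset.sum_le_sum fun z hz => ?_
    have h4 := exp_offDiagonal_le hq ha (hs0 z hz) (hs z hz) ht hu
    rwa [← Int.cast_abs, ← Int.natCast_natAbs, Int.cast_natCast, hgs z hz] at h4
  have hfib : ∀ n : ℕ, ((F.filter fun z => g z = n).card : ℝ)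
      ≤ 4 * C * (2 * Q) ^ ε * ((n + 1 : ℕ) : ℝ) ^ ε := fun n => by
    have h5 : F.filter (fun z => g z = n) ⊆ (a + ((n + 1 : ℕ) : ℤ) * Q).divisorsAntidiag ∪
        (a + (-((n + 1 : ℕ) : ℤ)) * Q).divisorsAntidiag := fun z hz => by
      obtain ⟨hzF, hz⟩ := Finset.mem_filter.mp hz
      have h6 : (s z).natAbs = n + 1 := by
        rw [← hz, hg, Nat.sub_add_cancel (Int.natAbs_pos.mpr (hs0 z hzF))]
      have h7 : a + s z * Q ≠ 0 := fun h => by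
        have hQ0 : (0 : ℤ) ≤ Q := Int.natCast_nonneg Q
        have h3 : |a| = |s z| * Q := by
          rw [eq_neg_of_add_eq_zero_left h, abs_neg, abs_mul, abs_of_nonneg hQ0]
        nlinarith [Int.one_le_abs (hs0 z hzF)]
      rw [Finset.mem_union, Int.mem_divisorsAntidiag, Int.mem_divisorsAntidiag, hs z hzF]
      rcases Int.natAbs_eq (s z) with h8 | h8 <;> rw [h6] at h8 <;> rw [h8] at h7 ⊢
      · exact Or.inl ⟨rfl, h7⟩
      · exact Or.inr ⟨rfl, h7⟩
    have h9 := card_offDiagonal_le ha hε hC ((n + 1 : ℕ) : ℤ) (by positivity) hC0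
    have h10 := card_offDiagonal_le ha hε hC (-((n + 1 : ℕ) : ℤ)) (neg_ne_zero.mpr (by positivity)) hC0
    rw [Int.natAbs_neg, Int.natAbs_natCast] at h10
    rw [Int.natAbs_natCast] at h9
    have h11 : ((F.filter fun z => g z = n).card : ℝ) ≤
        ((a + ((n + 1 : ℕ) : ℤ) * Q).divisorsAntidiag.card : ℝ) +
        ((a + (-((n + 1 : ℕ) : ℤ)) * Q).divisorsAntidiag.card : ℝ) := by
      exact_mod_cast (Finset.card_le_card h5).trans (Finset.card_union_le _ _)
    linarith
  refine h3.trans ?_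
  rw [Finset.sum_comp (fun n : ℕ => E * Real.exp (-Real.pi * ((n + 1 : ℕ) : ℝ) * Y)) g]
  calc _ ≤ ∑ n ∈ F.image g, 4 * C * (2 * Q) ^ ε * E *
        (((n + 1 : ℕ) : ℝ) ^ ε * Real.exp (-Real.pi * ((n + 1 : ℕ) : ℝ) * Y)) := by
        refine Finset.sum_le_sum fun n _ => ?_
        rw [nsmul_eq_mul]
        refine (mul_le_mul_of_nonneg_right (hfib n) (by positivity)).trans (le_of_eq ?_)
        ring
    _ ≤ 4 * C * (2 * Q) ^ ε * E * ∑' n : ℕ,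
        ((n + 1 : ℕ) : ℝ) ^ ε * Real.exp (-Real.pi * ((n + 1 : ℕ) : ℝ) * Y) := by
        rw [← Finset.mul_sum]
        refine mul_le_mul_of_nonneg_left ?_ (by positivity)
        exact h1.sum_le_tsum _ fun n _ => by positivity
    _ ≤ _ := mul_le_mul_of_nonneg_left h2 (by positivity)

end OffDiagonal

section ErrorTerm

theorem diagKernel_nonneg (p q : ℕ) (s : ℝ) : 0 ≤ diagKernel p q s :=
  tsum_nonneg fun m => by split_ifs; exacts [le_rfl, (Real.exp_pos _).le]

theorem diagKernel_le (p : ℕ) {q : ℕ} [NeZero q] {s : ℝ} (hs : 0 < s) :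
    diagKernel p q s ≤ √(2 * q / s) * Real.exp (-Real.pi * s / (2 * q)) := by
  have hq : (0 : ℝ) < q := by exact_mod_cast Nat.pos_of_ne_zero (NeZero.ne q)
  have hX : 0 < s / (2 * q) := by positivity
  set g : ℤ → ℂ := fun m => ((if (p : ℤ) ∣ m then 0 else Real.exp (-Real.pi * m ^ 2 * s / q) : ℝ) : ℂ)
    with hg
  have hle : ∀ m : ℤ, ‖g m‖ ≤ Real.exp (-Real.pi * m ^ 2 * (s / q)) := fun m => by
    simp only [hg, norm_real]
    split_ifs
    · rw [norm_zero]; exact (Real.exp_pos _).le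
    · rw [Real.norm_of_nonneg (Real.exp_pos _).le]
      exact le_of_eq (by ring_nf)
  have h1 := norm_tsum_int_sub_le (Summable.of_norm_bounded (summable_exp_neg_sq (by positivity)) hle)
    ((summable_nat_exp_neg_sq hX).mul_left (Real.exp (-Real.pi * s / (2 * q)))) fun h hh => by
      have h5 : h.natAbs - 1 + 1 = h.natAbs := Nat.sub_add_cancel (Int.natAbs_pos.mpr hh)
      have h6 : (1 : ℝ) ≤ (h : ℝ) ^ 2 := by
        have : (1 : ℝ) ≤ |(h : ℝ)| := by exact_mod_cast Int.one_le_abs hh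
        rw [← sq_abs]
        exact one_le_pow₀ this
      rw [h5, ← Int.cast_natCast (R := ℝ) h.natAbs, Int.natCast_natAbs, Int.cast_abs, sq_abs,
        ← Real.exp_add]
      refine (hle h).trans (Real.exp_le_exp.mpr ?_)
      have h7 : -Real.pi * s / (2 * q) + -Real.pi * (s / (2 * q)) * h ^ 2
          - -Real.pi * h ^ 2 * (s / q) = Real.pi * (s / (2 * q)) * (h ^ 2 - 1) := by
        field_simp; ring
      have h8 : 0 ≤ Real.pi * (s / (2 * q)) * ((h : ℝ) ^ 2 - 1) :=
        mul_nonneg (by positivity) (by linarith)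
      linarith
  have h2 : g 0 = 0 := by simp [hg]
  rw [h2, sub_zero, ← ofReal_tsum, norm_real, tsum_mul_left] at h1
  refine ((le_abs_self _).trans h1).trans ?_
  have h3 : √(2 * q / s) = 2 * (1 / (2 * √(s / (2 * q)))) := by
    rw [← inv_div s (2 * q : ℝ), Real.sqrt_inv]
    ring
  rw [h3]
  calc _ ≤ 2 * (Real.exp (-Real.pi * s / (2 * q)) * (1 / (2 * √(s / (2 * q))))) := by
        gcongr
        exact tsum_nat_exp_neg_sq_le hX
    _ = _ := by ring

theorem mainKernel_nonneg (q : ℕ) (a : ℤ) (t u : ℝ) : 0 ≤ mainKernel q a t u :=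
  Finset.sum_nonneg fun _ _ => (Real.exp_pos _).le

theorem mainKernel_le (q : ℕ) (a : ℤ) {t u : ℝ} (ht : 0 ≤ t) (hu : 0 ≤ u) :
    mainKernel q a t u ≤ 2 * a.natAbs.divisors.card := by
  have h : ∀ z ∈ a.divisorsAntidiag,
      Real.exp (-Real.pi * ((z.1 : ℝ) ^ 2 * t + z.2 ^ 2 * u) / q) ≤ 1 := fun z _ => by
    rw [Real.exp_le_one_iff, neg_mul, neg_div, neg_nonpos]
    positivity
  refine (Finset.sum_le_card_nsmul _ _ _ h).trans (le_of_eq ?_)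
  rw [Int.card_divisorsAntidiag]
  simp

variable {p q q₀ Q : ℕ} [NeZero q] [NeZero q₀] [NeZero Q] {χ : DirichletCharacter ℂ q} {a : ℤ}

theorem IsCosetData.ne_zero (D : IsCosetData p q q₀ Q χ a) : a ≠ 0 := by
  rintro rfl
  exact D.not_dvd (dvd_zero _)

theorem IsCosetData.norm_dualKernel_sub_le (D : IsCosetData p q q₀ Q χ a) (ha : 2 * |a| < Q)
    {t u : ℝ} (ht : 0 < t) (hu : 0 < u) {ε C : ℝ} (hε : 0 ≤ ε) (hε1 : ε ≤ 1) (hC0 : 0 ≤ C)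
    (hC : ∀ n : ℕ, n ≠ 0 → (n.divisors.card : ℝ) ≤ C * (n : ℝ) ^ ε) :
    ‖dualKernel q Q a t u - ZMod.stdAddChar (a : ZMod q) * (mainKernel q a t u : ℂ)‖ ≤
      4 * C * (2 * Q) ^ ε * Real.exp (-Real.pi * t / (2 * q)) *
        (√(t * u) / (2 * q₀)) ^ (-(1 + ε)) := by
  classical
  set f : ℤ × ℤ → ℂ := fun z => if ((z.1 * z.2 : ℤ) : ZMod Q) = (a : ZMod Q) then
    ZMod.stdAddChar ((z.1 * z.2 : ℤ) : ZMod q) *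
      (Real.exp (-Real.pi * (z.1 ^ 2 * t + z.2 ^ 2 * u) / q) : ℂ) else 0 with hf
  have hs : Summable f := summable_dualKernel ht hu
  have h1 : ZMod.stdAddChar (a : ZMod q) * (mainKernel q a t u : ℂ) =
      ∑' z, if z ∈ a.divisorsAntidiag then f z else 0 := by
    rw [tsum_eq_sum (s := a.divisorsAntidiag) fun z hz => if_neg hz, mainKernel, ofReal_sum,
      Finset.mul_sum]
    refine Finset.sum_congr rfl fun z hz => ?_
    rw [if_pos hz, hf]
    simp only [(Int.mem_divisorsAntidiag.mp hz).1, if_true]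
  have hs' : Summable fun z => if z ∈ a.divisorsAntidiag then f z else 0 :=
    summable_of_ne_finset_zero (s := a.divisorsAntidiag) fun z hz => if_neg hz
  rw [h1, dualKernel, ← hs.tsum_sub hs']
  refine le_of_tendsto (hs.sub hs').hasSum.norm (Filter.Eventually.of_forall fun F => ?_)
  refine le_trans ?_ (sum_offDiagonal_le D.q_eq ha ht hu hε hε1 hC0 hC
    (F.filter fun z => ((z.1 * z.2 : ℤ) : ZMod Q) = (a : ZMod Q) ∧ z ∉ a.divisorsAntidiag) ?_)
  · rw [Finset.sum_filter]
    refine (norm_sum_le _ _).trans (Finset.sum_le_sum fun z _ => ?_)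
    by_cases hz : z ∈ a.divisorsAntidiag
    · simp [hz]
    · by_cases hz' : ((z.1 * z.2 : ℤ) : ZMod Q) = (a : ZMod Q)
      · rw [if_neg hz, sub_zero, if_pos ⟨hz', hz⟩]
        exact norm_dualKernel_term_le z t u
      · rw [if_neg hz, sub_zero, if_neg fun h => hz' h.1, hf]
        simp only [hz', if_false, norm_zero, le_refl]
  · intro z hz
    obtain ⟨-, hz1, hz2⟩ := Finset.mem_filter.mp hz
    obtain ⟨s, hs⟩ := (ZMod.intCast_eq_intCast_iff_dvd_sub _ _ _).mp hz1.symm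
    refine ⟨s, ?_, by rw [mul_comm s]; linarith⟩
    rintro rfl
    exact hz2 (Int.mem_divisorsAntidiag.mpr ⟨by linarith, D.ne_zero⟩)

/-- The part of `cosetKernel` not accounted for by the diagonal and the pairs `m n = a`. -/
noncomputable def errKernel (p q q₀ Q : ℕ) [NeZero q] [NeZero Q] (a : ℤ) (t v : ℝ) : ℂ :=
  cosetKernel p q q₀ Q a t v - diagKernel p q (t + v) -
    (√(Q / (q₀ * v)) : ℝ) * (ZMod.stdAddChar (a : ZMod q) * (mainKernel q a t (1 / v) : ℂ))

theorem IsCosetData.norm_errKernel_le_of_dual (D : IsCosetData p q q₀ Q χ a) (ha : 2 * |a| < Q)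
    {t v : ℝ} (hv : 0 < v) (hvt : v ≤ t) {ε C : ℝ} (hε : 0 ≤ ε) (hε1 : ε ≤ 1) (hC1 : 1 ≤ C)
    (hC : ∀ n : ℕ, n ≠ 0 → (n.divisors.card : ℝ) ≤ C * (n : ℝ) ^ ε) :
    ‖errKernel p q q₀ Q a t v‖ ≤
      34 * C * q ^ ε * (√(q / t) * Real.exp (-Real.pi * t / (2 * q))) := by
  have ht : 0 < t := hv.trans_le hvt
  have hQ : (0 : ℝ) < Q := by exact_mod_cast Nat.pos_of_ne_zero (NeZero.ne Q)
  have hq₀ : (0 : ℝ) < q₀ := by exact_mod_cast Nat.pos_of_ne_zero (NeZero.ne q₀)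
  have hq : (q : ℝ) = q₀ * Q := by exact_mod_cast D.q_eq
  have hq1 : (1 : ℝ) ≤ q := by exact_mod_cast Nat.pos_of_ne_zero (NeZero.ne q)
  have hqε : (1 : ℝ) ≤ q ^ ε := Real.one_le_rpow hq1 hε
  set E := Real.exp (-Real.pi * t / (2 * q)) with hE
  have hE0 : 0 < E := Real.exp_pos _
  have h1 := D.norm_dualKernel_sub_le ha ht (one_div_pos.mpr hv) hε hε1 (by linarith) hC
  have h2 : diagKernel p q (t + v) ≤ 2 * (√(q / t) * E) := by
    refine (diagKernel_le p (by positivity)).trans ?_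
    have h3 : √(2 * q / (t + v)) ≤ 2 * √(q / t) := by
      rw [Real.sqrt_le_left (by positivity), mul_pow, Real.sq_sqrt (by positivity), ← mul_div_assoc]
      refine div_le_div₀ (by positivity) (by linarith) ht (by linarith)
    rw [← mul_assoc]
    refine mul_le_mul h3 (Real.exp_le_exp.mpr ?_) (Real.exp_pos _).le (by positivity)
    rw [neg_mul, neg_mul, neg_div, neg_div, neg_le_neg_iff]
    gcongr
    linarith
  set Y := √(t * (1 / v)) / (2 * q₀) with hY
  have hY0 : 0 < Y := by positivity
  have h4 : √(Q / (q₀ * v)) * Y⁻¹ = 2 * √(q / t) := by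
    rw [hY, inv_div, ← mul_div_assoc, div_eq_iff (by positivity), mul_assoc,
      ← Real.sqrt_mul (by positivity), mul_comm, mul_assoc]
    congr 1
    rw [hq, eq_comm, Real.sqrt_eq_iff_eq_sq (by positivity) (by positivity), mul_pow,
      Real.sq_sqrt (by positivity)]
    field_simp
  have h5 : (2 * Q : ℝ) ^ ε * Y ^ (-ε) ≤ 4 * q ^ ε := by
    have h6 : (2 * Q) * Y⁻¹ ≤ 4 * q := by
      have h7 : 1 ≤ √(t * (1 / v)) := by
        rw [Real.one_le_sqrt, mul_one_div, one_le_div hv]; exact hvt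
      rw [hY, inv_div, ← mul_div_assoc, div_le_iff₀ (by positivity), hq]
      nlinarith [mul_pos hq₀ hQ]
    rw [Real.rpow_neg hY0.le, ← Real.inv_rpow hY0.le, ← Real.mul_rpow (by positivity) (by positivity)]
    calc _ ≤ (4 * q : ℝ) ^ ε := by gcongr
      _ = (4 : ℝ) ^ ε * q ^ ε := Real.mul_rpow (by norm_num) (by positivity)
      _ ≤ (4 : ℝ) ^ (1 : ℝ) * q ^ ε := by
        gcongr
        norm_num
      _ = _ := by rw [Real.rpow_one]
  have h8 : errKernel p q q₀ Q a t v = (√(Q / (q₀ * v)) : ℝ) * (dualKernel q Q a t (1 / v) -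
      ZMod.stdAddChar (a : ZMod q) * (mainKernel q a t (1 / v) : ℂ)) - diagKernel p q (t + v) := by
    rw [errKernel, D.cosetKernel_eq ht hv]
    ring
  have h9 : √(Q / (q₀ * v)) * (4 * C * (2 * Q) ^ ε * E * Y ^ (-(1 + ε)))
      ≤ 32 * C * q ^ ε * (√(q / t) * E) := by
    have h10 : Y ^ (-(1 + ε)) = Y⁻¹ * Y ^ (-ε) := by
      rw [neg_add, Real.rpow_add hY0, Real.rpow_neg_one]
    rw [h10]
    calc _ = (√(Q / (q₀ * v)) * Y⁻¹) * (4 * C * E) * ((2 * Q) ^ ε * Y ^ (-ε)) := by ring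
      _ ≤ (2 * √(q / t)) * (4 * C * E) * (4 * q ^ ε) := by rw [h4]; gcongr
      _ = _ := by ring
  have h11 : 2 * (√(q / t) * E) ≤ 2 * C * q ^ ε * (√(q / t) * E) := by
    have : 1 ≤ C * q ^ ε := by nlinarith
    have h12 : 0 ≤ √(q / t) * E := by positivity
    nlinarith
  rw [h8]
  refine (norm_sub_le _ _).trans ?_
  rw [norm_mul, norm_real, norm_real, Real.norm_of_nonneg (Real.sqrt_nonneg _),
    Real.norm_of_nonneg (diagKernel_nonneg _ _ _)]
  have h13 := mul_le_mul_of_nonneg_left h1 (Real.sqrt_nonneg (Q / (q₀ * v)))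
  linarith

theorem IsCosetData.norm_errKernel_le_of_diag (D : IsCosetData p q q₀ Q χ a) (ha : 2 * |a| < Q)
    {t v : ℝ} (ht : 1 ≤ t) (hv : 0 < v) (hvt : v ≤ t) {ε C : ℝ} (hε : 0 ≤ ε) (hC1 : 1 ≤ C)
    (hC : ∀ n : ℕ, n ≠ 0 → (n.divisors.card : ℝ) ≤ C * (n : ℝ) ^ ε) :
    ‖errKernel p q q₀ Q a t v‖ ≤ 34 * C * q ^ ε * √(Q / v) := by
  have hQ : (0 : ℝ) < Q := by exact_mod_cast Nat.pos_of_ne_zero (NeZero.ne Q)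
  have hq₀ : (1 : ℝ) ≤ q₀ := by exact_mod_cast Nat.pos_of_ne_zero (NeZero.ne q₀)
  have hq : (q : ℝ) = q₀ * Q := by exact_mod_cast D.q_eq
  have hq1 : (1 : ℝ) ≤ q := by exact_mod_cast Nat.pos_of_ne_zero (NeZero.ne q)
  have hqε : (1 : ℝ) ≤ q ^ ε := Real.one_le_rpow hq1 hε
  have h1 := D.norm_cosetKernel_sub_le ht hv hvt
  have h2 : (a.natAbs.divisors.card : ℝ) ≤ C * q ^ ε := by
    refine (hC _ (Int.natAbs_ne_zero.mpr D.ne_zero)).trans ?_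
    have h3 : (a.natAbs : ℝ) ≤ Q := by
      have : (a.natAbs : ℤ) ≤ Q := by rw [Int.natCast_natAbs]; linarith [abs_nonneg a]
      exact_mod_cast this
    have h4 : (a.natAbs : ℝ) ≤ q := by rw [hq]; nlinarith
    gcongr
  have h5 : √(Q / (q₀ * v)) ≤ √(Q / v) := by
    refine Real.sqrt_le_sqrt ?_
    gcongr
    exact le_mul_of_one_le_left hv.le hq₀
  have h6 := mainKernel_le q a (by linarith : 0 ≤ t) (one_div_pos.mpr hv).le
  rw [errKernel]
  refine (norm_sub_le _ _).trans ?_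
  rw [norm_mul, norm_mul, norm_stdAddChar, one_mul, norm_real, norm_real,
    Real.norm_of_nonneg (Real.sqrt_nonneg _), Real.norm_of_nonneg (mainKernel_nonneg _ _ _ _)]
  have h7 : √(Q / (q₀ * v)) * mainKernel q a t (1 / v) ≤ √(Q / v) * (2 * (C * q ^ ε)) := by
    refine mul_le_mul h5 (by linarith) (mainKernel_nonneg _ _ _ _) (Real.sqrt_nonneg _)
  have h8 : 20 * √(Q / v) ≤ 20 * (C * q ^ ε) * √(Q / v) := by
    have : 1 ≤ C * q ^ ε := by nlinarith
    nlinarith [Real.sqrt_nonneg (Q / v)]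
  have h9 : 0 ≤ C * q ^ ε * √(Q / v) := by positivity
  nlinarith

end ErrorTerm

section LogError

open MeasureTheory

theorem integrable_exp_neg_mul_abs {κ : ℝ} (hκ : 0 < κ) :
    Integrable (fun x : ℝ => Real.exp (-κ * |x|)) ∧ ∫ x : ℝ, Real.exp (-κ * |x|) = 2 / κ := by
  have h : ∫ x : ℝ, Real.exp (-κ * |x|) = 2 / κ := by
    rw [integral_comp_abs (f := fun x => Real.exp (-κ * x)), integral_exp_mul_Ioi (by linarith)]
    simp [div_eq_mul_inv]
  refine ⟨not_imp_comm.mp integral_undef ?_, h⟩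
  rw [h]
  positivity

theorem integrable_exp_neg_mul_abs_prod {κ : ℝ} (hκ : 0 < κ) :
    Integrable (fun z : ℝ × ℝ => Real.exp (-κ * |z.1|) * Real.exp (-κ * |z.2|)) ∧
    ∫ z : ℝ × ℝ, Real.exp (-κ * |z.1|) * Real.exp (-κ * |z.2|) = (2 / κ) ^ 2 := by
  obtain ⟨h1, h2⟩ := integrable_exp_neg_mul_abs hκ
  refine ⟨h1.mul_prod h1, ?_⟩
  rw [Measure.volume_eq_prod, integral_prod_mul (fun x : ℝ => Real.exp (-κ * |x|))
    (fun x : ℝ => Real.exp (-κ * |x|)), h2, sq]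

theorem exp_neg_le_rpow {x ε : ℝ} (hx : 0 < x) (hε : 0 ≤ ε) (hε1 : ε ≤ 1) :
    Real.exp (-x) ≤ x ^ (-ε) := by
  rw [Real.exp_neg, Real.rpow_neg hx.le]
  exact inv_anti₀ (Real.rpow_pos_of_pos hx _) (rpow_le_exp hx.le hε hε1)

/-- The diagonal contribution to `logKernel`. -/
noncomputable def logDiag (p q : ℕ) (z : ℝ × ℝ) : ℝ :=
  Real.exp ((z.1 + z.2) / 4) * diagKernel p q (Real.exp z.1 + Real.exp z.2)

/-- The contribution to `logKernel` of the pairs `m n = a`. -/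
noncomputable def logMain (q q₀ Q : ℕ) (a : ℤ) (z : ℝ × ℝ) : ℝ :=
  √(Q / q₀) * Real.cos (2 * Real.pi * a / q) *
    (Real.exp ((z.1 - z.2) / 4) * mainKernel q a (Real.exp z.1) (Real.exp (-z.2)))

theorem logKernel_sub_eq {p q q₀ Q : ℕ} [NeZero q] [NeZero Q] {a : ℤ} (z : ℝ × ℝ) :
    logKernel p q q₀ Q a z - logDiag p q z - logMain q q₀ Q a z
      = Real.exp ((z.1 + z.2) / 4) * (errKernel p q q₀ Q a (Real.exp z.1) (Real.exp z.2)).re := by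
  have h1 : √((Q : ℝ) / (q₀ * Real.exp z.2)) = √(Q / q₀) * Real.exp (-(z.2 / 2)) := by
    rw [← div_div, Real.sqrt_div' _ (Real.exp_pos _).le, Real.exp_neg, Real.exp_half, div_eq_mul_inv]
  have h2 : (ZMod.stdAddChar (a : ZMod q)).re = Real.cos (2 * Real.pi * a / q) := by
    rw [ZMod.stdAddChar_coe, show (2 * Real.pi * I * a / q : ℂ)
      = ((2 * Real.pi * a / q : ℝ) : ℂ) * I by push_cast; ring, exp_ofReal_mul_I_re]
  rw [logKernel, logDiag, logMain, errKernel, sub_re, sub_re, ofReal_re, re_ofReal_mul,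
    re_mul_ofReal, h2, h1, one_div, ← Real.exp_neg,
    show (z.1 - z.2) / 4 = (z.1 + z.2) / 4 + -(z.2 / 2) by ring, Real.exp_add]
  ring

variable {p q q₀ Q : ℕ} [NeZero q] [NeZero q₀] [NeZero Q] {χ : DirichletCharacter ℂ q} {a : ℤ}

theorem IsCosetData.abs_logKernel_sub_le (D : IsCosetData p q q₀ Q χ a) (ha : 2 * |a| < Q)
    {ε C : ℝ} (hε : 0 ≤ ε) (hε1 : ε ≤ 1) (hC1 : 1 ≤ C)
    (hC : ∀ n : ℕ, n ≠ 0 → (n.divisors.card : ℝ) ≤ C * (n : ℝ) ^ ε) {z : ℝ × ℝ} (hz : |z.2| ≤ z.1) :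
    |logKernel p q q₀ Q a z - logDiag p q z - logMain q q₀ Q a z| ≤
      68 * C * q ^ (3 / 8 + 2 * ε) * (Real.exp (-(ε / 2) * |z.1|) * Real.exp (-(ε / 2) * |z.2|)) := by
  obtain ⟨x, y⟩ := z
  simp only at hz ⊢
  have hQ : (0 : ℝ) < Q := by exact_mod_cast Nat.pos_of_ne_zero (NeZero.ne Q)
  have hq₀ : (0 : ℝ) < q₀ := by exact_mod_cast Nat.pos_of_ne_zero (NeZero.ne q₀)
  have hq : (q : ℝ) = q₀ * Q := by exact_mod_cast D.q_eq
  have hQq : (Q : ℝ) ≤ q₀ := by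
    exact_mod_cast Nat.le_of_dvd (Nat.pos_of_ne_zero (NeZero.ne q₀)) D.Q_dvd
  have hq0 : (0 : ℝ) < q := by exact_mod_cast Nat.pos_of_ne_zero (NeZero.ne q)
  have hx : 0 ≤ x := (abs_nonneg y).trans hz
  have hyx : y ≤ x := (le_abs_self y).trans hz
  have h1 := D.norm_errKernel_le_of_dual ha (Real.exp_pos y) (Real.exp_le_exp.mpr hyx) hε hε1 hC1 hC
  have h2 := D.norm_errKernel_le_of_diag ha (Real.one_le_exp hx) (Real.exp_pos y)
    (Real.exp_le_exp.mpr hyx) hε hC1 hC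
  set N := ‖errKernel p q q₀ Q a (Real.exp x) (Real.exp y)‖ with hN
  set B := 34 * C * (q : ℝ) ^ ε with hB
  have hB0 : 0 ≤ B := by positivity
  have h3 : (Real.exp ((x + y) / 4) * N) ^ 2 ≤
      (B * (q : ℝ) ^ (3 / 8 : ℝ) * Real.exp (-(Real.pi * Real.exp x / (4 * q)))) ^ 2 := by
    have h4 : N ^ 2 ≤ (B * (√(q / Real.exp x) * Real.exp (-Real.pi * Real.exp x / (2 * q)))) *
        (B * √(Q / Real.exp y)) := by
      rw [sq]
      exact mul_le_mul h1 h2 (norm_nonneg _) (by positivity)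
    have h5 : √(q / Real.exp x) * √(Q / Real.exp y) = √(Q * q) * Real.exp (-((x + y) / 2)) := by
      rw [← Real.sqrt_mul (by positivity), ← Real.sqrt_sq (Real.exp_pos (-((x + y) / 2))).le,
        ← Real.sqrt_mul (by positivity), ← Real.exp_nat_mul, Nat.cast_ofNat,
        show 2 * -((x + y) / 2) = -x + -y by ring, Real.exp_add, Real.exp_neg, Real.exp_neg]
      congr 1
      field_simp
    have h6 : √(Q * q) ≤ ((q : ℝ) ^ (3 / 8 : ℝ)) ^ 2 := by
      rw [Real.sqrt_le_left (by positivity), ← pow_mul, ← Real.rpow_mul_natCast hq0.le]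
      norm_num
      have h7 : (Q : ℝ) ≤ q ^ (1 / 2 : ℝ) := by
        rw [← Real.sqrt_eq_rpow]
        refine Real.le_sqrt_of_sq_le ?_
        rw [hq]
        nlinarith
      calc (Q : ℝ) * q ≤ (q : ℝ) ^ (1 / 2 : ℝ) * q ^ (1 : ℝ) := by rw [Real.rpow_one]; gcongr
        _ = _ := by rw [← Real.rpow_add hq0]; norm_num
    have h8 : Real.exp ((x + y) / 4) ^ 2 * Real.exp (-((x + y) / 2)) = 1 := by
      rw [← Real.exp_nat_mul, ← Real.exp_add, Nat.cast_ofNat,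
        show 2 * ((x + y) / 4) + -((x + y) / 2) = 0 by ring, Real.exp_zero]
    have h9 : Real.exp (-(Real.pi * Real.exp x / (4 * q))) ^ 2
        = Real.exp (-Real.pi * Real.exp x / (2 * q)) := by
      rw [← Real.exp_nat_mul, Nat.cast_ofNat]
      congr 1
      ring
    rw [mul_pow, mul_pow, mul_pow, h9]
    calc _ ≤ Real.exp ((x + y) / 4) ^ 2 * ((B * (√(q / Real.exp x) *
          Real.exp (-Real.pi * Real.exp x / (2 * q)))) * (B * √(Q / Real.exp y))) := by gcongr
      _ = B ^ 2 * (√(q / Real.exp x) * √(Q / Real.exp y)) * Real.exp ((x + y) / 4) ^ 2 *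
          Real.exp (-Real.pi * Real.exp x / (2 * q)) := by ring
      _ = B ^ 2 * √(Q * q) * (Real.exp ((x + y) / 4) ^ 2 * Real.exp (-((x + y) / 2))) *
          Real.exp (-Real.pi * Real.exp x / (2 * q)) := by rw [h5]; ring
      _ ≤ _ := by
        rw [h8, mul_one]
        gcongr
  have h10 := le_of_sq_le_sq h3 (by positivity)
  have h11 : Real.exp (-(Real.pi * Real.exp x / (4 * q))) ≤ 2 * q ^ ε * Real.exp (-ε * x) := by
    have h12 : (1 / 2) * (Real.exp x / q) ≤ Real.pi * Real.exp x / (4 * q) := by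
      have : Real.pi * Real.exp x / (4 * q) = Real.pi / 4 * (Real.exp x / q) := by ring
      rw [this]
      refine mul_le_mul_of_nonneg_right ?_ (by positivity)
      linarith [Real.pi_gt_three]
    refine (Real.exp_le_exp.mpr (neg_le_neg h12)).trans ?_
    refine (exp_neg_le_rpow (by positivity) hε hε1).trans ?_
    rw [Real.mul_rpow (by norm_num) (by positivity), Real.div_rpow (Real.exp_pos x).le hq0.le,
      Real.rpow_neg hq0.le, ← Real.exp_mul, div_inv_eq_mul]
    have h13 : (1 / 2 : ℝ) ^ (-ε) ≤ 2 := by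
      rw [one_div, Real.inv_rpow (by norm_num), ← Real.rpow_neg (by norm_num), neg_neg]
      calc (2 : ℝ) ^ ε ≤ 2 ^ (1 : ℝ) := Real.rpow_le_rpow_of_exponent_le (by norm_num) hε1
        _ = 2 := Real.rpow_one 2
    rw [mul_comm x (-ε)]
    calc _ ≤ 2 * (Real.exp (-ε * x) * q ^ ε) := by gcongr
      _ = _ := by ring
  have h14 : Real.exp (-ε * x) ≤ Real.exp (-(ε / 2) * |x|) * Real.exp (-(ε / 2) * |y|) := by
    rw [← Real.exp_add, Real.exp_le_exp, abs_of_nonneg hx]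
    nlinarith
  rw [logKernel_sub_eq, abs_mul, abs_of_pos (Real.exp_pos _)]
  calc _ ≤ Real.exp ((x + y) / 4) * N := by
        gcongr
        exact abs_re_le_norm _
    _ ≤ B * (q : ℝ) ^ (3 / 8 : ℝ) * (2 * q ^ ε *
        (Real.exp (-(ε / 2) * |x|) * Real.exp (-(ε / 2) * |y|))) := by
        refine h10.trans ?_
        gcongr
        exact h11.trans (by gcongr)
    _ = 68 * C * (q ^ (3 / 8 : ℝ) * (q ^ ε * q ^ ε)) *
        (Real.exp (-(ε / 2) * |x|) * Real.exp (-(ε / 2) * |y|)) := by rw [hB]; ring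
    _ = _ := by rw [← Real.rpow_add hq0, ← Real.rpow_add hq0, two_mul]

theorem IsCosetData.abs_integral_logKernel_sub_le (D : IsCosetData p q q₀ Q χ a) (ha : 2 * |a| < Q)
    {ε C : ℝ} (hε : 0 < ε) (hε1 : ε ≤ 1) (hC1 : 1 ≤ C)
    (hC : ∀ n : ℕ, n ≠ 0 → (n.divisors.card : ℝ) ≤ C * (n : ℝ) ^ ε) :
    |∫ z : ℝ × ℝ, (logKernel p q q₀ Q a z - logDiag p q z - logMain q q₀ Q a z) *
      halfHeaviside (z.1 - z.2) * halfHeaviside (z.1 + z.2)| ≤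
      68 * C * q ^ (3 / 8 + 2 * ε) * (4 / ε) ^ 2 := by
  obtain ⟨h1, h2⟩ := integrable_exp_neg_mul_abs_prod (half_pos hε)
  have h3 : 2 / (ε / 2) = 4 / ε := by field_simp; norm_num
  rw [h3] at h2
  rw [← h2, ← integral_const_mul, ← Real.norm_eq_abs]
  refine norm_integral_le_of_norm_le (h1.const_mul _) (Filter.Eventually.of_forall fun z => ?_)
  rw [norm_mul, norm_mul, Real.norm_eq_abs, Real.norm_of_nonneg (halfHeaviside_nonneg _),
    Real.norm_of_nonneg (halfHeaviside_nonneg _)]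
  rcases lt_or_ge (z.1 - z.2) 0 with h | h
  · rw [halfHeaviside_of_neg h, mul_zero, zero_mul]
    positivity
  rcases lt_or_ge (z.1 + z.2) 0 with h' | h'
  · rw [halfHeaviside_of_neg h', mul_zero]
    positivity
  refine le_trans ?_ (D.abs_logKernel_sub_le ha hε.le hε1 hC1 hC
    (abs_le.mpr ⟨by linarith, by linarith⟩))
  rw [mul_assoc]
  refine mul_le_of_le_one_right (abs_nonneg _) ?_
  exact mul_le_one₀ (halfHeaviside_le_one _) (halfHeaviside_nonneg _) (halfHeaviside_le_one _)

end LogError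

section GammaPair

open MeasureTheory Set

theorem integral_exp_mul_exp_neg {s b : ℝ} (hs : 0 < s) (hb : 0 < b) :
    Integrable (fun x : ℝ => Real.exp (s * x) * Real.exp (-b * Real.exp x)) ∧
      ∫ x : ℝ, Real.exp (s * x) * Real.exp (-b * Real.exp x) = b ^ (-s) * Real.Gamma s := by
  have h : ∫ x : ℝ, Real.exp (s * x) * Real.exp (-b * Real.exp x) = b ^ (-s) * Real.Gamma s := by
    have h1 := Real.integral_rpow_mul_exp_neg_mul_Ioi hs hb
    rw [← Real.exp_image_univ, integral_image_eq_integral_abs_deriv_smul MeasurableSet.univ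
      (fun x _ => (Real.hasDerivAt_exp x).hasDerivWithinAt) Real.exp_injective.injOn, one_div,
      Real.inv_rpow hb.le, ← Real.rpow_neg hb.le] at h1
    rw [← h1, Measure.restrict_univ]
    refine integral_congr_ae (ae_of_all _ fun x => ?_)
    simp only [smul_eq_mul]
    rw [abs_of_pos (Real.exp_pos x), ← Real.exp_mul, ← Real.exp_add, ← Real.exp_add,
      ← Real.exp_add]
    congr 1
    ring
  refine ⟨not_imp_comm.mp integral_undef ?_, h⟩
  rw [h]
  exact (mul_pos (Real.rpow_pos_of_pos hb _) (Real.Gamma_pos_of_pos hs)).ne'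

theorem integral_exp_mul_exp_neg_prod {s b c : ℝ} (hs : 0 < s) (hb : 0 < b) (hc : 0 < c) :
    Integrable (fun z : ℝ × ℝ => (Real.exp (s * z.1) * Real.exp (-b * Real.exp z.1)) *
      (Real.exp (s * z.2) * Real.exp (-c * Real.exp z.2))) ∧
    ∫ z : ℝ × ℝ, (Real.exp (s * z.1) * Real.exp (-b * Real.exp z.1)) *
      (Real.exp (s * z.2) * Real.exp (-c * Real.exp z.2)) =
      (b * c) ^ (-s) * Real.Gamma s ^ 2 := by
  obtain ⟨h1, h2⟩ := integral_exp_mul_exp_neg hs hb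
  obtain ⟨h3, h4⟩ := integral_exp_mul_exp_neg hs hc
  refine ⟨h1.mul_prod h3, ?_⟩
  rw [Measure.volume_eq_prod, integral_prod_mul
    (fun x : ℝ => Real.exp (s * x) * Real.exp (-b * Real.exp x))
    (fun x : ℝ => Real.exp (s * x) * Real.exp (-c * Real.exp x)), h2, h4, Real.mul_rpow hb.le hc.le]
  ring

theorem abs_integral_halfHeaviside_sub_le {s κ b c : ℝ} (hκ : 0 < κ) (hs : κ ≤ s) (hb : 0 < b)
    (hc : 0 < c) :
    |(∫ z : ℝ × ℝ, (Real.exp (s * z.1) * Real.exp (-b * Real.exp z.1)) *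
      (Real.exp (s * z.2) * Real.exp (-c * Real.exp z.2)) * halfHeaviside (z.1 + z.2)) -
      (b * c) ^ (-s) * Real.Gamma s ^ 2| ≤ (b * c) ^ (-κ) * Real.Gamma κ ^ 2 := by
  obtain ⟨h1, h2⟩ := integral_exp_mul_exp_neg_prod (hκ.trans_le hs) hb hc
  obtain ⟨h3, h4⟩ := integral_exp_mul_exp_neg_prod hκ hb hc
  have hm : Measurable fun z : ℝ × ℝ => z.1 + z.2 := measurable_fst.add measurable_snd
  rw [← h2, ← integral_sub (h1.mul_halfHeaviside hm) h1,
    ← Real.norm_eq_abs, ← h4]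
  refine norm_integral_le_of_norm_le h3 (ae_of_all _ fun z => ?_)
  have h5 : halfHeaviside (z.1 + z.2) - 1 = - halfHeaviside (-(z.1 + z.2)) := by
    linarith [halfHeaviside_add_neg (z.1 + z.2)]
  rw [← mul_sub_one, h5, norm_mul, norm_neg, Real.norm_of_nonneg (halfHeaviside_nonneg _),
    Real.norm_of_nonneg (by positivity)]
  rcases lt_or_ge 0 (z.1 + z.2) with h | h
  · rw [halfHeaviside_of_neg (by linarith), mul_zero]
    positivity
  refine (mul_le_of_le_one_right (by positivity) (halfHeaviside_le_one _)).trans ?_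
  calc _ = Real.exp (s * (z.1 + z.2)) *
        (Real.exp (-b * Real.exp z.1) * Real.exp (-c * Real.exp z.2)) := by
        rw [mul_add, Real.exp_add]; ring
    _ ≤ Real.exp (κ * (z.1 + z.2)) *
        (Real.exp (-b * Real.exp z.1) * Real.exp (-c * Real.exp z.2)) := by
        gcongr ?_ * _
        rw [Real.exp_le_exp]
        exact mul_le_mul_of_nonpos_right hs h
    _ = _ := by rw [mul_add, Real.exp_add]; ring

end GammaPair

section LogMain

open MeasureTheory

/-- The symmetric form of `logMain`, without the constant. -/
noncomputable def symMain (q : ℕ) (a : ℤ) (z : ℝ × ℝ) : ℝ :=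
  ∑ w ∈ a.divisorsAntidiag,
    (Real.exp (1 / 4 * z.1) * Real.exp (-(Real.pi * w.1 ^ 2 / q) * Real.exp z.1)) *
      (Real.exp (1 / 4 * z.2) * Real.exp (-(Real.pi * w.2 ^ 2 / q) * Real.exp z.2))

theorem logMain_eq (q q₀ Q : ℕ) (a : ℤ) (x y : ℝ) : logMain q q₀ Q a (x, -y) =
    √(Q / q₀) * Real.cos (2 * Real.pi * a / q) * symMain q a (x, y) := by
  rw [logMain, symMain, mainKernel, Finset.mul_sum]
  congr 1
  refine Finset.sum_congr rfl fun w _ => ?_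
  rw [← Real.exp_add, ← Real.exp_add, ← Real.exp_add, ← Real.exp_add, neg_neg]
  congr 1
  simp only
  ring

theorem symMain_swap (q : ℕ) (a : ℤ) (z : ℝ × ℝ) : symMain q a z.swap = symMain q a z := by
  rw [symMain, symMain]
  refine Finset.sum_nbij' Prod.swap Prod.swap ?_ ?_ (fun _ _ => Prod.swap_swap _)
    (fun _ _ => Prod.swap_swap _) (fun w _ => ?_)
  · intro w hw
    simpa [mul_comm] using hw
  · intro w hw
    simpa [mul_comm] using hw
  · simp only [Prod.fst_swap, Prod.snd_swap]
    ring

variable {q : ℕ} [NeZero q] {a : ℤ}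

theorem pair_pos (ha : a ≠ 0) {w : ℤ × ℤ} (hw : w ∈ a.divisorsAntidiag) :
    0 < Real.pi * (w.1 : ℝ) ^ 2 / q ∧ 0 < Real.pi * (w.2 : ℝ) ^ 2 / q ∧
    Real.pi * (w.1 : ℝ) ^ 2 / q * (Real.pi * (w.2 : ℝ) ^ 2 / q) = (Real.pi * |(a : ℝ)| / q) ^ 2 := by
  have hq : (0 : ℝ) < q := by exact_mod_cast Nat.pos_of_ne_zero (NeZero.ne q)
  obtain ⟨h, -⟩ := Int.mem_divisorsAntidiag.mp hw
  have h1 : (w.1 : ℝ) ≠ 0 := by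
    intro h1
    rw [Int.cast_eq_zero] at h1
    exact ha (by rw [← h, h1, zero_mul])
  have h2 : (w.2 : ℝ) ≠ 0 := by
    intro h1
    rw [Int.cast_eq_zero] at h1
    exact ha (by rw [← h, h1, mul_zero])
  refine ⟨by positivity, by positivity, ?_⟩
  rw [div_pow, mul_pow, sq_abs, ← h]
  push_cast
  ring

theorem integrable_symMain (ha : a ≠ 0) : Integrable (symMain q a) := by
  refine integrable_finsetSum _ fun w hw => ?_
  obtain ⟨h1, h2, -⟩ := pair_pos (q := q) ha hw
  exact (integral_exp_mul_exp_neg_prod (by norm_num) h1 h2).1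

theorem abs_integral_symMain_sub_le (ha : a ≠ 0) {κ : ℝ} (hκ : 0 < κ) (hκ1 : κ ≤ 1 / 4) :
    |(∫ z : ℝ × ℝ, symMain q a z * halfHeaviside (z.1 + z.2)) -
      2 * a.natAbs.divisors.card * (√q / √|(a : ℝ)| * (Real.Gamma (1 / 4) ^ 2 / √Real.pi))| ≤
      2 * a.natAbs.divisors.card * (q ^ (2 * κ) * Real.Gamma κ ^ 2) := by
  have hq : (0 : ℝ) < q := by exact_mod_cast Nat.pos_of_ne_zero (NeZero.ne q)
  have ha0 : 1 ≤ |(a : ℝ)| := by exact_mod_cast Int.one_le_abs ha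
  have hX : 0 < Real.pi * |(a : ℝ)| / q := by positivity
  have h1 : ((Real.pi * |(a : ℝ)| / q) ^ 2) ^ (-(1 / 4 : ℝ)) * Real.Gamma (1 / 4) ^ 2
      = √q / √|(a : ℝ)| * (Real.Gamma (1 / 4) ^ 2 / √Real.pi) := by
    rw [← Real.rpow_natCast, ← Real.rpow_mul hX.le,
      show ((2 : ℕ) : ℝ) * -(1 / 4) = -(1 / 2) by norm_num, Real.rpow_neg hX.le,
      ← Real.sqrt_eq_rpow, Real.sqrt_div (by positivity), Real.sqrt_mul Real.pi_pos.le]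
    field_simp
  have h2 : ((Real.pi * |(a : ℝ)| / q) ^ 2) ^ (-κ) ≤ q ^ (2 * κ) := by
    rw [← Real.rpow_natCast, ← Real.rpow_mul hX.le, Nat.cast_ofNat, mul_neg, Real.rpow_neg hX.le,
      ← Real.inv_rpow hX.le]
    refine Real.rpow_le_rpow (by positivity) ?_ (by positivity)
    rw [inv_div, div_le_iff₀ (by positivity)]
    have : 1 ≤ Real.pi * |(a : ℝ)| := by nlinarith [Real.pi_gt_three]
    nlinarith
  have hcard : (2 * a.natAbs.divisors.card : ℝ) = a.divisorsAntidiag.card := by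
    rw [Int.card_divisorsAntidiag]; push_cast; ring
  have hm : Measurable fun z : ℝ × ℝ => z.1 + z.2 := measurable_fst.add measurable_snd
  simp only [symMain, Finset.sum_mul]
  rw [integral_finsetSum _ fun w hw => ((integral_exp_mul_exp_neg_prod (by norm_num)
    (pair_pos ha hw).1 (pair_pos ha hw).2.1).1.mul_halfHeaviside hm), hcard, ← nsmul_eq_mul,
    ← nsmul_eq_mul, ← Finset.sum_const, ← Finset.sum_const, ← Finset.sum_sub_distrib]
  refine (Finset.abs_sum_le_sum_abs _ _).trans (Finset.sum_le_sum fun w hw => ?_)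
  obtain ⟨h3, h4, h5⟩ := pair_pos (q := q) ha hw
  have h6 := abs_integral_halfHeaviside_sub_le hκ hκ1 h3 h4
  rw [h5, h1] at h6
  exact h6.trans (by gcongr)

theorem integral_logMain (q₀ Q : ℕ) (ha : a ≠ 0) :
    Integrable (fun z : ℝ × ℝ => logMain q q₀ Q a z * halfHeaviside (z.1 - z.2) *
      halfHeaviside (z.1 + z.2)) ∧
    2 * ∫ z : ℝ × ℝ, logMain q q₀ Q a z * halfHeaviside (z.1 - z.2) * halfHeaviside (z.1 + z.2) =
      √(Q / q₀) * Real.cos (2 * Real.pi * a / q) *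
        ∫ z : ℝ × ℝ, symMain q a z * halfHeaviside (z.1 + z.2) := by
  have hm : Measurable fun z : ℝ × ℝ => z.1 + z.2 := measurable_fst.add measurable_snd
  have hm' : Measurable fun z : ℝ × ℝ => z.1 - z.2 := measurable_fst.sub measurable_snd
  have hi := (integrable_symMain (q := q) ha).mul_halfHeaviside hm
  have hi' := hi.mul_halfHeaviside hm'
  set e : ℝ × ℝ → ℝ × ℝ := Prod.map id Neg.neg with he
  have hmp : MeasurePreserving e :=
    (MeasurePreserving.id (volume : Measure ℝ)).prod (Measure.measurePreserving_neg volume)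
  have hemb : MeasurableEmbedding e :=
    ((MeasurableEquiv.refl ℝ).prodCongr (MeasurableEquiv.neg ℝ)).measurableEmbedding
  have h1 : (fun z : ℝ × ℝ => logMain q q₀ Q a z * halfHeaviside (z.1 - z.2) *
      halfHeaviside (z.1 + z.2)) ∘ e = fun z => √(Q / q₀) * Real.cos (2 * Real.pi * a / q) *
      (symMain q a z * halfHeaviside (z.1 + z.2) * halfHeaviside (z.1 - z.2)) := by
    funext z
    obtain ⟨x, y⟩ := z
    simp only [Function.comp, he, Prod.map, id]
    rw [logMain_eq, sub_neg_eq_add, ← sub_eq_add_neg]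
    ring
  refine ⟨?_, ?_⟩
  · rw [← hmp.integrable_comp_emb hemb, h1]
    exact hi'.const_mul _
  · rw [← hmp.integral_comp hemb]
    have h2 : ∀ z : ℝ × ℝ, logMain q q₀ Q a (e z) * halfHeaviside ((e z).1 - (e z).2) *
      halfHeaviside ((e z).1 + (e z).2) = √(Q / q₀) * Real.cos (2 * Real.pi * a / q) *
      (symMain q a z * halfHeaviside (z.1 + z.2) * halfHeaviside (z.1 - z.2)) :=
      fun z => congrFun h1 z
    simp only [h2]
    rw [integral_const_mul, integral_eq_two_mul_halfHeaviside hi hm' (T := Prod.swap)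
      integral_comp_swap (fun z => by rw [symMain_swap, Prod.fst_swap, Prod.snd_swap, add_comm])
      (fun z => by simp)]
    ring

end LogMain

section WeightedHarmonic

/-- The summand of the half-weighted harmonic sum with cutoff `e ^ L`. -/
noncomputable def harmonicTerm (L : ℝ) (m : ℕ) : ℝ := 1 / m * halfHeaviside (L - Real.log m)

theorem harmonicTerm_nonneg (L : ℝ) (m : ℕ) : 0 ≤ harmonicTerm L m :=
  mul_nonneg (by positivity) (halfHeaviside_nonneg _)

theorem harmonicTerm_le (L : ℝ) (m : ℕ) :
    harmonicTerm L m ≤ Real.exp (L / 2) * (m : ℝ) ^ (-(3 / 2) : ℝ) := by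
  rcases Nat.eq_zero_or_pos m with rfl | hm
  · simp [harmonicTerm]
  have hm0 : (0 : ℝ) < m := by exact_mod_cast hm
  rw [harmonicTerm]
  rcases lt_or_ge (L - Real.log m) 0 with h | h
  · rw [halfHeaviside_of_neg h, mul_zero]
    positivity
  refine (mul_le_of_le_one_right (by positivity) (halfHeaviside_le_one _)).trans ?_
  have h1 : (m : ℝ) ^ (-(3 / 2) : ℝ) = 1 / m * Real.exp (-(Real.log m / 2)) := by
    rw [Real.rpow_def_of_pos hm0, one_div, ← Real.exp_log (inv_pos.mpr hm0), ← Real.exp_add,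
      Real.log_inv]
    ring_nf
  rw [h1, mul_left_comm, ← Real.exp_add]
  refine le_mul_of_one_le_right (by positivity) (Real.one_le_exp (by linarith))

theorem harmonicTerm_mul {p : ℕ} (hp : p ≠ 0) (L : ℝ) (m : ℕ) :
    harmonicTerm L (p * m) = 1 / p * harmonicTerm (L - Real.log p) m := by
  rcases Nat.eq_zero_or_pos m with rfl | hm
  · simp [harmonicTerm]
  rw [harmonicTerm, harmonicTerm, Nat.cast_mul,
    Real.log_mul (by exact_mod_cast hp) (by exact_mod_cast hm.ne'), sub_sub, ← mul_assoc,
    one_div_mul_one_div]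

theorem harmonicTerm_of_lt {L : ℝ} {m : ℕ} (h : L < Real.log m) : harmonicTerm L m = 0 := by
  rw [harmonicTerm, halfHeaviside_of_neg (by linarith), mul_zero]

theorem support_harmonicTerm (L : ℝ) {m : ℕ} (hm : m ∉ Finset.range (⌊Real.exp L⌋₊ + 1)) :
    harmonicTerm L m = 0 := by
  rw [Finset.mem_range, not_lt, Nat.add_one_le_iff] at hm
  have h1 : 0 < m := (Nat.zero_le _).trans_lt hm
  have h2 := (Nat.floor_lt (Real.exp_pos L).le).mp hm
  exact harmonicTerm_of_lt ((Real.lt_log_iff_exp_lt (by exact_mod_cast h1)).mpr h2)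

theorem summable_harmonicTerm (L : ℝ) : Summable (harmonicTerm L) :=
  summable_of_ne_finset_zero fun _ hm => support_harmonicTerm L hm

theorem tsum_harmonicTerm_bounds {L : ℝ} (hL : 0 ≤ L) :
    ∑' m, harmonicTerm L m ≤ harmonic ⌊Real.exp L⌋₊ ∧
    (harmonic ⌊Real.exp L⌋₊ : ℝ) - 1 / ⌊Real.exp L⌋₊ ≤ ∑' m, harmonicTerm L m := by
  rw [tsum_eq_sum fun _ hm => support_harmonicTerm L hm, Finset.sum_range_succ']
  have h1 : (1 : ℝ) ≤ Real.exp L := Real.one_le_exp hL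
  have h0 : harmonicTerm L 0 = 0 := by simp [harmonicTerm]
  obtain ⟨k, hk⟩ : ∃ k, ⌊Real.exp L⌋₊ = k + 1 :=
    Nat.exists_eq_succ_of_ne_zero (Nat.floor_pos.mpr h1).ne'
  have h2 : ((k + 1 : ℕ) : ℝ) ≤ Real.exp L := by
    rw [← hk]
    exact Nat.floor_le (Real.exp_pos L).le
  have h3 : ∀ i ∈ Finset.range k, harmonicTerm L (i + 1) = ((i + 1 : ℕ) : ℝ)⁻¹ := fun i hi => by
    rw [harmonicTerm, halfHeaviside_of_pos, mul_one, one_div]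
    rw [sub_pos, Real.log_lt_iff_lt_exp (by positivity)]
    refine lt_of_lt_of_le ?_ h2
    exact_mod_cast Nat.add_lt_add_right (Finset.mem_range.mp hi) 1
  have h4 : harmonicTerm L (k + 1) ≤ ((k + 1 : ℕ) : ℝ)⁻¹ := by
    rw [harmonicTerm, one_div]
    exact mul_le_of_le_one_right (by positivity) (halfHeaviside_le_one _)
  have h5 : (harmonic (k + 1) : ℝ)
      = ∑ i ∈ Finset.range k, ((i + 1 : ℕ) : ℝ)⁻¹ + ((k + 1 : ℕ) : ℝ)⁻¹ := by
    rw [harmonic, Finset.sum_range_succ]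
    push_cast
    rfl
  rw [h0, add_zero, hk, h5, Finset.sum_range_succ, Finset.sum_congr rfl h3]
  refine ⟨by linarith, ?_⟩
  rw [one_div, add_sub_cancel_right]
  linarith [harmonicTerm_nonneg L (k + 1)]

theorem abs_tsum_harmonicTerm_sub_le (L : ℝ) :
    |∑' m, harmonicTerm L m - (L + Real.eulerMascheroniConstant)| ≤ 4 * Real.exp (-(L / 2)) := by
  have hγ := Real.one_half_lt_eulerMascheroniConstant
  have hγ' := Real.eulerMascheroniConstant_lt_two_thirds
  rcases lt_or_ge L 0 with hL | hL
  · have h1 : ∑' m, harmonicTerm L m = 0 := by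
      refine (tsum_congr fun m => ?_).trans tsum_zero
      rcases Nat.eq_zero_or_pos m with rfl | hm
      · simp [harmonicTerm]
      · exact harmonicTerm_of_lt (hL.trans_le (Real.log_natCast_nonneg m))
    have h2 := Real.add_one_le_exp (-(L / 2))
    rw [h1, zero_sub, abs_neg, abs_le]
    constructor <;> linarith
  obtain ⟨h1, h2⟩ := tsum_harmonicTerm_bounds hL
  set n := ⌊Real.exp L⌋₊ with hn
  have hn1 : 1 ≤ n := (Nat.one_le_floor_iff _).mpr (Real.one_le_exp hL)
  have hn0 : (0 : ℝ) < n := by exact_mod_cast hn1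
  have h3 := Real.eulerMascheroniSeq_lt_eulerMascheroniConstant n
  have h4 := Real.eulerMascheroniConstant_lt_eulerMascheroniSeq' n
  rw [Real.eulerMascheroniSeq] at h3
  rw [Real.eulerMascheroniSeq', if_neg (by omega)] at h4
  have h5 : Real.log n ≤ L := by
    rw [Real.log_le_iff_le_exp hn0]
    exact Nat.floor_le (Real.exp_pos L).le
  have h6 : Real.exp L < n + 1 := Nat.lt_floor_add_one _
  have h7 : L ≤ Real.log (n + 1) := by
    rw [Real.le_log_iff_exp_le (by positivity)]
    exact h6.le
  have h8 : Real.log (n + 1) ≤ Real.log n + 1 / n := by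
    have : (n : ℝ) + 1 = n * (1 + 1 / n) := by field_simp
    rw [this, Real.log_mul hn0.ne' (by positivity)]
    have := Real.log_le_sub_one_of_pos (show (0 : ℝ) < 1 + 1 / n by positivity)
    linarith
  have h9 : 1 / (n : ℝ) ≤ 2 * Real.exp (-(L / 2)) := by
    rw [Real.exp_neg, div_le_iff₀ hn0, mul_assoc, inv_mul_eq_div, ← mul_div_assoc,
      one_le_div (Real.exp_pos _)]
    have h10 : Real.exp (L / 2) ≤ Real.exp L := Real.exp_le_exp.mpr (by linarith)
    have h11 : (1 : ℝ) ≤ n := by exact_mod_cast hn1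
    linarith
  rw [abs_le]
  constructor <;> linarith

theorem abs_tsum_not_dvd_harmonicTerm_sub_le {p : ℕ} (hp : 1 ≤ p) (L : ℝ) :
    |∑' m, (if p ∣ m then 0 else harmonicTerm L m) -
      ((1 - 1 / p) * (L + Real.eulerMascheroniConstant) + Real.log p / p)| ≤
      8 * Real.exp (-(L / 2)) := by
  have hp0 : (0 : ℝ) < p := by exact_mod_cast hp
  have h1 : ∑' m, (if p ∣ m then harmonicTerm L m else 0)
      = 1 / p * ∑' m, harmonicTerm (L - Real.log p) m := by
    rw [← tsum_mul_left, ← (mul_right_injective₀ (M₀ := ℕ) (by omega : p ≠ 0)).tsum_eq]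
    · refine tsum_congr fun m => ?_
      rw [if_pos (dvd_mul_right p m), harmonicTerm_mul (by omega)]
    · intro m hm
      by_cases h : p ∣ m
      · obtain ⟨c, rfl⟩ := h
        exact ⟨c, rfl⟩
      · simp [h] at hm
  have hs := summable_harmonicTerm L
  have hs' : Summable fun m => if p ∣ m then harmonicTerm L m else 0 :=
    hs.of_nonneg_of_le (fun m => by split_ifs; exacts [harmonicTerm_nonneg _ _, le_rfl])
      (fun m => by split_ifs; exacts [le_rfl, harmonicTerm_nonneg _ _])
  have h2 : ∑' m, (if p ∣ m then 0 else harmonicTerm L m)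
      = ∑' m, harmonicTerm L m - 1 / p * ∑' m, harmonicTerm (L - Real.log p) m := by
    rw [← h1, ← hs.tsum_sub hs']
    refine tsum_congr fun m => ?_
    split_ifs <;> simp
  have h3 := abs_tsum_harmonicTerm_sub_le L
  have h4 := abs_tsum_harmonicTerm_sub_le (L - Real.log p)
  have h5 : 1 / p * (4 * Real.exp (-((L - Real.log p) / 2))) ≤ 4 * Real.exp (-(L / 2)) := by
    have h6 : Real.exp (-((L - Real.log p) / 2)) = Real.exp (-(L / 2)) * Real.exp (Real.log p / 2) := by
      rw [← Real.exp_add]; ring_nf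
    have h7 : Real.exp (Real.log p / 2) ≤ p := by
      calc _ ≤ Real.exp (Real.log p) := by
            rw [Real.exp_le_exp]
            linarith [Real.log_natCast_nonneg p]
        _ = p := Real.exp_log hp0
    rw [h6, one_div, inv_mul_le_iff₀ hp0]
    calc _ = 4 * Real.exp (-(L / 2)) * Real.exp (Real.log p / 2) := by ring
      _ ≤ 4 * Real.exp (-(L / 2)) * p := by gcongr
      _ = _ := by ring
  have h8 : |1 / (p : ℝ) * (∑' m, harmonicTerm (L - Real.log p) m -
      (L - Real.log p + Real.eulerMascheroniConstant))| ≤ 4 * Real.exp (-(L / 2)) := by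
    rw [abs_mul, abs_of_pos (by positivity)]
    exact le_trans (by gcongr) h5
  rw [h2]
  refine (le_of_eq (congrArg abs ?_)).trans ((abs_sub _ _).trans
    ((add_le_add h3 h8).trans (by linarith)))
  ring

end WeightedHarmonic

section GammaDeriv

open MeasureTheory Set

theorem abs_le_exp_add_exp (x : ℝ) : |x| ≤ 8 * (Real.exp (1 / 8 * x) + Real.exp (-(1 / 8) * x)) := by
  have h1 := Real.add_one_le_exp (1 / 8 * x)
  have h2 := Real.add_one_le_exp (-(1 / 8) * x)
  have h3 := Real.exp_pos (1 / 8 * x)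
  have h4 := Real.exp_pos (-(1 / 8) * x)
  rw [abs_le]
  constructor <;> linarith

theorem integrable_mul_exp_mul_exp_neg :
    Integrable fun x : ℝ => x * (Real.exp (1 / 4 * x) * Real.exp (-1 * Real.exp x)) := by
  have h1 := (integral_exp_mul_exp_neg (s := 3 / 8) (b := 1) (by norm_num) one_pos).1
  have h2 := (integral_exp_mul_exp_neg (s := 1 / 8) (b := 1) (by norm_num) one_pos).1
  refine ((h1.add h2).const_mul 8).mono' (by fun_prop) (ae_of_all _ fun x => ?_)
  rw [norm_mul, Real.norm_eq_abs, Real.norm_of_nonneg (by positivity)]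
  refine (mul_le_mul_of_nonneg_right (abs_le_exp_add_exp x) (by positivity)).trans (le_of_eq ?_)
  have h3 : Real.exp (3 / 8 * x) = Real.exp (1 / 8 * x) * Real.exp (1 / 4 * x) := by
    rw [← Real.exp_add]; ring_nf
  have h4 : Real.exp (1 / 8 * x) = Real.exp (-(1 / 8) * x) * Real.exp (1 / 4 * x) := by
    rw [← Real.exp_add]; ring_nf
  simp only [Pi.add_apply]
  rw [h3, mul_assoc, add_mul, ← mul_assoc (Real.exp (-(1 / 8) * x)), ← h4, mul_assoc]

theorem deriv_Gamma_eq_integral : deriv Real.Gamma (1 / 4) =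
    ∫ x : ℝ, x * (Real.exp (1 / 4 * x) * Real.exp (-1 * Real.exp x)) := by
  have h1 : HasDerivAt Complex.GammaIntegral
      ((∫ x : ℝ, x * (Real.exp (1 / 4 * x) * Real.exp (-1 * Real.exp x)) : ℝ) : ℂ)
      ((1 / 4 : ℝ) : ℂ) := by
    convert Complex.hasDerivAt_GammaIntegral (s := ((1 / 4 : ℝ) : ℂ)) (by norm_num) using 1
    rw [integral_Ioi_eq_integral_exp, ← integral_complex_ofReal]
    refine integral_congr_ae (ae_of_all _ fun x => ?_)
    simp only
    rw [← mul_assoc (Real.exp x : ℂ), exp_mul_exp_cpow, Real.log_exp, neg_one_mul]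
    push_cast
    ring
  have h2 : HasDerivAt Complex.Gamma
      ((∫ x : ℝ, x * (Real.exp (1 / 4 * x) * Real.exp (-1 * Real.exp x)) : ℝ) : ℂ)
      ((1 / 4 : ℝ) : ℂ) := by
    refine h1.congr_of_eventuallyEq ?_
    have h3 : {s : ℂ | 0 < s.re} ∈ nhds ((1 / 4 : ℝ) : ℂ) :=
      (isOpen_lt continuous_const continuous_re).mem_nhds (by norm_num)
    filter_upwards [h3] with s hs
    exact Complex.Gamma_eq_integral hs
  have h4 := h2.real_of_complex
  simp only [Complex.Gamma_ofReal, ofReal_re] at h4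
  exact h4.deriv

/-- The integral of the main term of the half-weighted harmonic sum. -/
theorem integral_affine_mul (A B : ℝ) :
    Integrable (fun z : ℝ × ℝ => (A + B * (z.1 + z.2)) *
      ((Real.exp (1 / 4 * z.1) * Real.exp (-1 * Real.exp z.1)) *
      (Real.exp (1 / 4 * z.2) * Real.exp (-1 * Real.exp z.2)))) ∧
    ∫ z : ℝ × ℝ, (A + B * (z.1 + z.2)) *
      ((Real.exp (1 / 4 * z.1) * Real.exp (-1 * Real.exp z.1)) *
      (Real.exp (1 / 4 * z.2) * Real.exp (-1 * Real.exp z.2))) =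
      A * Real.Gamma (1 / 4) ^ 2 + 2 * B * (Real.Gamma (1 / 4) * deriv Real.Gamma (1 / 4)) := by
  set g : ℝ → ℝ := fun x => Real.exp (1 / 4 * x) * Real.exp (-1 * Real.exp x) with hg
  set k : ℝ → ℝ := fun x => x * g x with hk
  obtain ⟨hi, h1⟩ : Integrable g ∧ ∫ x, g x = Real.Gamma (1 / 4) := by
    have h := integral_exp_mul_exp_neg (s := 1 / 4) (b := 1) (by norm_num) one_pos
    rwa [Real.one_rpow, one_mul] at h
  have hj : Integrable k := integrable_mul_exp_mul_exp_neg
  have h2 : ∫ x, k x = deriv Real.Gamma (1 / 4) := deriv_Gamma_eq_integral.symm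
  have h3 : ∀ z : ℝ × ℝ, (A + B * (z.1 + z.2)) * (g z.1 * g z.2) =
      A * (g z.1 * g z.2) + (B * (k z.1 * g z.2) + B * (g z.1 * k z.2)) := fun z => by
    simp only [hk]; ring
  have e1 : Integrable fun z : ℝ × ℝ => A * (g z.1 * g z.2) := (hi.mul_prod hi).const_mul A
  have e2 : Integrable fun z : ℝ × ℝ => B * (k z.1 * g z.2) := (hj.mul_prod hi).const_mul B
  have e3 : Integrable fun z : ℝ × ℝ => B * (g z.1 * k z.2) := (hi.mul_prod hj).const_mul B
  change Integrable (fun z : ℝ × ℝ => (A + B * (z.1 + z.2)) * (g z.1 * g z.2)) ∧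
    ∫ z : ℝ × ℝ, (A + B * (z.1 + z.2)) * (g z.1 * g z.2) = _
  simp only [h3]
  refine ⟨e1.add (e2.add e3), ?_⟩
  have e5 : Integrable fun z : ℝ × ℝ => B * (k z.1 * g z.2) + B * (g z.1 * k z.2) := e2.add e3
  rw [integral_add e1 e5, integral_add e2 e3, integral_const_mul, integral_const_mul,
    integral_const_mul, Measure.volume_eq_prod, integral_prod_mul g g, integral_prod_mul k g,
    integral_prod_mul g k, h1, h2]
  ring

end GammaDeriv

section NonnegSeries

open MeasureTheory

theorem integrable_tsum_of_nonneg {α : Type*} [MeasurableSpace α] {μ : Measure α} {F : ℕ → α → ℝ}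
    (hF : ∀ i, Integrable (F i) μ) (h0 : ∀ i a, 0 ≤ F i a) (hs : ∀ a, Summable fun i => F i a)
    (hS : Summable fun i => ∫ a, F i a ∂μ) :
    Integrable (fun a => ∑' i, F i a) μ ∧ ∫ a, ∑' i, F i a ∂μ = ∑' i, ∫ a, F i a ∂μ := by
  constructor
  · refine ⟨aestronglyMeasurable_of_tendsto_ae Filter.atTop
      (f := fun n a => ∑ i ∈ Finset.range n, F i a)
      (fun n => (integrable_finsetSum _ fun i _ => hF i).aestronglyMeasurable)
      (ae_of_all _ fun a => (hs a).hasSum.tendsto_sum_nat), ?_⟩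
    rw [hasFiniteIntegral_iff_ofReal (ae_of_all _ fun a => tsum_nonneg fun i => h0 i a)]
    simp only [ENNReal.ofReal_tsum_of_nonneg (fun i => h0 i _) (hs _)]
    rw [lintegral_tsum fun i => (hF i).aemeasurable.ennreal_ofReal]
    simp only [← ofReal_integral_eq_lintegral_ofReal (hF _) (ae_of_all _ (h0 _))]
    rw [← ENNReal.ofReal_tsum_of_nonneg (fun i => integral_nonneg (h0 i)) hS]
    exact ENNReal.ofReal_lt_top
  · refine (integral_tsum_of_summable_integral_norm hF ?_).symm
    simpa only [Real.norm_of_nonneg (h0 _ _)] using hS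

end NonnegSeries

section DiagIntegral

open MeasureTheory

/-- The product weight `(t v) ^ s e^{-t-v}` in logarithmic coordinates. -/
noncomputable def gammaWeight (s : ℝ) (z : ℝ × ℝ) : ℝ :=
  (Real.exp (s * z.1) * Real.exp (-1 * Real.exp z.1)) *
    (Real.exp (s * z.2) * Real.exp (-1 * Real.exp z.2))

theorem gammaWeight_nonneg (s : ℝ) (z : ℝ × ℝ) : 0 ≤ gammaWeight s z := by
  unfold gammaWeight
  positivity

theorem integral_gammaWeight {s : ℝ} (hs : 0 < s) :
    Integrable (gammaWeight s) ∧ ∫ z, gammaWeight s z = Real.Gamma s ^ 2 := by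
  have h := integral_exp_mul_exp_neg_prod hs one_pos one_pos
  rwa [mul_one, Real.one_rpow, one_mul] at h

theorem exp_mul_gammaWeight (r T : ℝ) (z : ℝ × ℝ) :
    Real.exp (r * (T + (z.1 + z.2) / 4)) * gammaWeight (1 / 4) z =
      Real.exp (r * T) * gammaWeight ((1 + r) / 4) z := by
  rw [gammaWeight, gammaWeight]
  simp only [← Real.exp_add]
  congr 1
  ring

theorem halfHeaviside_mul {c : ℝ} (hc : 0 < c) (s : ℝ) :
    halfHeaviside (c * s) = halfHeaviside s := by
  simp [hc.ne', halfHeaviside, hc]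

/-- The weighted summand of the half-weighted harmonic sum over integers prime to `p`. -/
noncomputable def weightedTerm (p : ℕ) (T : ℝ) (m : ℕ) (z : ℝ × ℝ) : ℝ :=
  (if p ∣ m then 0 else harmonicTerm (T + (z.1 + z.2) / 4) m) * gammaWeight (1 / 4) z

theorem weightedTerm_nonneg (p : ℕ) (T : ℝ) (m : ℕ) (z : ℝ × ℝ) : 0 ≤ weightedTerm p T m z := by
  refine mul_nonneg ?_ (gammaWeight_nonneg _ _)
  split_ifs
  exacts [le_rfl, harmonicTerm_nonneg _ _]

theorem integrable_weightedTerm (p : ℕ) (T : ℝ) (m : ℕ) : Integrable (weightedTerm p T m) := by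
  have h0 := (integral_gammaWeight (s := 1 / 4) (by norm_num)).1
  by_cases h : p ∣ m
  · have : weightedTerm p T m = fun _ => 0 := by
      funext z
      rw [weightedTerm, if_pos h, zero_mul]
    rw [this]
    exact integrable_zero _ _ _
  · have hm : Measurable fun z : ℝ × ℝ => T + (z.1 + z.2) / 4 - Real.log m := by fun_prop
    have : weightedTerm p T m = fun z => 1 / (m : ℝ) *
        (gammaWeight (1 / 4) z * halfHeaviside (T + (z.1 + z.2) / 4 - Real.log m)) := by
      funext z
      rw [weightedTerm, if_neg h, harmonicTerm]
      ring
    rw [this]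
    exact (h0.mul_halfHeaviside hm).const_mul _

theorem summable_not_dvd_harmonicTerm (p : ℕ) (L : ℝ) :
    Summable fun m => if p ∣ m then 0 else harmonicTerm L m :=
  (summable_harmonicTerm L).of_nonneg_of_le
    (fun m => by split_ifs; exacts [le_rfl, harmonicTerm_nonneg _ _])
    (fun m => by split_ifs; exacts [harmonicTerm_nonneg _ _, le_rfl])

theorem summable_integral_weightedTerm (p : ℕ) (T : ℝ) :
    Summable fun m => ∫ z, weightedTerm p T m z := by
  obtain ⟨h1, -⟩ := integral_gammaWeight (s := (1 + 1 / 2) / 4) (by norm_num)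
  have h2 : Summable fun m : ℕ => (m : ℝ) ^ (-(3 / 2) : ℝ) :=
    Real.summable_nat_rpow.mpr (by norm_num)
  refine (h2.mul_right (∫ z, Real.exp (1 / 2 * T) * gammaWeight ((1 + 1 / 2) / 4) z)).of_nonneg_of_le
    (fun m => integral_nonneg (weightedTerm_nonneg p T m)) (fun m => ?_)
  rw [← integral_const_mul]
  refine integral_mono (integrable_weightedTerm p T m) ((h1.const_mul _).const_mul _) fun z => ?_
  simp only
  rw [weightedTerm, ← exp_mul_gammaWeight, ← mul_assoc]
  refine mul_le_mul_of_nonneg_right ?_ (gammaWeight_nonneg _ _)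
  split_ifs
  · positivity
  · refine (harmonicTerm_le _ m).trans (le_of_eq ?_)
    rw [mul_comm, one_div_mul_eq_div]

theorem abs_integral_tsum_weightedTerm_sub_le {p : ℕ} (hp : 1 ≤ p) (T : ℝ) :
    |(∫ z, ∑' m, weightedTerm p T m z) -
      (((1 - 1 / p) * (T + Real.eulerMascheroniConstant) + Real.log p / p) * Real.Gamma (1 / 4) ^ 2 +
        2 * ((1 - 1 / p) / 4) * (Real.Gamma (1 / 4) * deriv Real.Gamma (1 / 4)))| ≤
      8 * Real.exp (-(1 / 2) * T) * Real.Gamma (1 / 8) ^ 2 := by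
  obtain ⟨h1, h2⟩ := integral_affine_mul
    ((1 - 1 / p) * (T + Real.eulerMascheroniConstant) + Real.log p / p) ((1 - 1 / p) / 4)
  obtain ⟨h3, -⟩ := integrable_tsum_of_nonneg (integrable_weightedTerm p T) (weightedTerm_nonneg p T)
    (fun z => (summable_not_dvd_harmonicTerm p _).mul_right _) (summable_integral_weightedTerm p T)
  obtain ⟨h4, h5⟩ := integral_gammaWeight (s := 1 / 8) (by norm_num)
  rw [← h2, ← integral_sub h3 h1, ← h5, ← integral_const_mul, ← Real.norm_eq_abs]
  refine norm_integral_le_of_norm_le (h4.const_mul _) (ae_of_all _ fun z => ?_)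
  have h6 := abs_tsum_not_dvd_harmonicTerm_sub_le hp (T + (z.1 + z.2) / 4)
  have h7 := exp_mul_gammaWeight (-(1 / 2)) T z
  rw [show (1 + -(1 / 2)) / 4 = (1 / 8 : ℝ) by norm_num] at h7
  rw [mul_assoc 8, ← h7, Real.norm_eq_abs]
  simp only [weightedTerm]
  rw [tsum_mul_right]
  refine (le_of_eq ?_).trans ((mul_le_mul_of_nonneg_right h6 (gammaWeight_nonneg (1 / 4) z)).trans
    (le_of_eq ?_))
  · rw [← abs_of_nonneg (gammaWeight_nonneg (1 / 4) z), ← abs_mul,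
      abs_of_nonneg (gammaWeight_nonneg (1 / 4) z), gammaWeight]
    congr 1
    ring
  · rw [mul_assoc]
    congr 3
    ring

theorem integral_exp_scale {b : ℝ} (hb : 0 < b) :
    ∫ z : ℝ × ℝ, (Real.exp (1 / 4 * z.1) * Real.exp (-b * Real.exp z.1)) *
      (Real.exp (1 / 4 * z.2) * Real.exp (-b * Real.exp z.2)) * halfHeaviside (z.1 + z.2) =
    (√b)⁻¹ * ∫ z : ℝ × ℝ, gammaWeight (1 / 4) z * halfHeaviside (z.1 + z.2 - 2 * Real.log b) := by
  rw [← integral_add_right_eq_self _ ((-Real.log b, -Real.log b) : ℝ × ℝ), ← integral_const_mul]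
  refine integral_congr_ae (ae_of_all _ fun z => ?_)
  have h1 : ∀ x : ℝ, -b * Real.exp (x + -Real.log b) = -1 * Real.exp x := fun x => by
    rw [Real.exp_add, Real.exp_neg, Real.exp_log hb]
    field_simp
  have h2 : (√b)⁻¹ = Real.exp (-(1 / 2 * Real.log b)) := by
    rw [Real.sqrt_eq_rpow, Real.rpow_def_of_pos hb, Real.exp_neg, mul_comm]
  have h3 : (Real.exp (1 / 4 * (z.1 + -Real.log b)) * Real.exp (-1 * Real.exp z.1)) *
      (Real.exp (1 / 4 * (z.2 + -Real.log b)) * Real.exp (-1 * Real.exp z.2)) =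
      (√b)⁻¹ * gammaWeight (1 / 4) z := by
    rw [gammaWeight, h2]
    simp only [← Real.exp_add]
    congr 1
    ring
  simp only [Prod.fst_add, Prod.snd_add, h1]
  rw [h3, show z.1 + -Real.log b + (z.2 + -Real.log b) = z.1 + z.2 - 2 * Real.log b by ring]
  ring

/-- The summand of `logDiag`, cut off by the half-weighted Heaviside function. -/
noncomputable def diagTerm (p q : ℕ) (m : ℕ) (z : ℝ × ℝ) : ℝ :=
  if p ∣ m then 0 else
    (Real.exp (1 / 4 * z.1) * Real.exp (-(Real.pi * m ^ 2 / q) * Real.exp z.1)) *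
      (Real.exp (1 / 4 * z.2) * Real.exp (-(Real.pi * m ^ 2 / q) * Real.exp z.2)) *
      halfHeaviside (z.1 + z.2)

theorem diagTerm_nonneg (p q m : ℕ) (z : ℝ × ℝ) : 0 ≤ diagTerm p q m z := by
  rw [diagTerm]
  split_ifs
  · exact le_rfl
  · exact mul_nonneg (by positivity) (halfHeaviside_nonneg _)

/-- The Gaussian summand over the integers prime to `p`. -/
noncomputable def diagGauss (p q : ℕ) (s : ℝ) (m : ℤ) : ℝ :=
  if (p : ℤ) ∣ m then 0 else Real.exp (-Real.pi * m ^ 2 * s / q)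

theorem diagTerm_eq (p q m : ℕ) (z : ℝ × ℝ) : diagTerm p q m z =
    Real.exp ((z.1 + z.2) / 4) * halfHeaviside (z.1 + z.2) *
      diagGauss p q (Real.exp z.1 + Real.exp z.2) m := by
  rw [diagTerm, diagGauss]
  simp only [Int.natCast_dvd_natCast, Int.cast_natCast]
  split_ifs
  · rw [mul_zero]
  · rw [show -Real.pi * (m : ℝ) ^ 2 * (Real.exp z.1 + Real.exp z.2) / q =
      -(Real.pi * m ^ 2 / q) * Real.exp z.1 + -(Real.pi * m ^ 2 / q) * Real.exp z.2 by ring,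
      Real.exp_add, show (z.1 + z.2) / 4 = 1 / 4 * z.1 + 1 / 4 * z.2 by ring, Real.exp_add]
    ring

theorem tsum_int_of_even {g : ℤ → ℝ} (hg : Summable g) (h : ∀ m, g (-m) = g m) (h0 : g 0 = 0) :
    Summable (fun n : ℕ => g n) ∧ ∑' m, g m = 2 * ∑' n : ℕ, g n := by
  have h1 : Summable fun n : ℕ => g n := hg.comp_injective Nat.cast_injective
  have h3 : Summable fun n : ℕ => g ((n + 1 : ℕ) : ℤ) := (summable_nat_add_iff 1).mpr h1
  refine ⟨h1, ?_⟩
  have h5 : HasSum (fun n : ℕ => g (-((n : ℤ) + 1))) (∑' n : ℕ, g ((n + 1 : ℕ) : ℤ)) := by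
    simp only [h]
    exact_mod_cast h3.hasSum
  rw [(HasSum.of_nat_of_neg_add_one h1.hasSum h5).tsum_eq, h1.tsum_eq_zero_add, Nat.cast_zero, h0]
  ring

variable (p : ℕ) {q : ℕ} [NeZero q]

theorem integral_diagTerm (m : ℕ) : Integrable (diagTerm p q m) ∧ ∫ z, diagTerm p q m z =
    √(q / Real.pi) * ∫ z, weightedTerm p ((Real.log q - Real.log Real.pi) / 2) m z := by
  have hq : (0 : ℝ) < q := by exact_mod_cast Nat.pos_of_ne_zero (NeZero.ne q)
  by_cases h : p ∣ m
  · have : diagTerm p q m = fun _ => 0 := by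
      funext z
      rw [diagTerm, if_pos h]
    rw [this]
    refine ⟨integrable_zero _ _ _, ?_⟩
    simp [weightedTerm, h]
  have hm : (0 : ℝ) < m := by
    refine Nat.cast_pos.mpr (Nat.pos_of_ne_zero ?_)
    rintro rfl
    exact h (dvd_zero p)
  have hb : 0 < Real.pi * (m : ℝ) ^ 2 / q := by positivity
  have hm' : Measurable fun z : ℝ × ℝ => z.1 + z.2 := measurable_fst.add measurable_snd
  have h1 : diagTerm p q m = fun z =>
      (Real.exp (1 / 4 * z.1) * Real.exp (-(Real.pi * m ^ 2 / q) * Real.exp z.1)) *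
      (Real.exp (1 / 4 * z.2) * Real.exp (-(Real.pi * m ^ 2 / q) * Real.exp z.2)) *
      halfHeaviside (z.1 + z.2) := by
    funext z
    rw [diagTerm, if_neg h]
  rw [h1]
  refine ⟨(integral_exp_mul_exp_neg_prod (by norm_num) hb hb).1.mul_halfHeaviside hm', ?_⟩
  rw [integral_exp_scale hb, ← integral_const_mul, ← integral_const_mul]
  refine integral_congr_ae (ae_of_all _ fun z => ?_)
  simp only
  have h2 : (√(Real.pi * (m : ℝ) ^ 2 / q))⁻¹ = √(q / Real.pi) * (1 / m) := by
    rw [Real.sqrt_div (by positivity), Real.sqrt_mul Real.pi_pos.le, Real.sqrt_sq hm.le,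
      Real.sqrt_div hq.le]
    field_simp
  have h3 : z.1 + z.2 - 2 * Real.log (Real.pi * (m : ℝ) ^ 2 / q) =
      4 * ((Real.log q - Real.log Real.pi) / 2 + (z.1 + z.2) / 4 - Real.log m) := by
    rw [Real.log_div (by positivity) hq.ne', Real.log_mul Real.pi_pos.ne' (by positivity),
      Real.log_pow]
    push_cast
    ring
  rw [h2, h3, halfHeaviside_mul (by norm_num), weightedTerm, if_neg h, harmonicTerm]
  ring

theorem summable_diagGauss {s : ℝ} (hs : 0 < s) : Summable (diagGauss p q s) := by
  have hq : (0 : ℝ) < q := by exact_mod_cast Nat.pos_of_ne_zero (NeZero.ne q)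
  refine (summable_exp_neg_sq (div_pos hs hq)).of_nonneg_of_le (fun m => ?_) (fun m => ?_)
  · rw [diagGauss]
    split_ifs
    exacts [le_rfl, (Real.exp_pos _).le]
  · rw [diagGauss]
    split_ifs
    · exact (Real.exp_pos _).le
    · rw [← mul_div_assoc]

theorem tsum_diagGauss {s : ℝ} (hs : 0 < s) : Summable (fun n : ℕ => diagGauss p q s n) ∧
    ∑' m, diagGauss p q s m = 2 * ∑' n : ℕ, diagGauss p q s n :=
  tsum_int_of_even (summable_diagGauss p hs) (fun m => by
    simp only [diagGauss, dvd_neg, Int.cast_neg, neg_sq]) (by simp [diagGauss])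

theorem hasSum_diagTerm {z : ℝ × ℝ} : Summable (fun m => diagTerm p q m z) ∧
    logDiag p q z * halfHeaviside (z.1 + z.2) = 2 * ∑' m, diagTerm p q m z := by
  obtain ⟨h1, h2⟩ := tsum_diagGauss p (q := q) (s := Real.exp z.1 + Real.exp z.2) (by positivity)
  simp only [diagTerm_eq]
  refine ⟨h1.mul_left _, ?_⟩
  rw [tsum_mul_left, logDiag, diagKernel]
  simp only [diagGauss] at h2 ⊢
  rw [h2]
  ring

theorem integral_logDiag :
    Integrable (fun z : ℝ × ℝ => logDiag p q z * halfHeaviside (z.1 - z.2) *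
      halfHeaviside (z.1 + z.2)) ∧
    ∫ z : ℝ × ℝ, logDiag p q z * halfHeaviside (z.1 - z.2) * halfHeaviside (z.1 + z.2) =
      √(q / Real.pi) * ∫ z, ∑' m, weightedTerm p ((Real.log q - Real.log Real.pi) / 2) m z := by
  set T := (Real.log q - Real.log Real.pi) / 2 with hT
  have hm' : Measurable fun z : ℝ × ℝ => z.1 - z.2 := measurable_fst.sub measurable_snd
  obtain ⟨-, h1⟩ := integrable_tsum_of_nonneg (integrable_weightedTerm p T) (weightedTerm_nonneg p T)
    (fun z => (summable_not_dvd_harmonicTerm p _).mul_right _) (summable_integral_weightedTerm p T)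
  obtain ⟨h2, h3⟩ := integrable_tsum_of_nonneg (fun m => (integral_diagTerm p (q := q) m).1)
    (diagTerm_nonneg p q) (fun z => (hasSum_diagTerm p).1) (by
      simp only [(integral_diagTerm p (q := q) _).2]
      exact (summable_integral_weightedTerm p T).mul_left _)
  simp only [(integral_diagTerm p (q := q) _).2] at h3
  rw [tsum_mul_left, ← hT, ← h1] at h3
  have h4 : ∀ z : ℝ × ℝ, logDiag p q z * halfHeaviside (z.1 - z.2) * halfHeaviside (z.1 + z.2) =
      2 * ((∑' m, diagTerm p q m z) * halfHeaviside (z.1 - z.2)) := fun z => by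
    rw [← mul_assoc, ← (hasSum_diagTerm p).2]
    ring
  simp only [h4]
  refine ⟨(h2.mul_halfHeaviside hm').const_mul 2, ?_⟩
  rw [integral_const_mul, ← h3]
  refine (integral_eq_two_mul_halfHeaviside h2 hm' (T := Prod.swap) integral_comp_swap
    (fun z => tsum_congr fun m => ?_) (fun z => by simp)).symm
  simp only [diagTerm, Prod.fst_swap, Prod.snd_swap]
  split_ifs
  · rfl
  · rw [add_comm z.2 z.1]
    ring

end DiagIntegral

section Assembly

open MeasureTheory

theorem abs_le_of_decomposition {w u φ S E M Y c sym sym₀ Y₀ A δ₁ δ₂ δ₃ δ₄ Z : ℝ}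
    (hw : 0 < w) (hu : 0 < u) (hφ : 0 ≤ φ)
    (hS : w * u * S = φ * (E + M + w * Y)) (hM : 2 * M = c * sym)
    (hE : φ / (w * u) * |E| ≤ δ₁) (hsym : φ / (2 * (w * u)) * (|c| * |sym - sym₀|) ≤ δ₂)
    (hA : |φ / (2 * (w * u)) * (c * sym₀) - A| ≤ δ₃) (hY : φ / u * |Y - Y₀| ≤ δ₄)
    (hZ : Z = φ / u * Y₀) : |S - Z - A| ≤ δ₁ + δ₂ + δ₃ + δ₄ := by
  have h1 : S - Z - A = φ / (w * u) * E + φ / (2 * (w * u)) * (c * (sym - sym₀)) +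
      (φ / (2 * (w * u)) * (c * sym₀) - A) + φ / u * (Y - Y₀) := by
    have hM' : M = c * sym / 2 := by linarith
    have hS' : S = φ * (E + M + w * Y) / (w * u) := by
      rw [eq_div_iff (by positivity), ← hS]
      ring
    rw [hS', hM', hZ]
    field_simp
    ring
  rw [h1]
  refine (abs_add_le _ _).trans (add_le_add ((abs_add_le _ _).trans (add_le_add
    ((abs_add_le _ _).trans (add_le_add ?_ ?_)) hA)) ?_)
  · rwa [abs_mul, abs_of_nonneg (by positivity)]
  · rwa [abs_mul, abs_mul, abs_of_nonneg (show 0 ≤ φ / (2 * (w * u)) by positivity)]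
  · rwa [abs_mul, abs_of_nonneg (by positivity)]

theorem totient_prime_pow_div {p N : ℕ} (hp : p.Prime) (hN : ∃ e, e ≠ 0 ∧ N = p ^ e) :
    (N.totient : ℝ) / N = 1 - 1 / p := by
  obtain ⟨e, he, rfl⟩ := hN
  have hp0 : (p : ℝ) ≠ 0 := by exact_mod_cast hp.ne_zero
  rw [Nat.totient_prime_pow hp (Nat.pos_of_ne_zero he)]
  obtain ⟨e, rfl⟩ := Nat.exists_eq_succ_of_ne_zero he
  push_cast [Nat.cast_sub hp.one_le]
  rw [Nat.succ_eq_add_one, pow_succ]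
  field_simp

theorem abs_one_sub_cos_le (x : ℝ) : |Real.cos x - 1| ≤ |x| := by
  have h := Real.abs_sin_le_abs (x := x / 2)
  have h1 : Real.cos x - 1 = -(2 * Real.sin (x / 2) ^ 2) := by
    rw [Real.sin_sq_eq_half_sub, mul_div_cancel₀ x two_ne_zero]
    ring
  rw [h1, abs_neg, abs_of_nonneg (by positivity), ← sq_abs]
  have h2 := Real.abs_sin_le_one (x / 2)
  rw [abs_div, abs_two] at h
  nlinarith [abs_nonneg (Real.sin (x / 2))]

variable {p q q₀ Q : ℕ} [NeZero q] [NeZero q₀] [NeZero Q] {χ : DirichletCharacter ℂ q} {a : ℤ}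

open Classical in
/-- The normalised second moment, split along the decomposition of `logKernel`. -/
theorem IsCosetData.secondMoment_eq (D : IsCosetData p q q₀ Q χ a) (he : χ.Even) :
    √(q / Real.pi) * Real.Gamma (1 / 4) ^ 2 *
        ∑ ψ : DirichletCharacter ℂ q₀, (if ψ.Even then
          ‖(χ * DirichletCharacter.changeLevel D.dvd ψ).LFunction (1 / 2)‖ ^ 2 else 0) =
      q₀.totient * ((∫ z : ℝ × ℝ, (logKernel p q q₀ Q a z - logDiag p q z - logMain q q₀ Q a z) *
          halfHeaviside (z.1 - z.2) * halfHeaviside (z.1 + z.2)) +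
        (∫ z : ℝ × ℝ, logMain q q₀ Q a z * halfHeaviside (z.1 - z.2) *
          halfHeaviside (z.1 + z.2)) +
        √(q / Real.pi) * ∫ z, ∑' m, weightedTerm p ((Real.log q - Real.log Real.pi) / 2) m z) := by
  have hm : Measurable fun z : ℝ × ℝ => z.1 + z.2 := measurable_fst.add measurable_snd
  have hm' : Measurable fun z : ℝ × ℝ => z.1 - z.2 := measurable_fst.sub measurable_snd
  obtain ⟨h1, h2⟩ := D.integral_logKernel he
  obtain ⟨h3, -⟩ := integral_logMain (q := q) q₀ Q D.ne_zero
  obtain ⟨h5, h6⟩ := integral_logDiag p (q := q)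
  have h7 := (h1.mul_halfHeaviside hm').mul_halfHeaviside hm
  have h8 : ∀ z : ℝ × ℝ, (logKernel p q q₀ Q a z - logDiag p q z - logMain q q₀ Q a z) *
      halfHeaviside (z.1 - z.2) * halfHeaviside (z.1 + z.2) =
      logKernel p q q₀ Q a z * halfHeaviside (z.1 - z.2) * halfHeaviside (z.1 + z.2) -
      logDiag p q z * halfHeaviside (z.1 - z.2) * halfHeaviside (z.1 + z.2) -
      logMain q q₀ Q a z * halfHeaviside (z.1 - z.2) * halfHeaviside (z.1 + z.2) := fun z => by ring
  simp only [h8]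
  have h9 : Integrable fun z : ℝ × ℝ =>
      logKernel p q q₀ Q a z * halfHeaviside (z.1 - z.2) * halfHeaviside (z.1 + z.2) -
      logDiag p q z * halfHeaviside (z.1 - z.2) * halfHeaviside (z.1 + z.2) := h7.sub h5
  rw [integral_sub h9 h3, integral_sub h7 h5, ← h6]
  rw [integral_eq_four_mul_halfHeaviside h1 D.logKernel_swap D.logKernel_neg_swap] at h2
  linear_combination (-1 / 4 : ℝ) * h2

theorem IsCosetData.le_sqrt (D : IsCosetData p q q₀ Q χ a) : (Q : ℝ) ≤ √q := by
  refine Real.le_sqrt_of_sq_le ?_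
  have h := Nat.le_of_dvd (Nat.pos_of_ne_zero (NeZero.ne q₀)) D.Q_dvd
  have h1 : Q ^ 2 ≤ q := by
    rw [D.q_eq, sq]
    exact Nat.mul_le_mul_right Q h
  exact_mod_cast h1

theorem IsCosetData.sqrt_div (D : IsCosetData p q q₀ Q χ a) :
    √((Q : ℝ) / q₀) = √q / q₀ ∧ √((Q : ℝ) / q₀) ≤ 1 := by
  have h0 : (0 : ℝ) < q₀ := by exact_mod_cast Nat.pos_of_ne_zero (NeZero.ne q₀)
  have h := Nat.le_of_dvd (Nat.pos_of_ne_zero (NeZero.ne q₀)) D.Q_dvd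
  constructor
  · rw [D.q_eq, Nat.cast_mul, Real.sqrt_mul h0.le, Real.sqrt_div (Nat.cast_nonneg _),
      div_eq_div_iff (by positivity) h0.ne']
    linear_combination (-√(Q : ℝ)) * Real.mul_self_sqrt h0.le
  · rw [Real.sqrt_le_one, div_le_one h0]
    exact_mod_cast h

theorem IsCosetData.diagonal_eq (D : IsCosetData p q q₀ Q χ a) :
    (q₀.totient : ℝ) / 2 * (q.totient / q) * (Real.log q + 2 * Real.eulerMascheroniConstant
      + deriv Real.Gamma (1 / 4) / Real.Gamma (1 / 4) - Real.log Real.pi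
      + 2 * Real.log p / (p - 1)) =
    q₀.totient / Real.Gamma (1 / 4) ^ 2 *
      (((1 - 1 / p) * ((Real.log q - Real.log Real.pi) / 2 + Real.eulerMascheroniConstant) +
        Real.log p / p) * Real.Gamma (1 / 4) ^ 2 +
        2 * ((1 - 1 / p) / 4) * (Real.Gamma (1 / 4) * deriv Real.Gamma (1 / 4))) := by
  have hg : Real.Gamma (1 / 4) ≠ 0 := (Real.Gamma_pos_of_pos (by norm_num)).ne'
  have hp : (1 : ℝ) < p := by exact_mod_cast D.prime.one_lt
  have hp1 : (p : ℝ) - 1 ≠ 0 := by linarith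
  have hp0 : (p : ℝ) ≠ 0 := by linarith
  rw [totient_prime_pow_div D.prime D.exists_q_eq]
  field_simp
  ring

/-- The implied constant, in terms of a constant for the divisor bound. -/
noncomputable def momentConst (ε C : ℝ) : ℝ :=
  √Real.pi / Real.Gamma (1 / 4) ^ 2 * (68 * C * (4 / ε) ^ 2) +
    √Real.pi / Real.Gamma (1 / 4) ^ 2 * (C * Real.Gamma (ε / 2) ^ 2) +
    C * Real.pi + 8 * Real.pi ^ (1 / 4 : ℝ) * Real.Gamma (1 / 8) ^ 2 / Real.Gamma (1 / 4) ^ 2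

open Classical in
theorem IsCosetData.abs_secondMoment_sub_le (D : IsCosetData p q q₀ Q χ a) (he : χ.Even)
    (ha : 2 * |a| < Q) {ε C : ℝ} (hε : 0 < ε) (hε1 : ε ≤ 1 / 2) (hC1 : 1 ≤ C)
    (hC : ∀ n : ℕ, n ≠ 0 → (n.divisors.card : ℝ) ≤ C * (n : ℝ) ^ ε) :
    |(∑ ψ : DirichletCharacter ℂ q₀, (if ψ.Even then
        ‖(χ * DirichletCharacter.changeLevel D.dvd ψ).LFunction (1 / 2)‖ ^ 2 else 0)) -
      (q₀.totient : ℝ) / 2 * (q.totient / q) * (Real.log q + 2 * Real.eulerMascheroniConstant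
        + deriv Real.Gamma (1 / 4) / Real.Gamma (1 / 4) - Real.log Real.pi
        + 2 * Real.log p / (p - 1)) -
      (q₀.totient : ℝ) / q₀ * √q * (a.natAbs.divisors.card / √|(a : ℝ)|)| ≤
      momentConst ε C * (q : ℝ) ^ (-(1 / 8 : ℝ) + 2 * ε) * q₀ := by
  have hq : (0 : ℝ) < q := by exact_mod_cast Nat.pos_of_ne_zero (NeZero.ne q)
  have hq1 : (1 : ℝ) ≤ q := by exact_mod_cast Nat.pos_of_ne_zero (NeZero.ne q)
  have hq0 : (0 : ℝ) < q₀ := by exact_mod_cast Nat.pos_of_ne_zero (NeZero.ne q₀)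
  have hg : 0 < Real.Gamma (1 / 4) := Real.Gamma_pos_of_pos (by norm_num)
  have hC0 : 0 < C := by linarith
  have hφ : (q₀.totient : ℝ) ≤ q₀ := by exact_mod_cast Nat.totient_le q₀
  have ha1 : 1 ≤ |(a : ℝ)| := by exact_mod_cast Int.one_le_abs D.ne_zero
  have haQ : 2 * |(a : ℝ)| < Q := by exact_mod_cast ha
  have haq : 2 * |(a : ℝ)| ≤ √q := haQ.le.trans D.le_sqrt
  have hsq : √(q : ℝ) ≤ q := by
    rw [Real.sqrt_le_left hq.le]
    nlinarith
  have hd : (a.natAbs.divisors.card : ℝ) ≤ C * (q : ℝ) ^ ε := by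
    have h1 : (a.natAbs : ℝ) ≤ q := by
      rw [Nat.cast_natAbs, Int.cast_abs]
      linarith
    exact (hC _ (Int.natAbs_ne_zero.mpr D.ne_zero)).trans (by gcongr)
  have hπ : √((q : ℝ) / Real.pi) = √q / √Real.pi := Real.sqrt_div hq.le _
  have hw : 0 < √((q : ℝ) / Real.pi) := by positivity
  have hsπ : 0 < √Real.pi := Real.sqrt_pos.mpr Real.pi_pos
  have hsq0 : 0 < √(q : ℝ) := Real.sqrt_pos.mpr hq
  have hsq' : (√(q : ℝ))⁻¹ = q ^ (-(1 / 2) : ℝ) := by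
    rw [Real.sqrt_eq_rpow, Real.rpow_neg hq.le]
  have hc : |√((Q : ℝ) / q₀) * Real.cos (2 * Real.pi * a / q)| ≤ 1 := by
    rw [abs_mul, abs_of_nonneg (Real.sqrt_nonneg _)]
    exact mul_le_one₀ D.sqrt_div.2 (abs_nonneg _) (Real.abs_cos_le_one _)
  refine (abs_le_of_decomposition hw (pow_pos hg 2) (Nat.cast_nonneg _) (D.secondMoment_eq he)
    (integral_logMain (q := q) q₀ Q D.ne_zero).2
    (δ₁ := √Real.pi / Real.Gamma (1 / 4) ^ 2 * (68 * C * (4 / ε) ^ 2) *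
      (q : ℝ) ^ (-(1 / 8 : ℝ) + 2 * ε) * q₀)
    (δ₂ := √Real.pi / Real.Gamma (1 / 4) ^ 2 * (C * Real.Gamma (ε / 2) ^ 2) *
      (q : ℝ) ^ (-(1 / 8 : ℝ) + 2 * ε) * q₀)
    (δ₃ := C * Real.pi * (q : ℝ) ^ (-(1 / 8 : ℝ) + 2 * ε) * q₀)
    (δ₄ := 8 * Real.pi ^ (1 / 4 : ℝ) * Real.Gamma (1 / 8) ^ 2 / Real.Gamma (1 / 4) ^ 2 *
      (q : ℝ) ^ (-(1 / 8 : ℝ) + 2 * ε) * q₀)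
    (sym₀ := 2 * a.natAbs.divisors.card * (√q / √|(a : ℝ)| * (Real.Gamma (1 / 4) ^ 2 / √Real.pi)))
    ?_ ?_ ?_ ?_ D.diagonal_eq).trans (le_of_eq (by rw [momentConst]; ring))
  · have h1 := D.abs_integral_logKernel_sub_le ha hε (by linarith) hC1 hC
    calc _ ≤ (q₀ : ℝ) / (√((q : ℝ) / Real.pi) * Real.Gamma (1 / 4) ^ 2) *
          (68 * C * q ^ (3 / 8 + 2 * ε) * (4 / ε) ^ 2) := by gcongr
      _ = √Real.pi / Real.Gamma (1 / 4) ^ 2 * (68 * C * (4 / ε) ^ 2) *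
          ((√(q : ℝ))⁻¹ * q ^ (3 / 8 + 2 * ε)) * q₀ := by
        rw [hπ]
        field_simp
      _ ≤ _ := by
        rw [hsq', ← Real.rpow_add hq]
        exact mul_le_mul_of_nonneg_right (mul_le_mul_of_nonneg_left
          (Real.rpow_le_rpow_of_exponent_le hq1 (by linarith)) (by positivity)) hq0.le
  · have h1 := abs_integral_symMain_sub_le (q := q) D.ne_zero (half_pos hε) (by linarith)
    calc _ ≤ (q₀ : ℝ) / (2 * (√((q : ℝ) / Real.pi) * Real.Gamma (1 / 4) ^ 2)) *
          (1 * (2 * (C * (q : ℝ) ^ ε) * (q ^ (2 * (ε / 2)) * Real.Gamma (ε / 2) ^ 2))) := by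
          gcongr
          exact h1.trans (by gcongr)
      _ = √Real.pi / Real.Gamma (1 / 4) ^ 2 * (C * Real.Gamma (ε / 2) ^ 2) *
          ((√(q : ℝ))⁻¹ * (q ^ ε * q ^ (2 * (ε / 2)))) * q₀ := by
        rw [hπ]
        field_simp
      _ ≤ _ := by
        rw [hsq', ← Real.rpow_add hq, ← Real.rpow_add hq]
        exact mul_le_mul_of_nonneg_right (mul_le_mul_of_nonneg_left
          (Real.rpow_le_rpow_of_exponent_le hq1 (by linarith)) (by positivity)) hq0.le
  · have hsa : 1 ≤ √|(a : ℝ)| := Real.one_le_sqrt.mpr ha1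
    have h1 : (q₀.totient : ℝ) / (2 * (√((q : ℝ) / Real.pi) * Real.Gamma (1 / 4) ^ 2)) *
        (√((Q : ℝ) / q₀) * Real.cos (2 * Real.pi * a / q) *
        (2 * a.natAbs.divisors.card * (√q / √|(a : ℝ)| * (Real.Gamma (1 / 4) ^ 2 / √Real.pi)))) -
        (q₀.totient : ℝ) / q₀ * √q * (a.natAbs.divisors.card / √|(a : ℝ)|) =
        (q₀.totient : ℝ) * √((Q : ℝ) / q₀) * (a.natAbs.divisors.card / √|(a : ℝ)|) *
          (Real.cos (2 * Real.pi * a / q) - 1) := by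
      rw [hπ, D.sqrt_div.1]
      field_simp
    have h2 : |Real.cos (2 * Real.pi * a / q) - 1| ≤ Real.pi * (√(q : ℝ))⁻¹ := by
      refine (abs_one_sub_cos_le _).trans ?_
      rw [abs_div, abs_mul, abs_of_pos (show 0 < 2 * Real.pi by positivity), Nat.abs_cast,
        div_le_iff₀ hq]
      calc 2 * Real.pi * |(a : ℝ)| = Real.pi * (2 * |(a : ℝ)|) := by ring
        _ ≤ Real.pi * √q := by gcongr
        _ = Real.pi * (√(q : ℝ))⁻¹ * q := by
          nth_rewrite 3 [← Real.mul_self_sqrt hq.le]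
          field_simp
    rw [h1, abs_mul, abs_of_nonneg (by positivity)]
    calc _ ≤ (q₀ : ℝ) * 1 * ((C * (q : ℝ) ^ ε) / 1) * (Real.pi * (√(q : ℝ))⁻¹) := by
          gcongr
          exact D.sqrt_div.2
      _ = C * Real.pi * ((√(q : ℝ))⁻¹ * q ^ ε) * q₀ := by ring
      _ ≤ _ := by
        rw [hsq', ← Real.rpow_add hq]
        exact mul_le_mul_of_nonneg_right (mul_le_mul_of_nonneg_left
          (Real.rpow_le_rpow_of_exponent_le hq1 (by linarith)) (by positivity)) hq0.le
  · have h1 := abs_integral_tsum_weightedTerm_sub_le D.prime.one_le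
      ((Real.log q - Real.log Real.pi) / 2)
    have h2 : Real.exp (-(1 / 2) * ((Real.log q - Real.log Real.pi) / 2)) =
        q ^ (-(1 / 4) : ℝ) * Real.pi ^ (1 / 4 : ℝ) := by
      rw [Real.rpow_def_of_pos hq, Real.rpow_def_of_pos Real.pi_pos, ← Real.exp_add]
      congr 1
      ring
    rw [h2] at h1
    calc _ ≤ (q₀ : ℝ) / Real.Gamma (1 / 4) ^ 2 *
          (8 * (q ^ (-(1 / 4) : ℝ) * Real.pi ^ (1 / 4 : ℝ)) * Real.Gamma (1 / 8) ^ 2) := by gcongr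
      _ = 8 * Real.pi ^ (1 / 4 : ℝ) * Real.Gamma (1 / 8) ^ 2 / Real.Gamma (1 / 4) ^ 2 *
          q ^ (-(1 / 4) : ℝ) * q₀ := by ring
      _ ≤ _ := by
        exact mul_le_mul_of_nonneg_right (mul_le_mul_of_nonneg_left
          (Real.rpow_le_rpow_of_exponent_le hq1 (by linarith)) (by positivity)) hq0.le

end Assembly

theorem eN_eq_stdAddChar (q : ℕ) [NeZero q] (x : ℤ) : eN q x = ZMod.stdAddChar (x : ZMod q) :=
  (ZMod.stdAddChar_coe x).symm

theorem not_isPrimitive_of_forall_eq_one {p k d : ℕ} (hp : p.Prime) (hd : d < k)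
    {χ : DirichletCharacter ℂ (p ^ k)}
    (h : ∀ y : ℤ, χ ((1 + p ^ d * y : ℤ) : ZMod (p ^ k)) = 1) : ¬ χ.IsPrimitive := by
  have : NeZero (p ^ k) := ⟨pow_ne_zero k hp.ne_zero⟩
  intro hχ
  have hdvd : p ^ d ∣ p ^ k := pow_dvd_pow p hd.le
  have h1 : χ.FactorsThrough (p ^ d) := by
    rw [DirichletCharacter.factorsThrough_iff_ker_unitsMap hdvd]
    intro u hu
    rw [MonoidHom.mem_ker] at hu ⊢
    have h2 : ((u : ZMod (p ^ k)).val : ZMod (p ^ d)) = 1 := by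
      have h3 := congrArg Units.val hu
      rw [ZMod.unitsMap_val, Units.val_one] at h3
      rwa [ZMod.natCast_val]
    have h3 : (p ^ d : ℤ) ∣ ((u : ZMod (p ^ k)).val : ℤ) - 1 := by
      rw [← Int.natCast_pow, ← ZMod.intCast_zmod_eq_zero_iff_dvd]
      push_cast
      rw [h2, sub_self]
    obtain ⟨y, hy⟩ := h3
    have h4 := h y
    rw [← hy, add_sub_cancel, Int.cast_natCast, ZMod.natCast_zmod_val] at h4
    rw [Units.ext_iff, MulChar.coe_toUnitHom, h4, Units.val_one]
  have h2 := DirichletCharacter.conductor_dvd_of_mem_conductorSet (χ := χ) h1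
  rw [hχ] at h2
  exact absurd ((Nat.pow_dvd_pow_iff_le_right hp.one_lt).mp h2) (by omega)

theorem not_dvd_of_isPrimitive {p j k : ℕ} (hp : p.Prime) (hj : 0 < j) (hjk : j < k)
    {χ : DirichletCharacter ℂ (p ^ k)} (hχ : χ.IsPrimitive) {a : ℤ}
    (ha : ∀ x : ℤ, χ ((1 + p ^ j * x : ℤ) : ZMod (p ^ k)) = eN (p ^ (k - j)) (a * x)) :
    ¬ (p : ℤ) ∣ a := by
  rintro ⟨b, rfl⟩
  have : NeZero (p ^ (k - j)) := ⟨pow_ne_zero _ hp.ne_zero⟩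
  refine not_isPrimitive_of_forall_eq_one hp (Nat.sub_one_lt_of_lt hjk) (fun y => ?_) hχ
  have h1 : (p ^ (k - 1) * y : ℤ) = p ^ j * (p ^ (k - 1 - j) * y) := by
    rw [← mul_assoc, ← pow_add, show j + (k - 1 - j) = k - 1 by omega]
  have h2 : (p * b * (p ^ (k - 1 - j) * y) : ℤ) = ((p ^ (k - j) : ℕ) : ℤ) * (b * y) := by
    rw [show k - j = k - 1 - j + 1 by omega]
    push_cast
    ring
  rw [h1, ha, h2, eN_eq_stdAddChar, Int.cast_mul, Int.cast_natCast, ZMod.natCast_self, zero_mul,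
    AddChar.map_zero_eq_one]

theorem isCosetData_of_isPrimitive {p j k : ℕ} [NeZero (p ^ k)] [NeZero (p ^ j)]
    [NeZero (p ^ (k - j))] (hp : p.Prime) (hodd : Odd p) (hj : 0 < j) (hjk : j < k)
    (hkj : k ≤ 2 * j) {χ : DirichletCharacter ℂ (p ^ k)} (hχ : χ.IsPrimitive) {a : ℤ}
    (ha : ∀ x : ℤ, χ ((1 + p ^ j * x : ℤ) : ZMod (p ^ k)) = eN (p ^ (k - j)) (a * x)) :
    IsCosetData p (p ^ k) (p ^ j) (p ^ (k - j)) χ a where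
  prime := hp
  ne_two := by rintro rfl; exact absurd hodd (by decide)
  q₀_eq := ⟨j, hj.ne', rfl⟩
  Q_eq := ⟨k - j, by omega, rfl⟩
  q_eq := by rw [← pow_add, Nat.add_sub_cancel' hjk.le]
  Q_dvd := pow_dvd_pow p (by omega)
  map_one_add x := by rw [← eN_eq_stdAddChar, ← ha]; push_cast; rfl
  not_dvd := not_dvd_of_isPrimitive hp hj hjk hχ ha

open Classical in
/-- Second moment asymptotic along a coset, `j < k ≤ 2j` (Garcia--Young, Theorem 1.1). -/
theorem second_moment_coset_asymptotic :
    ∀ ε : ℝ, 0 < ε → ∃ C : ℝ, 0 < C ∧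
      ∀ (p j k : ℕ) (hp : p.Prime), Odd p → 0 < j → ∀ (hjk : j < k), k ≤ 2 * j →
      ∀ (χ : DirichletCharacter ℂ (p ^ k)), χ.IsPrimitive → χ.Even →
      ∀ a : ℤ, |(a : ℝ)| < (p ^ k : ℝ) / (2 * p ^ j) →
        (∀ x : ℤ, χ ((1 + p ^ j * x : ℤ) : ZMod (p ^ k)) = eN (p ^ (k - j)) (a * x)) →
        haveI : NeZero (p ^ k) := ⟨pow_ne_zero k hp.ne_zero⟩
        ¬ ((p : ℤ) ∣ a) ∧
        |(∑ ψ : DirichletCharacter ℂ (p ^ j),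
            if ψ.Even then
              ‖(χ * DirichletCharacter.changeLevel (pow_dvd_pow p hjk.le) ψ).LFunction
                  (1 / 2)‖ ^ 2
            else 0)
          - ((p ^ j).totient : ℝ) / 2 * ((p ^ k).totient / (p ^ k : ℝ)) *
              (Real.log (p ^ k) + 2 * Real.eulerMascheroniConstant
                + deriv Real.Gamma (1 / 4) / Real.Gamma (1 / 4)
                - Real.log Real.pi + 2 * Real.log p / (p - 1))
          - ((p ^ j).totient : ℝ) / (p ^ j) * Real.sqrt (p ^ k) *
              ((a.natAbs.divisors.card : ℝ) / Real.sqrt a.natAbs)|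
        ≤ C * (p ^ k : ℝ) ^ (-(1 / 8 : ℝ) + ε) * (p ^ j : ℝ) := by
  intro ε hε
  have hδ : 0 < min (ε / 2) (1 / 2) := lt_min (half_pos hε) (by norm_num)
  set δ := min (ε / 2) (1 / 2) with hδ_def
  have hδε : 2 * δ ≤ ε := by linarith [min_le_left (ε / 2) (1 / 2 : ℝ)]
  obtain ⟨C, hC1, hC⟩ := exists_card_divisors_le_rpow hδ
  have hK : 0 < momentConst δ C := by
    have := Real.pi_pos
    unfold momentConst
    have h1 := Real.Gamma_pos_of_pos (show (0 : ℝ) < 1 / 4 by norm_num)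
    have h2 : 0 < C * Real.pi := by nlinarith
    positivity
  refine ⟨momentConst δ C, hK, fun p j k hp hodd hj hjk hkj χ hχ he a ha hax => ?_⟩
  have : NeZero (p ^ k) := ⟨pow_ne_zero k hp.ne_zero⟩
  have : NeZero (p ^ j) := ⟨pow_ne_zero j hp.ne_zero⟩
  have : NeZero (p ^ (k - j)) := ⟨pow_ne_zero _ hp.ne_zero⟩
  have hp0 : (0 : ℝ) < p := by exact_mod_cast hp.pos
  have D := isCosetData_of_isPrimitive hp hodd hj hjk hkj hχ hax
  refine ⟨D.not_dvd, ?_⟩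
  have haQ : 2 * |a| < ((p ^ (k - j) : ℕ) : ℤ) := by
    have h1 : (p : ℝ) ^ k = p ^ (k - j) * p ^ j := by
      rw [← pow_add, Nat.sub_add_cancel hjk.le]
    rw [h1, lt_div_iff₀ (by positivity)] at ha
    have h2 : 2 * |(a : ℝ)| < p ^ (k - j) :=
      lt_of_mul_lt_mul_right (by linarith) (pow_pos hp0 j).le
    exact_mod_cast h2
  have h := D.abs_secondMoment_sub_le he haQ hδ (min_le_right _ _) hC1 hC
  rw [← Int.cast_abs, ← Nat.cast_natAbs] at h
  push_cast at h
  have hpk : (1 : ℝ) ≤ p ^ k := one_le_pow₀ (by exact_mod_cast hp.one_le)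
  have hle : momentConst δ C * ((p : ℝ) ^ k) ^ (-(1 / 8 : ℝ) + 2 * δ) * p ^ j ≤
      momentConst δ C * ((p : ℝ) ^ k) ^ (-(1 / 8 : ℝ) + ε) * p ^ j :=
    mul_le_mul_of_nonneg_right (mul_le_mul_of_nonneg_left
      (Real.rpow_le_rpow_of_exponent_le hpk (by linarith)) hK.le) (by positivity)
  refine le_trans (le_of_eq ?_) (h.trans hle)
  congr!
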